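/- arXiv:math/9406215 — 8 statements merged into one kernel-verified Lean document; each statement's English description precedes it below -/
import Mathlib

section
/- Every separable metric space Lipschitz embeds into c₀. Precisely: if (M, d) is a separable metric space, then there exist a constant K ≥ 1 and a map f : M → c₀ (the space of real sequences converging to 0, with the sup norm, realized as the closed subspace {x ∈ lp (fun _ : ℕ => ℝ) ∞ | x n → 0} of ℓ_∞) such that K⁻¹ · d(x, y) ≤ ‖f x − f y‖ ≤ K · d(x, y) for all x, y ∈ M. -/
open Filter Topology ENNReal

/-- A bump of height at most `2 * r` around `u (j + 1)` that vanishes on the `r`-balls around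
`u 0, …, u j`. -/
noncomputable def separatingBump {M : Type*} [MetricSpace M] (u : ℕ → M) (r : ℝ) (j : ℕ)
    (x : M) : ℝ :=
  max 0 (min (2 * r - dist x (u (j + 1))) (Metric.infDist x (u '' Set.Iic j) - r))

namespace separatingBump

variable {M : Type*} [MetricSpace M] (u : ℕ → M) (r : ℝ) (j : ℕ)

lemma nonneg (x : M) : 0 ≤ separatingBump u r j x := le_max_left _ _

lemma le_two_mul (hr : 0 ≤ r) (x : M) : separatingBump u r j x ≤ 2 * r :=
  max_le (by positivity) <| (min_le_left _ _).trans (by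
    linarith [dist_nonneg (x := x) (y := u (j + 1))])

lemma abs_sub_le (x y : M) :
    |separatingBump u r j x - separatingBump u r j y| ≤ dist x y := by
  have one_sided (x y : M) : separatingBump u r j x ≤ separatingBump u r j y + dist x y := by
    have h₁ : dist y (u (j + 1)) ≤ dist x (u (j + 1)) + dist x y := by
      linarith [dist_triangle y x (u (j + 1)), dist_comm x y]
    have h₂ : Metric.infDist x (u '' Set.Iic j) ≤ Metric.infDist y (u '' Set.Iic j) + dist x y :=
      Metric.infDist_le_infDist_add_dist
    refine max_le (add_nonneg (nonneg u r j y) dist_nonneg) ?_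
    refine le_trans ?_ (add_le_add_left (le_max_right _ _) _)
    rw [min_add]
    exact min_le_min (by linarith) (by linarith)
  rw [abs_sub_le_iff]
  constructor
  · linarith [one_sided x y]
  · linarith [one_sided y x, dist_comm x y]

variable {u r j}

lemma lt_dist_of_pos {x : M} (h : 0 < separatingBump u r j x) {i : ℕ} (hi : i ≤ j) :
    r < dist x (u i) := by
  have h' := (lt_max_iff.1 h).resolve_left (lt_irrefl _)
  have := (lt_min_iff.1 h').2
  linarith [Metric.infDist_le_dist_of_mem (x := x) (Set.mem_image_of_mem u (Set.mem_Iic.2 hi))]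

lemma eq_zero_of_le_dist {x : M} (h : 2 * r ≤ dist x (u (j + 1))) :
    separatingBump u r j x = 0 :=
  max_eq_left ((min_le_left _ _).trans (by linarith))

/-- Any point far from `u 0` is seen by some bump, centred close to that point. -/
lemma exists_half_le (hu : DenseRange u) (hr : 0 < r) {x : M} (hx : 2 * r ≤ dist x (u 0)) :
    ∃ j, r / 2 ≤ separatingBump u r j x ∧ dist x (u (j + 1)) < 3 / 2 * r := by
  classical
  have hex : ∃ i, dist x (u i) < 3 / 2 * r := hu.exists_dist_lt x (by positivity)
  obtain ⟨j, hj⟩ : ∃ j, Nat.find hex = j + 1 := by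
    refine Nat.exists_eq_succ_of_ne_zero fun h0 => ?_
    have := Nat.find_spec hex
    rw [h0] at this
    linarith
  have hlt : dist x (u (j + 1)) < 3 / 2 * r := hj ▸ Nat.find_spec hex
  refine ⟨j, le_max_of_le_right (le_min (by linarith) ?_), hlt⟩
  have : 3 / 2 * r ≤ Metric.infDist x (u '' Set.Iic j) := by
    refine (Metric.le_infDist (Set.nonempty_Iic.image u)).2 ?_
    rintro _ ⟨i, hi, rfl⟩
    exact not_lt.1 (Nat.find_min hex (hj ▸ Nat.lt_succ_of_le hi))
  linarith

lemma exists_le_abs_sub (hu : DenseRange u) (hr : 0 < r) {x y : M} (hxy : 4 * r ≤ dist x y) :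
    ∃ j, r / 2 ≤ |separatingBump u r j x - separatingBump u r j y| := by
  wlog hx : 2 * r ≤ dist x (u 0) generalizing x y
  · have hy : 2 * r ≤ dist y (u 0) := by linarith [dist_triangle_right x y (u 0)]
    obtain ⟨j, hj⟩ := this (by rwa [dist_comm]) hy
    exact ⟨j, by rwa [abs_sub_comm]⟩
  obtain ⟨j, hj, hd⟩ := exists_half_le hu hr hx
  refine ⟨j, ?_⟩
  have hy : separatingBump u r j y = 0 :=
    eq_zero_of_le_dist (by linarith [dist_triangle_right x y (u (j + 1))])
  rw [hy, sub_zero]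
  exact hj.trans (le_abs_self _)

/-- At a given point, the bumps over all dyadic scales tend to zero. -/
lemma tendsto_cofinite (hu : DenseRange u) (x : M) :
    Tendsto (fun p : ℤ × ℕ => separatingBump u ((2 : ℝ) ^ p.1) p.2 x) cofinite (𝓝 0) := by
  rw [Metric.tendsto_nhds]
  intro ε hε
  obtain ⟨a, ha, -⟩ := exists_mem_Ico_zpow (half_pos hε) (_root_.one_lt_two (α := ℝ))
  obtain ⟨b, -, hb⟩ := exists_mem_Ico_zpow (x := dist x (u 0) + 1) (by positivity)
    (_root_.one_lt_two (α := ℝ))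
  choose i hi using fun k : ℤ => hu.exists_dist_lt x (zpow_pos (two_pos (α := ℝ)) k)
  rw [eventually_cofinite]
  refine ((Set.finite_Icc a (b + 1)).biUnion fun k _ =>
    (Set.finite_Iio (i k)).image (Prod.mk k)).subset ?_
  rintro ⟨k, j⟩ h
  have h : ε ≤ separatingBump u ((2 : ℝ) ^ k) j x := by
    simpa [Real.dist_eq, abs_of_nonneg (nonneg u _ j x)] using h
  have hpos := hε.trans_le h
  have hak : (2 : ℝ) ^ a ≤ 2 ^ k := by
    linarith [le_two_mul u ((2 : ℝ) ^ k) j (by positivity) x]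
  have hkb : (2 : ℝ) ^ k ≤ 2 ^ (b + 1) := by
    linarith [lt_dist_of_pos hpos (Nat.zero_le j)]
  have hji : j < i k := by
    by_contra! hij
    linarith [lt_dist_of_pos hpos hij, hi k]
  simp only [Set.mem_iUnion]
  exact ⟨k, ⟨(zpow_le_zpow_iff_right₀ _root_.one_lt_two).1 hak,
    (zpow_le_zpow_iff_right₀ _root_.one_lt_two).1 hkb⟩, j, hji, rfl⟩

end separatingBump

/-- (Aharoni) Every separable metric space Lipschitz embeds into `c₀`, realized as the
closed subspace of `ℓ_∞` of sequences tending to `0`. -/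
theorem aharoni_lipschitz_embedding_into_c0
    {M : Type*} [MetricSpace M] [TopologicalSpace.SeparableSpace M] :
    ∃ (K : ℝ) (f : M → lp (fun _ : ℕ => ℝ) ∞),
      1 ≤ K ∧
      (∀ m : M, Tendsto (fun n : ℕ => (f m : ∀ _ : ℕ, ℝ) n) atTop (𝓝 0)) ∧
      (∀ x y : M, K⁻¹ * dist x y ≤ ‖f x - f y‖ ∧ ‖f x - f y‖ ≤ K * dist x y) := by
  rcases isEmpty_or_nonempty M with hM | hM
  · exact ⟨1, isEmptyElim, le_rfl, isEmptyElim, isEmptyElim⟩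
  obtain ⟨u, hu⟩ := TopologicalSpace.exists_dense_seq M
  let e : ℕ ≃ ℤ × ℕ := (Denumerable.eqv (ℤ × ℕ)).symm
  let F (x : M) (n : ℕ) : ℝ := separatingBump u ((2 : ℝ) ^ (e n).1) (e n).2 x
  have hF (x : M) : Tendsto (F x) atTop (𝓝 0) := by
    rw [← Nat.cofinite_eq_atTop]
    exact (separatingBump.tendsto_cofinite hu x).comp e.injective.tendsto_cofinite
  let f (x : M) : lp (fun _ : ℕ => ℝ) ∞ := ⟨F x, memℓp_infty (hF x).norm.bddAbove_range⟩
  refine ⟨16, f, by norm_num, hF, fun x y => ⟨?_, ?_⟩⟩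
  · rcases eq_or_ne x y with rfl | hxy
    · simp
    have hd : 0 < dist x y := dist_pos.2 hxy
    obtain ⟨k, hk, hk'⟩ := exists_mem_Ico_zpow (x := dist x y / 4) (by positivity)
      (_root_.one_lt_two (α := ℝ))
    rw [zpow_add_one₀ two_ne_zero] at hk'
    obtain ⟨j, hj⟩ := separatingBump.exists_le_abs_sub hu (r := (2 : ℝ) ^ k) (by positivity)
      (x := x) (y := y) (by linarith)
    have hnorm := lp.norm_apply_le_norm ENNReal.top_ne_zero (f x - f y) (e.symm (k, j))
    have hcoord : ‖(f x - f y : lp (fun _ : ℕ => ℝ) ∞) (e.symm (k, j))‖ =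
        |separatingBump u ((2 : ℝ) ^ k) j x - separatingBump u ((2 : ℝ) ^ k) j y| := by
      change |F x _ - F y _| = _
      simp [F]
    linarith
  · refine lp.norm_le_of_forall_le (by positivity) fun n => ?_
    have hn : ‖(f x - f y : lp (fun _ : ℕ => ℝ) ∞) n‖ ≤ dist x y :=
      separatingBump.abs_sub_le u _ _ x y
    linarith [dist_nonneg (x := x) (y := y)]
end

section
/- For 1 ≤ p < ∞, the space L_p = L_p([0,1]) embeds uniformly into the Hilbert space ℓ₂ if and only if p ≤ 2. That is: there exists an injective map f : L_p → ℓ₂ such that f is uniformly continuous and for every ε > 0 there is δ > 0 with ‖f x − f y‖ ≤ δ implying ‖x − y‖ ≤ ε, if and only if p ≤ 2. -/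
open Filter Topology MeasureTheory

theorem Orthonormal.countable_of_separable {E ι : Type*} [NormedAddCommGroup E]
    [InnerProductSpace ℝ E] [TopologicalSpace.SeparableSpace E] {v : ι → E}
    (hv : Orthonormal ℝ v) : Countable ι := by
  have hd : Pairwise (Function.onFun Disjoint fun i => Metric.ball (v i) (1 / 2)) := by
    intro i j hij
    refine Metric.ball_disjoint_ball ?_
    rw [dist_eq_norm]
    have h : ‖v i - v j‖ ^ 2 = 2 := by
      rw [norm_sub_sq_real, hv.1 i, hv.1 j, hv.2 hij]; norm_num
    nlinarith [norm_nonneg (v i - v j)]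
  have := Set.PairwiseDisjoint.countable_of_isOpen (ι := ι) (a := Set.univ)
    (s := fun i => Metric.ball (v i) (1 / 2)) (fun i _ j _ h => hd h)
    (fun i _ => Metric.isOpen_ball) (fun i _ => ⟨v i, by simp⟩)
  exact Set.countable_univ_iff.mp this

theorem exists_linearIsometry_lp_two (E : Type*) [NormedAddCommGroup E] [InnerProductSpace ℝ E]
    [CompleteSpace E] [TopologicalSpace.SeparableSpace E] :
    Nonempty (E →ₗᵢ[ℝ] lp (fun _ : ℕ => ℝ) 2) := by
  obtain ⟨w, b, -⟩ := exists_hilbertBasis ℝ E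
  have := b.orthonormal.countable_of_separable
  obtain ⟨e, he⟩ := Countable.exists_injective_nat w
  let c : HilbertBasis ℕ ℝ (lp (fun _ : ℕ => ℝ) 2) := .ofRepr (.refl ℝ _)
  exact ⟨(c.orthonormal.comp e he).orthogonalFamily.linearIsometry.comp b.repr.toLinearIsometry⟩

theorem integrableOn_two_sub_two_cos_mul_rpow {p : ℝ} (hp : 0 < p) (hp2 : p < 2) :
    IntegrableOn (fun u : ℝ => (2 - 2 * Real.cos u) * u ^ (-1 - p)) (Set.Ioi 0) := by
  have hmeas : Measurable fun u : ℝ => (2 - 2 * Real.cos u) * u ^ (-1 - p) := by fun_prop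
  rw [← Set.Ioc_union_Ioi_eq_Ioi zero_le_one]
  refine IntegrableOn.union ?_ ?_
  · have h1 : IntegrableOn (fun u : ℝ => u ^ (1 - p)) (Set.Ioc 0 1) :=
      (intervalIntegrable_iff_integrableOn_Ioc_of_le zero_le_one).mp
        (intervalIntegral.intervalIntegrable_rpow' (by linarith))
    refine h1.mono' hmeas.aestronglyMeasurable
      ((ae_restrict_iff' measurableSet_Ioc).mpr (ae_of_all _ fun u hu => ?_))
    have hpos : 0 ≤ u ^ (-1 - p) := Real.rpow_nonneg hu.1.le _
    rw [Real.norm_of_nonneg (mul_nonneg (by linarith [Real.cos_le_one u]) hpos)]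
    calc (2 - 2 * Real.cos u) * u ^ (-1 - p) ≤ u ^ 2 * u ^ (-1 - p) := by
          gcongr
          linarith [Real.one_sub_sq_div_two_le_cos (x := u)]
      _ = u ^ (1 - p) := by
          rw [← Real.rpow_natCast u 2, ← Real.rpow_add hu.1]
          norm_num
          congr 1
          ring
  · have h1 := (integrableOn_Ioi_rpow_of_lt (a := -1 - p) (by linarith) one_pos).const_mul 4
    refine h1.mono' hmeas.aestronglyMeasurable
      ((ae_restrict_iff' measurableSet_Ioi).mpr (ae_of_all _ fun u hu => ?_))
    have hpos : 0 ≤ u ^ (-1 - p) := Real.rpow_nonneg (zero_le_one.trans (le_of_lt hu)) _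
    rw [Real.norm_of_nonneg (mul_nonneg (by linarith [Real.cos_le_one u]) hpos)]
    gcongr
    linarith [Real.neg_one_le_cos u]

theorem integral_two_sub_two_cos_mul_rpow_pos {p : ℝ} (hp : 0 < p) (hp2 : p < 2) :
    0 < ∫ u in Set.Ioi (0 : ℝ), (2 - 2 * Real.cos u) * u ^ (-1 - p) := by
  rw [setIntegral_pos_iff_support_of_nonneg_ae _ (integrableOn_two_sub_two_cos_mul_rpow hp hp2)]
  · have hsub : Set.Ioc (0 : ℝ) 1 ⊆
        (Function.support fun u : ℝ => (2 - 2 * Real.cos u) * u ^ (-1 - p)) ∩ Set.Ioi 0 := by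
      refine fun u hu => ⟨?_, hu.1⟩
      have h1 : Real.cos u < 1 := by
        simpa using Real.cos_lt_cos_of_nonneg_of_le_pi le_rfl
          (by linarith [hu.2, Real.pi_gt_three]) hu.1
      exact (mul_pos (by linarith) (Real.rpow_pos_of_pos hu.1 _)).ne'
    exact lt_of_lt_of_le (by simp) (measure_mono hsub)
  · refine (ae_restrict_iff' measurableSet_Ioi).mpr (ae_of_all _ fun u hu => ?_)
    exact mul_nonneg (by linarith [Real.cos_le_one u]) (Real.rpow_nonneg (le_of_lt hu) _)

theorem lintegral_two_sub_two_cos_mul_rpow {p : ℝ} (hp : 0 < p) (hp2 : p < 2) (t : ℝ) :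
    ∫⁻ u in Set.Ioi (0 : ℝ), ENNReal.ofReal ((2 - 2 * Real.cos (u * t)) * u ^ (-1 - p)) =
      ENNReal.ofReal (∫ u in Set.Ioi (0 : ℝ), (2 - 2 * Real.cos u) * u ^ (-1 - p)) *
        ‖t‖ₑ ^ p := by
  rcases eq_or_ne t 0 with rfl | ht
  · simp [hp]
  have ht' : 0 < |t| := abs_pos.mpr ht
  have hI := integrableOn_two_sub_two_cos_mul_rpow hp hp2
  have key : Set.EqOn (fun u : ℝ => (2 - 2 * Real.cos (u * t)) * u ^ (-1 - p))
      (fun u => |t| ^ (1 + p) * ((2 - 2 * Real.cos (|t| * u)) * (|t| * u) ^ (-1 - p)))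
      (Set.Ioi 0) := by
    intro u hu
    have hc : Real.cos (u * t) = Real.cos (|t| * u) := by
      rw [← Real.cos_abs (u * t), abs_mul, abs_of_pos hu, mul_comm]
    have h2 : |t| ^ (1 + p) * |t| ^ (-1 - p) = 1 := by
      rw [← Real.rpow_add ht']; ring_nf; simp
    simp only [hc]
    rw [Real.mul_rpow ht'.le (le_of_lt hu)]
    linear_combination (-(2 - 2 * Real.cos (|t| * u)) * u ^ (-1 - p)) * h2
  have hI' : IntegrableOn (fun u : ℝ =>
      |t| ^ (1 + p) * ((2 - 2 * Real.cos (|t| * u)) * (|t| * u) ^ (-1 - p))) (Set.Ioi 0) := by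
    refine Integrable.const_mul ?_ _
    have := (integrableOn_Ioi_comp_mul_left_iff
      (fun u : ℝ => (2 - 2 * Real.cos u) * u ^ (-1 - p)) 0 ht').mpr (by simpa using hI)
    exact this
  rw [← ofReal_integral_eq_lintegral_ofReal]
  · rw [setIntegral_congr_fun measurableSet_Ioi key, integral_const_mul,
      integral_comp_mul_left_Ioi (fun u : ℝ => (2 - 2 * Real.cos u) * u ^ (-1 - p)) 0 ht',
      mul_zero, smul_eq_mul, ← mul_assoc, mul_comm, ENNReal.ofReal_mul' (by positivity)]
    congr 1
    rw [← ofReal_norm, ENNReal.ofReal_rpow_of_nonneg (norm_nonneg _) hp.le, Real.norm_eq_abs,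
      Real.rpow_add ht', Real.rpow_one]
    congr 1
    field_simp
  · exact hI'.congr_fun key.symm measurableSet_Ioi
  · refine (ae_restrict_iff' measurableSet_Ioi).mpr (ae_of_all _ fun u hu => ?_)
    exact mul_nonneg (by linarith [Real.cos_le_one (u * t)]) (Real.rpow_nonneg (le_of_lt hu) _)

/-- The Fourier feature map, realising `|s - t| ^ p` as a squared `L²` distance. -/
noncomputable def fourierFeature (p : ℝ) (t u : ℝ) : ℂ :=
  (Complex.exp ((u * t : ℝ) * Complex.I) - 1) * ((u ^ (-(1 + p) / 2) : ℝ) : ℂ)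

theorem fourierFeature_zero (p u : ℝ) : fourierFeature p 0 u = 0 := by
  simp [fourierFeature]

theorem measurable_fourierFeature {α : Type*} [MeasurableSpace α] (p : ℝ) {F : α → ℝ}
    (hF : Measurable F) : Measurable fun z : α × ℝ => fourierFeature p (F z.1) z.2 := by
  unfold fourierFeature
  fun_prop

theorem enorm_fourierFeature_sub_sq {p u : ℝ} (hu : 0 < u) (s t : ℝ) :
    ‖fourierFeature p s u - fourierFeature p t u‖ₑ ^ (2 : ℝ) =
      ENNReal.ofReal ((2 - 2 * Real.cos (u * (s - t))) * u ^ (-1 - p)) := by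
  have h : ‖fourierFeature p s u - fourierFeature p t u‖ ^ (2 : ℝ) =
      (2 - 2 * Real.cos (u * (s - t))) * u ^ (-1 - p) := by
    unfold fourierFeature
    rw [← sub_mul, norm_mul, Real.mul_rpow (norm_nonneg _) (norm_nonneg _), Complex.norm_real,
      Real.norm_of_nonneg (Real.rpow_nonneg hu.le _), ← Real.rpow_mul hu.le]
    congr 1
    · rw [Real.rpow_two, Complex.sq_norm, Complex.normSq_apply, mul_sub, Real.cos_sub]
      simp [Complex.exp_ofReal_mul_I_re, Complex.exp_ofReal_mul_I_im, -Complex.ofReal_mul]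
      linear_combination Real.sin_sq_add_cos_sq (u * s) + Real.sin_sq_add_cos_sq (u * t)
    · congr 1; ring
  rw [← h, ← ofReal_norm, ENNReal.ofReal_rpow_of_nonneg (norm_nonneg _) (by norm_num)]

theorem lintegral_fourierFeature_sub {α : Type*} [MeasurableSpace α] (μ : Measure α) [SFinite μ]
    {p : ℝ} (hp : 0 < p) (hp2 : p < 2) {F G : α → ℝ} (hF : Measurable F) (hG : Measurable G) :
    ∫⁻ z, ‖fourierFeature p (F z.1) z.2 - fourierFeature p (G z.1) z.2‖ₑ ^ (2 : ℝ)
        ∂(μ.prod (volume.restrict (Set.Ioi (0 : ℝ)))) =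
      ENNReal.ofReal (∫ u in Set.Ioi (0 : ℝ), (2 - 2 * Real.cos u) * u ^ (-1 - p)) *
        ∫⁻ x, ‖F x - G x‖ₑ ^ p ∂μ := by
  have hFG : Measurable fun z : α × ℝ =>
      fourierFeature p (F z.1) z.2 - fourierFeature p (G z.1) z.2 :=
    (measurable_fourierFeature p hF).sub (measurable_fourierFeature p hG)
  rw [lintegral_prod _ (hFG.enorm.pow_const _).aemeasurable,
    ← lintegral_const_mul _ (by fun_prop)]
  refine lintegral_congr fun x => ?_
  rw [← lintegral_two_sub_two_cos_mul_rpow hp hp2]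
  exact setLIntegral_congr_fun measurableSet_Ioi fun u hu => enorm_fourierFeature_sub_sq hu _ _

theorem exists_map_Lp_norm_sub_eq_rpow {α : Type*} [MeasurableSpace α]
    [MeasurableSpace.CountablyGenerated α] (μ : Measure α)
    [SFinite μ] {p : ℝ} (hp : 0 < p) (hp2 : p < 2) [Fact (1 ≤ ENNReal.ofReal p)] :
    ∃ (f : Lp ℝ (ENNReal.ofReal p) μ → lp (fun _ : ℕ => ℝ) 2) (K : ℝ), 0 < K ∧
      ∀ x y, ‖f x - f y‖ = K * ‖x - y‖ ^ (p / 2) := by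
  let ν := μ.prod (volume.restrict (Set.Ioi (0 : ℝ)))
  set C := ∫ u in Set.Ioi (0 : ℝ), (2 - 2 * Real.cos u) * u ^ (-1 - p) with hC
  have hCpos : 0 < C := integral_two_sub_two_cos_mul_rpow_pos hp hp2
  have hp0 : ENNReal.ofReal p ≠ 0 := by simpa using hp
  have hnorm (F G : Lp ℝ (ENNReal.ofReal p) μ) :
      eLpNorm ((fun z : α × ℝ => fourierFeature p (F z.1) z.2) -
        fun z : α × ℝ => fourierFeature p (G z.1) z.2) 2 ν =
      ENNReal.ofReal (√C * ‖F - G‖ ^ (p / 2)) := by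
    have hFG : ∫⁻ x, ‖F x - G x‖ₑ ^ p ∂μ = ENNReal.ofReal (‖F - G‖ ^ p) := by
      rw [← ENNReal.ofReal_rpow_of_nonneg (norm_nonneg _) hp.le, ofReal_norm, Lp.enorm_def,
        eLpNorm_congr_ae (Lp.coeFn_sub F G),
        eLpNorm_eq_lintegral_rpow_enorm_toReal hp0 ENNReal.ofReal_ne_top,
        ENNReal.toReal_ofReal hp.le, ← ENNReal.rpow_mul, one_div, inv_mul_cancel₀ hp.ne',
        ENNReal.rpow_one]
      rfl
    rw [eLpNorm_eq_lintegral_rpow_enorm_toReal two_ne_zero ENNReal.ofNat_ne_top]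
    simp only [ENNReal.toReal_ofNat, Pi.sub_apply]
    rw [lintegral_fourierFeature_sub μ hp hp2 (Lp.stronglyMeasurable F).measurable
      (Lp.stronglyMeasurable G).measurable, hFG, ← ENNReal.ofReal_mul hCpos.le,
      ENNReal.ofReal_rpow_of_nonneg (by positivity) (by norm_num),
      Real.mul_rpow hCpos.le (by positivity), ← Real.rpow_mul (norm_nonneg _), Real.sqrt_eq_rpow]
    ring_nf
  have hmem (F : Lp ℝ (ENNReal.ofReal p) μ) :
      MemLp (fun z : α × ℝ => fourierFeature p (F z.1) z.2) 2 ν := by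
    have hF := (Lp.stronglyMeasurable F).measurable
    refine ⟨(measurable_fourierFeature p hF).aestronglyMeasurable, ?_⟩
    rw [eLpNorm_lt_top_iff_lintegral_rpow_enorm_lt_top two_ne_zero ENNReal.ofNat_ne_top]
    have h := lintegral_fourierFeature_sub μ hp hp2 hF (measurable_const (a := (0 : ℝ)))
    simp only [fourierFeature_zero, sub_zero] at h
    rw [ENNReal.toReal_ofNat, h]
    have hfin := lintegral_rpow_enorm_lt_top_of_eLpNorm_lt_top hp0 ENNReal.ofReal_ne_top
      (Lp.eLpNorm_lt_top F)
    rw [ENNReal.toReal_ofReal hp.le] at hfin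
    exact ENNReal.mul_lt_top ENNReal.ofReal_lt_top hfin
  have : Fact ((2 : ENNReal) ≠ ⊤) := ⟨ENNReal.ofNat_ne_top⟩
  have : IsSeparable ν := inferInstance
  obtain ⟨J⟩ := exists_linearIsometry_lp_two (Lp ℂ 2 ν)
  refine ⟨fun F => J (hmem F).toLp, √C, Real.sqrt_pos.mpr hCpos, fun F G => ?_⟩
  rw [← map_sub, J.norm_map, ← MemLp.toLp_sub, Lp.norm_toLp, hnorm,
    ENNReal.toReal_ofReal (by positivity)]

section Cotype

variable {G W : Type*} [AddCommGroup G] [NormedAddCommGroup W] [InnerProductSpace ℝ W]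

/-- The composition of the averages `w ↦ (w + τ (e j) w) / 2` over `j < r`. -/
noncomputable def halfAverage (τ : G → W →ₗᵢ[ℝ] W) (e : ℕ → G) : ℕ → W → W
  | 0, w => w
  | r + 1, w => halfAverage τ e r ((1 / 2 : ℝ) • (w + τ (e r) w))

theorem norm_half_add_isometry_sq (T : W →ₗᵢ[ℝ] W) (w : W) :
    ‖(1 / 2 : ℝ) • (w + T w)‖ ^ 2 = ‖w‖ ^ 2 - 1 / 4 * ‖T w - w‖ ^ 2 := by
  rw [norm_smul, mul_pow, norm_add_sq_real, norm_sub_sq_real, T.norm_map, real_inner_comm]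
  norm_num
  ring

theorem norm_nsmul_action_sub_le {τ : G → W →ₗᵢ[ℝ] W} (h0 : ∀ w, τ 0 w = w)
    (hadd : ∀ a b w, τ (a + b) w = τ a (τ b w)) (a : G) (w : W) (k : ℕ) :
    ‖τ (k • a) w - w‖ ≤ k * ‖τ a w - w‖ := by
  induction k with
  | zero => simp [h0]
  | succ k ih =>
    have h : τ ((k + 1) • a) w - w = τ (k • a) (τ a w - w) + (τ (k • a) w - w) := by
      rw [succ_nsmul, hadd, map_sub]; abel
    calc ‖τ ((k + 1) • a) w - w‖ ≤ ‖τ a w - w‖ + k * ‖τ a w - w‖ := by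
          rw [h]
          refine (norm_add_le _ _).trans ?_
          rw [LinearIsometry.norm_map]
          gcongr
      _ = _ := by push_cast; ring

theorem norm_halfAverage_sq_le {τ : G → W →ₗᵢ[ℝ] W} (h0 : ∀ w, τ 0 w = w)
    (hadd : ∀ a b w, τ (a + b) w = τ a (τ b w)) (e : ℕ → G) {k : ℕ} {a : ℝ} (ha : 0 ≤ a)
    (r : ℕ) (har : a * (k ^ 2 + r) ≤ 1) (w : W) :
    ‖halfAverage τ e r w‖ ^ 2 ≤
      ‖w‖ ^ 2 - a / 4 * ∑ j ∈ Finset.range r, ‖τ (k • e j) w - w‖ ^ 2 := by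
  induction r generalizing w with
  | zero => simp [halfAverage]
  | succ r ih =>
    push_cast at har
    set T := τ (e r) with hT
    set h := (1 / 2 : ℝ) • (w + T w) with hh
    have hcomm (b : G) (v : W) : τ b (T v) = T (τ b v) := by
      rw [hT, ← hadd, ← hadd, add_comm]
    have hterm (j : ℕ) :
        ‖τ (k • e j) w - w‖ ^ 2 - ‖T w - w‖ ^ 2 ≤ ‖τ (k • e j) h - h‖ ^ 2 := by
      have h1 : τ (k • e j) h - h =
          (1 / 2 : ℝ) • ((τ (k • e j) w - w) + T (τ (k • e j) w - w)) := by
        rw [hh, map_smul, map_add, hcomm, map_sub, ← smul_sub]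
        congr 1
        abel
      have h2 : T (τ (k • e j) w - w) - (τ (k • e j) w - w) =
          τ (k • e j) (T w - w) - (T w - w) := by
        rw [map_sub, map_sub, hcomm]; abel
      have h3 : ‖τ (k • e j) (T w - w) - (T w - w)‖ ≤ 2 * ‖T w - w‖ := by
        refine (norm_sub_le _ _).trans ?_
        rw [LinearIsometry.norm_map]
        linarith
      rw [h1, norm_half_add_isometry_sq, h2]
      nlinarith [norm_nonneg (τ (k • e j) (T w - w) - (T w - w))]
    have hsum : ∑ j ∈ Finset.range r, ‖τ (k • e j) w - w‖ ^ 2 - r * ‖T w - w‖ ^ 2 ≤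
        ∑ j ∈ Finset.range r, ‖τ (k • e j) h - h‖ ^ 2 := by
      simpa using Finset.sum_le_sum fun j (_ : j ∈ Finset.range r) => hterm j
    have hlast : ‖τ (k • e r) w - w‖ ^ 2 ≤ k ^ 2 * ‖T w - w‖ ^ 2 := by
      rw [← mul_pow]
      exact pow_le_pow_left₀ (norm_nonneg _) (norm_nsmul_action_sub_le h0 hadd _ _ _) 2
    have hnorm : ‖h‖ ^ 2 = ‖w‖ ^ 2 - 1 / 4 * ‖T w - w‖ ^ 2 := norm_half_add_isometry_sq T w
    have hi := ih (by nlinarith) h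
    have h4 := mul_le_mul_of_nonneg_left hsum ha
    have h5 := mul_le_mul_of_nonneg_left hlast ha
    have h6 := mul_le_mul_of_nonneg_right har (sq_nonneg ‖T w - w‖)
    have h7 := mul_nonneg ha (sq_nonneg ‖T w - w‖)
    rw [Finset.sum_range_succ]
    change ‖halfAverage τ e r h‖ ^ 2 ≤ _
    linarith

theorem le_inner_halfAverage {τ : G → W →ₗᵢ[ℝ] W} (h0 : ∀ w, τ 0 w = w)
    (hadd : ∀ a b w, τ (a + b) w = τ a (τ b w)) (e : ℕ → G) {b : ℝ} {v : W} (r : ℕ) (w : W)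
    (hb : ∀ s ⊆ Finset.range r, b ≤ inner ℝ (τ (∑ j ∈ s, e j) w) v) :
    b ≤ inner ℝ (halfAverage τ e r w) v := by
  induction r generalizing w with
  | zero => simpa [halfAverage, h0] using hb ∅
  | succ r ih =>
    refine ih _ fun s hs => ?_
    have hr : r ∉ s := fun h => by simpa using hs h
    have h1 := hb s (hs.trans (Finset.range_subset_range.mpr r.le_succ))
    have h2 := hb (insert r s) (by
      rw [Finset.range_add_one]; exact Finset.insert_subset_insert _ hs)
    rw [Finset.sum_insert hr, add_comm, hadd] at h2
    rw [map_smul, map_add, real_inner_smul_left, inner_add_left]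
    linarith

theorem sum_norm_nsmul_action_sub_sq_le {τ : G → W →ₗᵢ[ℝ] W} (h0 : ∀ w, τ 0 w = w)
    (hadd : ∀ a b w, τ (a + b) w = τ a (τ b w)) (e : ℕ → G) {R : ℝ} (k n : ℕ) (hk : 0 < k)
    (w : W) (hR : ∀ s ⊆ Finset.range n, ‖τ (∑ j ∈ s, e j) w - w‖ ^ 2 ≤ R) :
    ∑ j ∈ Finset.range n, ‖τ (k • e j) w - w‖ ^ 2 ≤ 4 * (k ^ 2 + n) * R := by
  have hpos : (0 : ℝ) < k ^ 2 + n := by positivity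
  have h1 := norm_halfAverage_sq_le h0 hadd e (k := k) (inv_nonneg.mpr hpos.le) n
    (inv_mul_cancel₀ hpos.ne').le w
  have h2 := le_inner_halfAverage h0 hadd e (b := ‖w‖ ^ 2 - R / 2) (v := w) n w fun s hs => by
    have := hR s hs
    rw [norm_sub_sq_real, LinearIsometry.norm_map] at this
    linarith
  have h3 : 0 ≤ ‖halfAverage τ e n w - w‖ ^ 2 := sq_nonneg _
  rw [norm_sub_sq_real] at h3
  have h4 : ((k : ℝ) ^ 2 + n)⁻¹ / 4 * ∑ j ∈ Finset.range n, ‖τ (k • e j) w - w‖ ^ 2 ≤ R := by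
    linarith
  calc _ = 4 * (k ^ 2 + n) * (((k : ℝ) ^ 2 + n)⁻¹ / 4 *
        ∑ j ∈ Finset.range n, ‖τ (k • e j) w - w‖ ^ 2) := by field_simp
    _ ≤ _ := by gcongr

/-- A metric cotype `2` inequality for maps from a finite abelian group to a Hilbert space. -/
theorem sum_sum_norm_translate_sub_sq_le [Fintype G] (g : G → W) (e : ℕ → G) {ρ : ℝ} (k n : ℕ)
    (hk : 0 < k)
    (hρ : ∀ x, ∀ s ⊆ Finset.range n, ‖g (x + ∑ j ∈ s, e j) - g x‖ ≤ ρ) :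
    ∑ j ∈ Finset.range n, ∑ x, ‖g (x + k • e j) - g x‖ ^ 2 ≤
      4 * (k ^ 2 + n) * (Fintype.card G * ρ ^ 2) := by
  let τ (a : G) : PiLp 2 (fun _ : G => W) →ₗᵢ[ℝ] PiLp 2 (fun _ : G => W) :=
    (LinearIsometryEquiv.piLpCongrLeft 2 ℝ W (Equiv.subRight a)).toLinearIsometry
  have hτ (a : G) (v : PiLp 2 (fun _ : G => W)) (x : G) : τ a v x = v (x + a) := rfl
  have hnorm (a : G) : ‖τ a (WithLp.toLp 2 g) - WithLp.toLp 2 g‖ ^ 2 =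
      ∑ x, ‖g (x + a) - g x‖ ^ 2 := by
    rw [PiLp.norm_sq_eq_of_L2]; rfl
  have h := sum_norm_nsmul_action_sub_sq_le (τ := τ) (R := Fintype.card G * ρ ^ 2)
    (fun w => by ext x; simp [hτ])
    (fun a b w => by ext x; simp [hτ, add_assoc]) e k n hk (WithLp.toLp 2 g) fun s hs => by
      rw [hnorm]
      refine (Finset.sum_le_card_nsmul _ _ (ρ ^ 2) fun x _ =>
        pow_le_pow_left₀ (norm_nonneg _) (hρ x s hs) 2).trans_eq ?_
      simp
  simpa only [hnorm] using h

end Cotype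

/-- The measure of the `i`-th of `N` equal cells of the unit interval. -/
theorem inv_le_volume_restrict_floor_eq {N i : ℕ} (hi : i < N) :
    ENNReal.ofReal (N : ℝ)⁻¹ ≤
      volume.restrict (Set.Icc (0 : ℝ) 1) {t : ℝ | ⌊N * t⌋₊ = i} := by
  have hN : (0 : ℝ) < N := by exact_mod_cast (Nat.zero_le i).trans_lt hi
  have hi' : (i : ℝ) + 1 ≤ N := by exact_mod_cast hi
  have hsub : Set.Ico ((i : ℝ) / N) ((i + 1) / N) ⊆
      {t : ℝ | ⌊N * t⌋₊ = i} ∩ Set.Icc (0 : ℝ) 1 := by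
    rintro t ⟨h1, h2⟩
    have h0 : 0 ≤ t := le_trans (by positivity) h1
    rw [div_le_iff₀ hN] at h1
    rw [lt_div_iff₀ hN] at h2
    refine ⟨(Nat.floor_eq_iff (by positivity)).mpr ⟨by linarith, by linarith⟩, h0, ?_⟩
    nlinarith
  rw [Measure.restrict_apply' measurableSet_Icc]
  refine le_trans (le_of_eq ?_) (measure_mono hsub)
  rw [Real.volume_Ico]
  congr 1
  ring

theorem exists_sequence_embedding_Lp {p : ℝ} (hp : 1 ≤ p) [Fact (1 ≤ ENNReal.ofReal p)]
    (N : ℕ) (hN : 0 < N) :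
    ∃ J : (Fin N → ℝ) → Lp ℝ (ENNReal.ofReal p) (volume.restrict (Set.Icc (0 : ℝ) 1)),
      (∀ a b i, |a i - b i| ≤ ‖J a - J b‖) ∧
      ∀ a b M, 0 ≤ M → (∀ i, |a i - b i| ≤ M) → ‖J a - J b‖ ≤ (N : ℝ) ^ (1 / p) * M := by
  set μ := volume.restrict (Set.Icc (0 : ℝ) 1)
  have hp0 : ENNReal.ofReal p ≠ 0 := by simpa using by linarith
  let b (a : Fin N → ℝ) (m : ℕ) : ℝ := if h : m < N then a ⟨m, h⟩ else 0
  let F (a : Fin N → ℝ) (t : ℝ) : ℝ := (N : ℝ) ^ (1 / p) * b a ⌊N * t⌋₊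
  have hb (a : Fin N → ℝ) (m : ℕ) : |b a m| ≤ ∑ i, |a i| := by
    by_cases h : m < N
    · simpa [b, h] using Finset.single_le_sum (f := fun i => |a i|)
        (fun i _ => abs_nonneg _) (Finset.mem_univ (⟨m, h⟩ : Fin N))
    · simpa [b, h] using Finset.sum_nonneg fun i _ => abs_nonneg (a i)
  have hF (a : Fin N → ℝ) : MemLp (F a) (ENNReal.ofReal p) μ := by
    have hfl : Measurable fun t : ℝ => ⌊N * t⌋₊ :=
      Nat.measurable_floor.comp (measurable_const_mul (N : ℝ))
    have hm : Measurable (F a) := ((measurable_from_nat (f := b a)).comp hfl).const_mul _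
    refine MemLp.of_bound hm.aestronglyMeasurable ((N : ℝ) ^ (1 / p) * ∑ i, |a i|)
      (ae_of_all _ fun t => ?_)
    rw [norm_mul, Real.norm_of_nonneg (by positivity), Real.norm_eq_abs]
    gcongr
    exact hb a _
  refine ⟨fun a => (hF a).toLp, fun a c i => ?_, fun a c M hM h => ?_⟩
  · rw [← MemLp.toLp_sub, Lp.norm_toLp]
    have hmeas : MeasurableSet {t : ℝ | ⌊N * t⌋₊ = (i : ℕ)} :=
      (Nat.measurable_floor.comp (measurable_const_mul (N : ℝ))) (measurableSet_singleton _)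
    have h1 : eLpNorm ({t : ℝ | ⌊N * t⌋₊ = (i : ℕ)}.indicator
        fun _ => (N : ℝ) ^ (1 / p) * (a i - c i)) (ENNReal.ofReal p) μ ≤
        eLpNorm (F a - F c) (ENNReal.ofReal p) μ := by
      refine eLpNorm_mono fun t => ?_
      by_cases ht : ⌊N * t⌋₊ = (i : ℕ)
      · rw [Set.indicator_of_mem (by exact ht)]
        simp [F, b, ht, mul_sub]
      · rw [Set.indicator_of_notMem (by exact ht)]
        simp
    rw [eLpNorm_indicator_const hmeas hp0 ENNReal.ofReal_ne_top,
      ENNReal.toReal_ofReal (by linarith)] at h1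
    have h2 : ENNReal.ofReal |a i - c i| ≤ eLpNorm (F a - F c) (ENNReal.ofReal p) μ := by
      refine le_trans ?_ h1
      have hv := ENNReal.rpow_le_rpow (inv_le_volume_restrict_floor_eq i.2)
        (one_div_nonneg.mpr (zero_le_one.trans hp))
      refine le_trans (le_of_eq ?_) (mul_le_mul_right hv _)
      rw [ENNReal.ofReal_rpow_of_nonneg (by positivity) (by positivity), ← ofReal_norm,
        ← ENNReal.ofReal_mul (norm_nonneg _), norm_mul, Real.norm_of_nonneg (by positivity),
        mul_right_comm, ← Real.mul_rpow (by positivity) (by positivity),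
        mul_inv_cancel₀ (by positivity), Real.one_rpow, one_mul, Real.norm_eq_abs]
    rw [← ENNReal.toReal_ofReal (abs_nonneg (a i - c i))]
    exact ENNReal.toReal_mono ((hF a).sub (hF c)).2.ne h2
  · have hle := Lp.norm_le_of_ae_bound (f := (hF a).toLp - (hF c).toLp)
      (C := (N : ℝ) ^ (1 / p) * M) (by positivity) (by
        rw [← MemLp.toLp_sub]
        filter_upwards [((hF a).sub (hF c)).coeFn_toLp] with t ht
        rw [ht, Pi.sub_apply, ← mul_sub, norm_mul, Real.norm_of_nonneg (by positivity)]
        gcongr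
        by_cases hm : ⌊N * t⌋₊ < N
        · simpa [b, hm] using h _
        · simpa [b, hm] using hM)
    simpa [μ, measureUnivNNReal] using hle

theorem norm_stdAddChar_one_sub_one_le {k : ℕ} [NeZero (2 * k)] (hk : 0 < k) :
    ‖ZMod.stdAddChar (1 : ZMod (2 * k)) - 1‖ ≤ Real.pi / k := by
  have h := ZMod.stdAddChar_coe (N := 2 * k) 1
  have hk' : (k : ℂ) ≠ 0 := by exact_mod_cast hk.ne'
  rw [Int.cast_one] at h
  rw [h, show (2 * Real.pi * Complex.I * (1 : ℤ) / (2 * k : ℕ) : ℂ) =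
    Complex.I * ((Real.pi / k : ℝ) : ℂ) by push_cast; field_simp]
  refine Real.norm_exp_I_mul_ofReal_sub_one_le.trans_eq ?_
  exact Real.norm_of_nonneg (by positivity)

theorem stdAddChar_half {k : ℕ} [NeZero (2 * k)] (hk : 0 < k) :
    ZMod.stdAddChar (k : ZMod (2 * k)) = -1 := by
  have h := ZMod.stdAddChar_coe (N := 2 * k) k
  have hk' : (k : ℂ) ≠ 0 := by exact_mod_cast hk.ne'
  rw [Int.cast_natCast] at h
  rw [h, ← Complex.exp_pi_mul_I]
  congr 1
  push_cast
  field_simp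

theorem exists_torus_map_Lp {p : ℝ} (hp : 1 ≤ p) [Fact (1 ≤ ENNReal.ofReal p)] {k n : ℕ}
    (hk : 0 < k) (hn : 0 < n) :
    ∃ φ : (Fin n → ZMod (2 * k)) →
        Lp ℝ (ENNReal.ofReal p) (volume.restrict (Set.Icc (0 : ℝ) 1)),
      (∀ x y i, y i = (k : ZMod (2 * k)) → 1 ≤ ‖φ (x + y) - φ x‖) ∧
      ∀ x y, (∀ i, y i = 0 ∨ y i = 1) →
        ‖φ (x + y) - φ x‖ ≤ ((n * 2 : ℕ) : ℝ) ^ (1 / p) * (Real.pi / k) := by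
  have : NeZero (2 * k) := ⟨by omega⟩
  obtain ⟨J, hJ1, hJ2⟩ := exists_sequence_embedding_Lp hp (n * 2) (by omega)
  let a (x : Fin n → ZMod (2 * k)) (m : Fin (n * 2)) : ℝ :=
    if (finProdFinEquiv.symm m).2 = 0 then (ZMod.stdAddChar (x (finProdFinEquiv.symm m).1)).re
    else (ZMod.stdAddChar (x (finProdFinEquiv.symm m).1)).im
  refine ⟨fun x => J (a x), fun x y i hi => ?_, fun x y hy => ?_⟩
  · have h0 := hJ1 (a (x + y)) (a x) (finProdFinEquiv (i, 0))
    have h1 := hJ1 (a (x + y)) (a x) (finProdFinEquiv (i, 1))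
    change 1 ≤ ‖J (a (x + y)) - J (a x)‖
    have hD := norm_nonneg (J (a (x + y)) - J (a x))
    generalize ‖J (a (x + y)) - J (a x)‖ = D at *
    simp only [a, Equiv.symm_apply_apply, Pi.add_apply, hi, AddChar.map_add_eq_mul,
      stdAddChar_half hk] at h0 h1
    simp only [mul_neg, mul_one, if_true, one_ne_zero, if_false, Complex.neg_re,
      Complex.neg_im] at h0 h1
    have hc : (ZMod.stdAddChar (x i)).re ^ 2 + (ZMod.stdAddChar (x i)).im ^ 2 = 1 := by
      have h : ‖ZMod.stdAddChar (x i)‖ ^ 2 = 1 := by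
        rw [ZMod.stdAddChar_apply, Circle.norm_coe, one_pow]
      rw [← h, Complex.sq_norm, Complex.normSq_apply]; ring
    have h2 := pow_le_pow_left₀ (abs_nonneg _) h0 2
    have h3 := pow_le_pow_left₀ (abs_nonneg _) h1 2
    rw [sq_abs] at h2 h3
    nlinarith
  · refine hJ2 _ _ _ (by positivity) fun m => ?_
    set i := (finProdFinEquiv.symm m).1 with hi
    have hnorm : ‖ZMod.stdAddChar ((x + y) i) - ZMod.stdAddChar (x i)‖ ≤ Real.pi / k := by
      rw [Pi.add_apply, AddChar.map_add_eq_mul, ← mul_sub_one, norm_mul, ZMod.stdAddChar_apply,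
        Circle.norm_coe, one_mul]
      rcases hy i with h | h <;> rw [h]
      · simp; positivity
      · exact norm_stdAddChar_one_sub_one_le hk
    by_cases hm : (finProdFinEquiv.symm m).2 = 0
    · simp only [a, hm, if_true, ← hi, ← Complex.sub_re]
      exact (Complex.abs_re_le_norm _).trans hnorm
    · simp only [a, hm, if_false, ← hi, ← Complex.sub_im]
      exact (Complex.abs_im_le_norm _).trans hnorm

theorem tendsto_sq_rpow_inv_mul_pi_div {p : ℝ} (hp : 2 < p) :
    Tendsto (fun k : ℕ => ((k ^ 2 * 2 : ℕ) : ℝ) ^ (1 / p) * (Real.pi / k)) atTop (𝓝 0) := by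
  have h : Tendsto (fun k : ℕ => 2 ^ (1 / p) * Real.pi * (k : ℝ) ^ (-(1 - 2 / p))) atTop (𝓝 0) := by
    have hpos : 0 < 1 - 2 / p := by
      rw [sub_pos, div_lt_one (by linarith)]; exact hp
    simpa using ((tendsto_rpow_neg_atTop hpos).comp tendsto_natCast_atTop_atTop).const_mul
      (2 ^ (1 / p) * Real.pi)
  refine h.congr' ?_
  filter_upwards [eventually_gt_atTop 0] with k hk
  have hk' : (0 : ℝ) < k := by exact_mod_cast hk
  push_cast
  rw [Real.mul_rpow (by positivity) (by norm_num), ← Real.rpow_natCast (k : ℝ) 2,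
    ← Real.rpow_mul hk'.le, show -(1 - 2 / p) = (2 : ℕ) * (1 / p) - 1 by push_cast; ring,
    Real.rpow_sub_one hk'.ne']
  ring

theorem not_uniform_embedding_Lp_of_two_lt {H : Type*} [NormedAddCommGroup H]
    [InnerProductSpace ℝ H] {p : ℝ} (hp : 2 < p) [Fact (1 ≤ ENNReal.ofReal p)]
    {f : Lp ℝ (ENNReal.ofReal p) (volume.restrict (Set.Icc (0 : ℝ) 1)) → H}
    (hf : UniformContinuous f) :
    ¬ ∀ ε > (0 : ℝ), ∃ δ > (0 : ℝ), ∀ x y, ‖f x - f y‖ ≤ δ → ‖x - y‖ ≤ ε := by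
  intro hinv
  obtain ⟨δ, hδ, hfar⟩ := hinv (1 / 2) (by norm_num)
  obtain ⟨η, hη, hnear⟩ := Metric.uniformContinuous_iff.mp hf (δ / 4) (by positivity)
  obtain ⟨k, hkη, hk⟩ := (((tendsto_sq_rpow_inv_mul_pi_div hp).eventually_lt_const hη).and
    (eventually_gt_atTop 0)).exists
  have : NeZero (2 * k) := ⟨by omega⟩
  obtain ⟨φ, hφ1, hφ2⟩ := exists_torus_map_Lp (p := p) (by linarith) hk (pow_pos hk 2)
  let e (j : ℕ) (i : Fin (k ^ 2)) : ZMod (2 * k) := if (i : ℕ) = j then 1 else 0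
  have h := sum_sum_norm_translate_sub_sq_le (fun x => f (φ x)) e (ρ := δ / 4) k (k ^ 2) hk
    fun x s _ => by
      rw [← dist_eq_norm]
      refine (hnear ?_).le
      rw [dist_eq_norm]
      refine (hφ2 x _ fun i => ?_).trans_lt hkη
      simp only [Finset.sum_apply, e, Finset.sum_ite_eq]
      split_ifs <;> simp
  have hlow : ∑ j ∈ Finset.range (k ^ 2), ∑ _x : Fin (k ^ 2) → ZMod (2 * k), δ ^ 2 ≤
      ∑ j ∈ Finset.range (k ^ 2), ∑ x, ‖f (φ (x + k • e j)) - f (φ x)‖ ^ 2 := by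
    refine Finset.sum_le_sum fun j hj => Finset.sum_le_sum fun x _ => ?_
    refine pow_le_pow_left₀ hδ.le (le_of_not_gt fun hlt => ?_) 2
    have h1 := hfar _ _ hlt.le
    have h2 := hφ1 x (k • e j) ⟨j, Finset.mem_range.mp hj⟩ (by simp [e])
    linarith
  have hc : (0 : ℝ) < Fintype.card (Fin (k ^ 2) → ZMod (2 * k)) := by
    exact_mod_cast Fintype.card_pos
  have hk2 : (0 : ℝ) < (k : ℝ) ^ 2 := by positivity
  have hfin := hlow.trans h
  simp only [Finset.sum_const, Finset.card_univ, Finset.card_range, nsmul_eq_mul,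
    Nat.cast_pow] at hfin
  have := mul_pos (mul_pos hk2 hc) (pow_pos hδ 2)
  linarith

theorem exists_map_Lp_of_le_two {α : Type*} [MeasurableSpace α]
    [MeasurableSpace.CountablyGenerated α] (μ : Measure α)
    [SFinite μ] {p : ℝ} (hp : 0 < p) (hp2 : p ≤ 2) [Fact (1 ≤ ENNReal.ofReal p)] :
    ∃ (f : Lp ℝ (ENNReal.ofReal p) μ → lp (fun _ : ℕ => ℝ) 2) (K : ℝ), 0 < K ∧
      ∀ x y, ‖f x - f y‖ = K * ‖x - y‖ ^ (p / 2) := by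
  rcases hp2.lt_or_eq with h | rfl
  · exact exists_map_Lp_norm_sub_eq_rpow μ hp h
  · have : Fact ((2 : ENNReal) ≠ ⊤) := ⟨ENNReal.ofNat_ne_top⟩
    obtain ⟨J⟩ := exists_linearIsometry_lp_two (Lp ℝ 2 μ)
    rw [ENNReal.ofReal_ofNat]
    exact ⟨J, 1, one_pos, fun x y => by simp [← map_sub]⟩

/-- (Aharoni–Maurey–Mityagin) For `1 ≤ p < ∞`, `L_p([0,1])` embeds uniformly into the
Hilbert space `ℓ₂` if and only if `p ≤ 2`. -/
theorem lp_uniformly_embeds_into_hilbert_iff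
    (p : ℝ) (hp : 1 ≤ p) [Fact (1 ≤ ENNReal.ofReal p)] :
    (∃ f : Lp ℝ (ENNReal.ofReal p) (volume.restrict (Set.Icc (0:ℝ) 1)) →
        lp (fun _ : ℕ => ℝ) 2,
      Function.Injective f ∧ UniformContinuous f ∧
      ∀ ε > (0:ℝ), ∃ δ > (0:ℝ), ∀ x y, ‖f x - f y‖ ≤ δ → ‖x - y‖ ≤ ε) ↔ p ≤ 2 := by
  constructor
  · rintro ⟨f, -, hf, hinv⟩
    exact le_of_not_gt fun h => not_uniform_embedding_Lp_of_two_lt h hf hinv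
  · intro hp2
    have hp0 : 0 < p := by linarith
    obtain ⟨f, K, hK, hf⟩ := exists_map_Lp_of_le_two
      (volume.restrict (Set.Icc (0 : ℝ) 1)) hp0 hp2
    have hinv : ∀ ε > (0 : ℝ), ∃ δ > (0 : ℝ), ∀ x y, ‖f x - f y‖ ≤ δ → ‖x - y‖ ≤ ε := by
      refine fun ε hε => ⟨K * ε ^ (p / 2), by positivity, fun x y h => ?_⟩
      rw [hf, mul_le_mul_iff_right₀ hK] at h
      exact (Real.rpow_le_rpow_iff (norm_nonneg _) hε.le (by positivity)).mp h
    refine ⟨f, fun x y hxy => ?_, ?_, hinv⟩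
    · have h := hf x y
      rw [hxy, sub_self, norm_zero, zero_eq_mul, or_iff_right hK.ne',
        Real.rpow_eq_zero (norm_nonneg _) (by positivity)] at h
      exact sub_eq_zero.mp (norm_eq_zero.mp h)
    · refine Metric.uniformContinuous_iff.mpr fun ε hε =>
        ⟨(ε / K) ^ (2 / p), by positivity, fun {x y} h => ?_⟩
      rw [dist_eq_norm] at h ⊢
      have h1 := Real.rpow_lt_rpow (norm_nonneg _) h (show 0 < p / 2 by positivity)
      rw [← Real.rpow_mul (by positivity), show 2 / p * (p / 2) = 1 by field_simp,
        Real.rpow_one, lt_div_iff₀ hK] at h1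
      rw [hf, mul_comm]
      exact h1
end

section
/- (Christensen) Let X be a separable real Banach space, and call a Borel set A ⊆ X a zero set if there is a Borel probability measure μ on X with μ(x − A) = 0 for every x ∈ X, where x − A = {x − a : a ∈ A}. Then: (i) a countable union of zero sets, if Borel, is a zero set; (ii) every zero set has empty interior; (iii) if Y is a finite-dimensional linear subspace of X with X = Y + D for some countable set D (e.g. any finite-dimensional subspace when X is separable), then a Borel set A ⊆ X is a zero set provided that for every x ∈ X the set (A + x) ∩ Y has Lebesgue measure zero in Y, where Lebesgue measure on Y is transported by any linear isomorphism Y ≅ ℝ^{dim Y}. -/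
open MeasureTheory

/-- A Borel set `A` in a separable real Banach space is a (Christensen) zero set if
there is a Borel probability measure `μ` with `μ (x - A) = 0` for every `x`. -/
def IsChristensenZeroSet {X : Type*} [NormedAddCommGroup X] [NormedSpace ℝ X]
    [MeasurableSpace X] (A : Set X) : Prop :=
  MeasurableSet A ∧
    ∃ μ : Measure X, IsProbabilityMeasure μ ∧ ∀ x : X, μ ((fun a => x - a) '' A) = 0

section ZeroSets

open ProbabilityTheory Set Filter Topology

theorem image_const_sub_eq_setOf {G : Type*} [AddCommGroup G] (x : G) (A : Set G) :
    (fun a => x - a) '' A = {z | x - z ∈ A} := by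
  ext z
  constructor
  · rintro ⟨a, ha, rfl⟩
    simpa using ha
  · exact fun hz => ⟨x - z, hz, by simp⟩

/-- Adding an independent random variable preserves being a test variable. -/
theorem measure_sub_add_mem_eq_zero_of_indepFun {X Ω : Type*} [AddCommGroup X]
    [MeasurableSpace X] [MeasurableAdd₂ X] [MeasurableSub X] [MeasurableSpace Ω] {P : Measure Ω}
    [IsProbabilityMeasure P] {Z T : Ω → X} (hZ : Measurable Z) (hT : Measurable T)
    (hind : IndepFun T Z P) {A : Set X} (hA : MeasurableSet A)
    (h : ∀ x, P {ω | x - Z ω ∈ A} = 0) (x : X) : P {ω | x - (Z ω + T ω) ∈ A} = 0 := by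
  have hB : MeasurableSet {p : X × X | x - (p.2 + p.1) ∈ A} :=
    (show Measurable fun p : X × X => x - (p.2 + p.1) by fun_prop) hA
  have hmap := (indepFun_iff_map_prod_eq_prod_map_map hT.aemeasurable hZ.aemeasurable).1 hind
  have := Measure.isProbabilityMeasure_map (μ := P) hZ.aemeasurable
  have key : P.map (fun ω => (T ω, Z ω)) {p : X × X | x - (p.2 + p.1) ∈ A} = 0 := by
    rw [hmap, Measure.measure_prod_null hB]
    refine Eventually.of_forall fun t => ?_
    change P.map Z _ = 0
    rw [Measure.map_apply hZ (measurable_prodMk_left hB)]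
    convert h (x - t) using 2
    ext ω
    simp only [mem_ofPred_eq, mem_preimage, sub_sub, add_comm]
  rwa [Measure.map_apply (hT.prodMk hZ) hB] at key

variable {X : Type*} [NormedAddCommGroup X] [NormedSpace ℝ X] [MeasurableSpace X]

theorem isChristensenZeroSet_iff {A : Set X} :
    IsChristensenZeroSet A ↔ MeasurableSet A ∧
      ∃ μ : Measure X, IsProbabilityMeasure μ ∧ ∀ x : X, μ {z | x - z ∈ A} = 0 := by
  simp only [IsChristensenZeroSet, image_const_sub_eq_setOf]

theorem IsChristensenZeroSet.interior_eq_empty [SecondCountableTopology X] {A : Set X}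
    (hA : IsChristensenZeroSet A) : interior A = ∅ := by
  obtain ⟨-, μ, hμ, hμA⟩ := isChristensenZeroSet_iff.1 hA
  obtain ⟨c, -, hc⟩ := exists_mem_forall_mem_nhdsWithin_pos_measure (μ := μ) (s := univ) (by simp)
  refine eq_empty_of_forall_notMem fun a ha => ?_
  refine (hc {z | c + a - z ∈ A} ?_).ne' (hμA (c + a))
  rw [nhdsWithin_univ]
  have hcont : ContinuousAt (fun z : X => c + a - z) c := by fun_prop
  exact hcont.preimage_mem_nhds (by simpa using mem_interior_iff_mem_nhds.1 ha)

variable [BorelSpace X]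

theorem isChristensenZeroSet_of_finiteDimensional_slices (Y : Subspace ℝ X)
    [FiniteDimensional ℝ Y] {A : Set X} (hA : MeasurableSet A)
    (e : Y ≃ₗ[ℝ] (Fin (Module.finrank ℝ Y) → ℝ))
    (h : ∀ x : X, volume (e '' {y : Y | (y : X) ∈ (fun a => a + x) '' A}) = 0) :
    IsChristensenZeroSet A := by
  let φ : (Fin (Module.finrank ℝ Y) → ℝ) →ₗ[ℝ] X := Y.subtype ∘ₗ e.symm.toLinearMap
  have hφ : Measurable φ := φ.continuous_of_finiteDimensional.measurable
  let Q : Measure (Fin (Module.finrank ℝ Y) → ℝ) := volume.restrict (Icc 0 1)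
  have hQ : IsProbabilityMeasure Q := ⟨by simp [Q, Real.volume_Icc_pi]⟩
  refine isChristensenZeroSet_iff.2
    ⟨hA, Q.map φ, Measure.isProbabilityMeasure_map hφ.aemeasurable, fun x => ?_⟩
  have hx : Measurable fun z : X => x - z := by fun_prop
  change Q.map φ ((fun z => x - z) ⁻¹' A) = 0
  rw [Measure.map_apply hφ (hx hA)]
  refine Measure.absolutelyContinuous_of_le Measure.restrict_le_self
    (measure_mono_null ?_ ((Measure.measure_neg volume _).trans (h (-x))))
  intro v hv
  refine ⟨-e.symm v, ⟨x - φ v, hv, ?_⟩, by simp⟩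
  simp only [φ, LinearMap.comp_apply, Submodule.subtype_apply, LinearEquiv.coe_coe,
    NegMemClass.coe_neg]
  abel

variable [SecondCountableTopology X]

/-- A test measure may be replaced by the law of a random variable of arbitrarily small norm. -/
theorem IsChristensenZeroSet.exists_bounded_test {A : Set X} (hA : IsChristensenZeroSet A)
    {r : ℝ} (hr : 0 < r) :
    ∃ (ν : Measure X) (g : X → X), IsProbabilityMeasure ν ∧ Measurable g ∧ (∀ ω, ‖g ω‖ ≤ r) ∧
      ∀ x, ν {ω | x - g ω ∈ A} = 0 := by
  classical
  obtain ⟨-, μ, hμ, hμA⟩ := isChristensenZeroSet_iff.1 hA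
  obtain ⟨c, -, hc⟩ := exists_mem_forall_mem_nhdsWithin_pos_measure (μ := μ) (s := univ) (by simp)
  have hpos : μ (Metric.closedBall c r) ≠ 0 :=
    (hc _ (by simpa using Metric.closedBall_mem_nhds c hr)).ne'
  have hs : MeasurableSet (Metric.closedBall c r) := Metric.isClosed_closedBall.measurableSet
  refine ⟨μ[|Metric.closedBall c r], fun ω => if ω ∈ Metric.closedBall c r then ω - c else 0,
    cond_isProbabilityMeasure hpos, Measurable.ite hs (by fun_prop) measurable_const,
    fun ω => ?_, fun x => ?_⟩
  · dsimp only
    split_ifs with h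
    · simpa [dist_eq_norm] using h
    · simpa using hr.le
  · rw [cond_apply hs]
    refine mul_eq_zero_of_right _ (measure_mono_null ?_ (hμA (x + c)))
    rintro ω ⟨hω, hωA⟩
    simp only [mem_ofPred_eq, if_pos hω] at hωA ⊢
    convert hωA using 1
    abel

theorem IsChristensenZeroSet.iUnion [CompleteSpace X] {A : ℕ → Set X}
    (hA : ∀ n, IsChristensenZeroSet (A n)) : IsChristensenZeroSet (⋃ n, A n) := by
  refine isChristensenZeroSet_iff.2 ⟨.iUnion fun n => (hA n).1, ?_⟩
  choose ν g hν hg hbound htest using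
    fun n => (hA n).exists_bounded_test (r := (1 / 2 : ℝ) ^ n) (by positivity)
  let P := Measure.infinitePi ν
  let Z : ℕ → (ℕ → X) → X := fun i ω => g i (ω i)
  have hZ : ∀ i, Measurable (Z i) := fun i => (hg i).comp (measurable_pi_apply i)
  have hZs : ∀ ω, Summable fun i => Z i ω := fun ω =>
    Summable.of_norm_bounded summable_geometric_two fun i => hbound i (ω i)
  have hS : Measurable fun ω => ∑' i, Z i ω := .tsum hZ
  have hindep : iIndepFun Z P := iIndepFun_infinitePi hg
  refine ⟨P.map fun ω => ∑' i, Z i ω, Measure.isProbabilityMeasure_map hS.aemeasurable,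
    fun x => ?_⟩
  have hx : Measurable fun z : X => x - z := by fun_prop
  change P.map _ ((fun z => x - z) ⁻¹' _) = 0
  rw [Measure.map_apply hS (hx (.iUnion fun n => (hA n).1))]
  simp only [preimage_iUnion, measure_iUnion_null_iff]
  intro n
  let T : (ℕ → X) → X := fun ω => ∑' i, if i = n then 0 else Z i ω
  have hle : ∀ i, MeasurableSpace.comap (Z i) inferInstance ≤ MeasurableSpace.pi :=
    fun i => (hZ i).comap_le
  have hT' : Measurable[⨆ i ∈ ({n}ᶜ : Set ℕ), MeasurableSpace.comap (Z i) inferInstance] T := by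
    refine @Measurable.tsum _ _ _ (_) _ _ _ _ _ _ _ _ (.unconditional ℕ) _ _ _ fun i => ?_
    by_cases hi : i = n
    · simp only [if_pos hi]
      exact measurable_const
    · simp only [if_neg hi]
      exact measurable_iff_comap_le.2 (le_iSup₂_of_le i hi le_rfl)
  have hT : Measurable T := hT'.mono (iSup₂_le fun i _ => hle i) le_rfl
  have hTZ : IndepFun T (Z n) P := by
    have h := indep_iSup_of_disjoint hle hindep.iIndep
      (disjoint_compl_left (a := ({n} : Set ℕ)))
    refine indep_of_indep_of_le_left (indep_of_indep_of_le_right h ?_) hT'.comap_le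
    exact le_iSup₂_of_le n rfl le_rfl
  have hZtest : ∀ y, P {ω | y - Z n ω ∈ A n} = 0 := fun y => by
    have hm : MeasurableSet {ω | y - g n ω ∈ A n} := (measurable_const.sub (hg n)) (hA n).1
    have h := htest n y
    rwa [← Measure.infinitePi_map_eval ν n, Measure.map_apply (measurable_pi_apply n) hm] at h
  convert measure_sub_add_mem_eq_zero_of_indepFun (hZ n) hT hTZ (hA n).1 hZtest x using 2
  ext ω
  simp only [mem_preimage, mem_ofPred_eq, T, (hZs ω).tsum_eq_add_tsum_ite n]

end ZeroSets

/-- (Christensen) Basic properties of the family of zero sets in a separable real Banach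
space: (i) a countable union of zero sets, if Borel, is a zero set; (ii) zero sets have
empty interior; (iii) if `Y` is a finite-dimensional subspace with `X = Y + D` for a
countable set `D`, then a Borel set all of whose translates meet `Y` in a set of Lebesgue
measure zero (Lebesgue measure transported to `Y` by any linear isomorphism with `ℝ^d`)
is a zero set. -/
theorem christensen_zero_sets_form_null_family
    {X : Type*} [NormedAddCommGroup X] [NormedSpace ℝ X] [CompleteSpace X]
    [TopologicalSpace.SeparableSpace X] [MeasurableSpace X] [BorelSpace X] :
    (∀ A : ℕ → Set X, (∀ n, IsChristensenZeroSet (A n)) →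
      MeasurableSet (⋃ n, A n) → IsChristensenZeroSet (⋃ n, A n)) ∧
    (∀ A : Set X, IsChristensenZeroSet A → interior A = ∅) ∧
    (∀ Y : Subspace ℝ X, FiniteDimensional ℝ Y →
      (∃ D : Set X, D.Countable ∧ ∀ x : X, ∃ y ∈ Y, ∃ d ∈ D, x = y + d) →
      ∀ A : Set X, MeasurableSet A →
        (∀ (x : X) (e : Y ≃ₗ[ℝ] (Fin (Module.finrank ℝ Y) → ℝ)),
          volume (e '' {y : Y | (y : X) ∈ (fun a => a + x) '' A}) = 0) →
        IsChristensenZeroSet A) := by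
  refine ⟨fun A hA _ => .iUnion hA, fun A hA => hA.interior_eq_empty, ?_⟩
  intro Y _ _ A hA h
  exact isChristensenZeroSet_of_finiteDimensional_slices Y hA
    (Module.finBasis ℝ Y).equivFun fun x => h x _
end

section
/- For every q > 2, the space L_q = L_q([0,1]) does not Lipschitz embed into L_1 = L_1([0,1]): there is no map f : L_q → L_1 and constant K ≥ 1 with K⁻¹‖x − y‖ ≤ ‖f x − f y‖ ≤ K‖x − y‖ for all x, y ∈ L_q. -/
open MeasureTheory

section Convexity

/-- A function on a commutative monoid satisfying the midpoint inequality
`2 Φ(u + v) ≤ Φ(2u) + Φ(2v)` satisfies Jensen's inequality over finite sets of dyadic size. -/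
theorem two_pow_mul_le_sum_of_midpoint {M ι : Type*} [AddCommMonoid M] [DecidableEq ι]
    (Φ : M → ℝ) (h : ∀ u v, 2 * Φ (u + v) ≤ Φ (2 • u) + Φ (2 • v)) (k : ℕ) :
    ∀ (S : Finset ι) (c : ι → M), S.card = 2 ^ k →
      2 ^ k * Φ (∑ s ∈ S, c s) ≤ ∑ s ∈ S, Φ (2 ^ k • c s) := by
  induction k with
  | zero =>
    intro S c hS
    obtain ⟨s, rfl⟩ := Finset.card_eq_one.1 (by simpa using hS)
    simp
  | succ k ih =>
    intro S c hS
    obtain ⟨T, hTS, hT⟩ := Finset.exists_subset_card_eq (s := S) (n := 2 ^ k)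
      (by rw [hS, pow_succ]; omega)
    have hT' : (S \ T).card = 2 ^ k := by
      rw [Finset.card_sdiff_of_subset hTS, hS, hT, pow_succ]; omega
    have h1 := ih T (fun s => 2 • c s) hT
    have h2 := ih (S \ T) (fun s => 2 • c s) hT'
    have h3 := h (∑ s ∈ S \ T, c s) (∑ s ∈ T, c s)
    rw [Finset.sum_sdiff hTS, Finset.smul_sum, Finset.smul_sum] at h3
    simp only [smul_smul, ← pow_succ] at h1 h2
    rw [← Finset.sum_sdiff hTS (f := fun s => Φ (2 ^ (k + 1) • c s)), pow_succ (2 : ℝ)]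
    have : (0 : ℝ) < 2 ^ k := by positivity
    nlinarith

end Convexity

section TensorPower

open Matrix

variable {ι Y : Type*} [Fintype ι] [Fintype Y] [DecidableEq Y]

/-- The tensor product `⨂ⱼ a ^ cⱼ` of powers of a square matrix `a`. -/
def tensorPow (a : Matrix Y Y ℝ) (c : ι → ℕ) : Matrix (ι → Y) (ι → Y) ℝ :=
  Matrix.of fun x y => ∏ j, (a ^ c j) (x j) (y j)

theorem tensorPow_isSymm {a : Matrix Y Y ℝ} (ha : a.IsSymm) (c : ι → ℕ) :
    (tensorPow a c).IsSymm := by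
  ext x y
  simp only [tensorPow, Matrix.transpose_apply, Matrix.of_apply]
  exact Finset.prod_congr rfl fun j _ => (ha.pow (c j)).apply _ _

theorem tensorPow_nonneg {a : Matrix Y Y ℝ} (ha : ∀ x y, 0 ≤ a x y) (c : ι → ℕ) (x y : ι → Y) :
    0 ≤ tensorPow a c x y :=
  Finset.prod_nonneg fun _ _ => Matrix.pow_apply_nonneg ha _ _ _

theorem Matrix.pow_mulVec_of_mulVec_eq_smul {a : Matrix Y Y ℝ} {φ : Y → ℝ} {l : ℝ}
    (h : a *ᵥ φ = l • φ) (n : ℕ) : (a ^ n) *ᵥ φ = l ^ n • φ := by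
  induction n with
  | zero => simp
  | succ n ih =>
    rw [pow_succ, ← Matrix.mulVec_mulVec, h, Matrix.mulVec_smul, ih, smul_smul, pow_succ, mul_comm]

variable [DecidableEq ι]

theorem tensorPow_add (a : Matrix Y Y ℝ) (c d : ι → ℕ) :
    tensorPow a (c + d) = tensorPow a c * tensorPow a d := by
  ext x y
  simp only [tensorPow, Matrix.of_apply, Matrix.mul_apply, Pi.add_apply, pow_add,
    ← Finset.prod_mul_distrib]
  rw [Finset.prod_univ_sum, Fintype.piFinset_univ]

theorem tensorPow_mulVec_prod (a : Matrix Y Y ℝ) (c : ι → ℕ) (g : ι → Y → ℝ) :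
    tensorPow a c *ᵥ (fun x => ∏ j, g j (x j)) = fun x => ∏ j, ((a ^ c j) *ᵥ g j) (x j) := by
  ext x
  simp only [tensorPow, Matrix.mulVec, dotProduct, Matrix.of_apply, ← Finset.prod_mul_distrib]
  rw [Finset.prod_univ_sum, Fintype.piFinset_univ]

theorem tensorPow_mulVec_one {a : Matrix Y Y ℝ} (ha : a *ᵥ 1 = 1) (c : ι → ℕ) :
    tensorPow a c *ᵥ 1 = 1 := by
  have h := tensorPow_mulVec_prod a c (fun _ => 1)
  have h' (n : ℕ) : (a ^ n) *ᵥ 1 = 1 := by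
    simpa using Matrix.pow_mulVec_of_mulVec_eq_smul (l := 1) (by simpa using ha) n
  simp only [h', Pi.one_apply, Finset.prod_const_one] at h
  exact h

/-- An eigenvector of `a`, read off in a single coordinate, is an eigenvector of `⨂ⱼ a ^ cⱼ`. -/
theorem tensorPow_mulVec_eval {a : Matrix Y Y ℝ} (ha : a *ᵥ 1 = 1) {φ : Y → ℝ} {l : ℝ}
    (h : a *ᵥ φ = l • φ) (c : ι → ℕ) (i : ι) :
    tensorPow a c *ᵥ (fun x => φ (x i)) = l ^ c i • fun x => φ (x i) := by
  have h' (n : ℕ) : (a ^ n) *ᵥ 1 = 1 := by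
    simpa using Matrix.pow_mulVec_of_mulVec_eq_smul (l := 1) (by simpa using ha) n
  have key := tensorPow_mulVec_prod a c (fun j => if j = i then φ else 1)
  have e1 (x : ι → Y) : ∏ j, (if j = i then φ else 1) (x j) = φ (x i) := by
    rw [Finset.prod_eq_single i] <;> simp +contextual
  have e2 (x : ι → Y) :
      ∏ j, ((a ^ c j) *ᵥ (if j = i then φ else 1)) (x j) = l ^ c i * φ (x i) := by
    rw [Finset.prod_eq_single i]
    · simp [Matrix.pow_mulVec_of_mulVec_eq_smul h]
    · intro j _ hj
      simp [hj, h']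
    · simp
  simp only [e1, e2] at key
  rw [key]
  rfl

theorem dotProduct_tensorPow_mulVec {a : Matrix Y Y ℝ} (ha : a.IsSymm) (c d : ι → ℕ)
    (G : (ι → Y) → ℝ) :
    (tensorPow a c *ᵥ G) ⬝ᵥ (tensorPow a d *ᵥ G) = G ⬝ᵥ (tensorPow a (c + d) *ᵥ G) := by
  rw [tensorPow_add, ← Matrix.mulVec_mulVec, Matrix.dotProduct_mulVec G, ← Matrix.mulVec_transpose,
    (tensorPow_isSymm ha c).eq]

theorem dotProduct_tensorPow_midpoint {a : Matrix Y Y ℝ} (ha : a.IsSymm) (G : (ι → Y) → ℝ)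
    (u v : ι → ℕ) :
    2 * (G ⬝ᵥ (tensorPow a (2 • (u + v)) *ᵥ G)) ≤
      G ⬝ᵥ (tensorPow a (2 • (2 • u)) *ᵥ G) + G ⬝ᵥ (tensorPow a (2 • (2 • v)) *ᵥ G) := by
  rw [two_smul ℕ (2 • u), two_smul ℕ (2 • v), smul_add, ← dotProduct_tensorPow_mulVec ha,
    ← dotProduct_tensorPow_mulVec ha, ← dotProduct_tensorPow_mulVec ha]
  simp only [dotProduct, Finset.mul_sum, ← Finset.sum_add_distrib]
  gcongr with x
  nlinarith [sq_nonneg ((tensorPow a (2 • u) *ᵥ G) x - (tensorPow a (2 • v) *ᵥ G) x)]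

theorem dotProduct_tensorPow_le_sum {a : Matrix Y Y ℝ} (ha : a.IsSymm) {k : ℕ}
    (hk : Fintype.card ι = 2 ^ k) (G : (ι → Y) → ℝ) :
    2 ^ k * (G ⬝ᵥ (tensorPow a (fun _ : ι => 2) *ᵥ G)) ≤
      ∑ i, G ⬝ᵥ (tensorPow a (Pi.single i (2 * 2 ^ k)) *ᵥ G) := by
  have h := two_pow_mul_le_sum_of_midpoint
    (fun u : ι → ℕ => G ⬝ᵥ (tensorPow a (2 • u) *ᵥ G)) (dotProduct_tensorPow_midpoint ha G) k
    Finset.univ (fun i => Pi.single i 1) (by simpa using hk)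
  rw [Finset.univ_sum_single (fun _ => 1)] at h
  convert h using 6 with i _ i
  · simp
  · rw [smul_smul, ← Pi.single_smul]; simp

/-- The Dirichlet form of a symmetric stochastic matrix. -/
theorem sum_mul_sub_sq_eq {X : Type*} [Fintype X] {T : Matrix X X ℝ} (hT : T.IsSymm)
    (h1 : T *ᵥ 1 = 1) (G : X → ℝ) :
    ∑ x, ∑ y, T x y * (G x - G y) ^ 2 = 2 * (G ⬝ᵥ G - G ⬝ᵥ (T *ᵥ G)) := by
  have hr (x : X) : ∑ y, T x y = 1 := by
    simpa [Matrix.mulVec, dotProduct] using congrFun h1 x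
  have e1 : ∑ x, ∑ y, T x y * G x ^ 2 = G ⬝ᵥ G := by
    simp [← Finset.sum_mul, hr, dotProduct, sq]
  have e2 : ∑ x, ∑ y, T x y * G y ^ 2 = G ⬝ᵥ G := by
    rw [Finset.sum_comm, ← e1]
    exact Finset.sum_congr rfl fun x _ => Finset.sum_congr rfl fun y _ => by rw [hT.apply]
  have e3 : ∑ x, ∑ y, T x y * (G x * G y) = G ⬝ᵥ (T *ᵥ G) := by
    simp only [dotProduct, Matrix.mulVec, Finset.mul_sum]
    exact Finset.sum_congr rfl fun x _ => Finset.sum_congr rfl fun y _ => by ring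
  calc ∑ x, ∑ y, T x y * (G x - G y) ^ 2
      = ∑ x, ∑ y, (T x y * G x ^ 2 + T x y * G y ^ 2 - 2 * (T x y * (G x * G y))) :=
        Finset.sum_congr rfl fun x _ => Finset.sum_congr rfl fun y _ => by ring
    _ = _ := by
        simp only [Finset.sum_add_distrib, Finset.sum_sub_distrib, ← Finset.mul_sum, e1, e2, e3]
        ring

theorem sum_tensorPow_mul_sub_sq_le {a : Matrix Y Y ℝ} (ha : a.IsSymm) (h1 : a *ᵥ 1 = 1) {k : ℕ}
    (hk : Fintype.card ι = 2 ^ k) (G : (ι → Y) → ℝ) :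
    ∑ x, ∑ y, (∑ i, tensorPow a (Pi.single i (2 * 2 ^ k)) x y) * (G x - G y) ^ 2 ≤
      ∑ x, ∑ y, (2 ^ k * tensorPow a (fun _ : ι => 2) x y) * (G x - G y) ^ 2 := by
  have e : ∑ x, ∑ y, (∑ i, tensorPow a (Pi.single i (2 * 2 ^ k)) x y) * (G x - G y) ^ 2 =
      ∑ i, ∑ x, ∑ y, tensorPow a (Pi.single i (2 * 2 ^ k)) x y * (G x - G y) ^ 2 := by
    rw [Finset.sum_comm]
    simp only [Finset.sum_mul]
    rw [Finset.sum_comm]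
    refine (Finset.sum_congr rfl fun x _ => Finset.sum_comm).trans Finset.sum_comm
  rw [e]
  simp only [sum_mul_sub_sq_eq (tensorPow_isSymm ha _) (tensorPow_mulVec_one h1 _), mul_assoc,
    ← Finset.mul_sum, Finset.sum_sub_distrib]
  have := dotProduct_tensorPow_le_sum ha hk G
  simp only [Finset.sum_const, Finset.card_univ, hk, nsmul_eq_mul]
  push_cast
  linarith

end TensorPower

section L1

theorem integral_indicator_sub_sq (a b : ℝ) :
    Integrable (fun s => ((Set.Iio a).indicator 1 s - (Set.Iio b).indicator 1 s : ℝ) ^ 2) ∧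
    ∫ s, ((Set.Iio a).indicator 1 s - (Set.Iio b).indicator 1 s : ℝ) ^ 2 = |a - b| := by
  have e : (fun s => ((Set.Iio a).indicator 1 s - (Set.Iio b).indicator 1 s : ℝ) ^ 2) =
      (Set.Ico (min a b) (max a b)).indicator 1 := by
    ext s
    simp only [Set.indicator_apply, Set.mem_Iio, Set.mem_Ico, Pi.one_apply, min_le_iff, lt_max_iff]
    split_ifs <;> grind
  rw [e]
  refine ⟨(integrable_indicator_iff measurableSet_Ico).2 (integrableOn_const (by simp)), ?_⟩
  rw [integral_indicator_one measurableSet_Ico, Real.volume_real_Ico, max_sub_min_eq_abs',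
    max_eq_left (abs_nonneg _)]

variable {X : Type*} [Fintype X]

/-- A quadratic inequality for real functions on a finite set passes to distances on the line. -/
theorem sum_mul_abs_sub_le {v w : X → X → ℝ}
    (h : ∀ G : X → ℝ, ∑ x, ∑ y, v x y * (G x - G y) ^ 2 ≤ ∑ x, ∑ y, w x y * (G x - G y) ^ 2)
    (F : X → ℝ) :
    ∑ x, ∑ y, v x y * |F x - F y| ≤ ∑ x, ∑ y, w x y * |F x - F y| := by
  have hi (u : X → X → ℝ) (x y : X) : Integrable (fun s => u x y *
      ((Set.Iio (F x)).indicator 1 s - (Set.Iio (F y)).indicator 1 s : ℝ) ^ 2) :=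
    (integral_indicator_sub_sq _ _).1.const_mul _
  have e (u : X → X → ℝ) : ∑ x, ∑ y, u x y * |F x - F y| = ∫ s, ∑ x, ∑ y, u x y *
      ((Set.Iio (F x)).indicator 1 s - (Set.Iio (F y)).indicator 1 s : ℝ) ^ 2 := by
    rw [integral_finsetSum _ fun x _ => integrable_finsetSum _ fun y _ => hi u x y]
    refine Finset.sum_congr rfl fun x _ => ?_
    rw [integral_finsetSum _ fun y _ => hi u x y]
    refine Finset.sum_congr rfl fun y _ => ?_
    rw [integral_const_mul, (integral_indicator_sub_sq _ _).2]
  rw [e, e]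
  exact integral_mono
    (integrable_finsetSum _ fun x _ => integrable_finsetSum _ fun y _ => hi v x y)
    (integrable_finsetSum _ fun x _ => integrable_finsetSum _ fun y _ => hi w x y)
    fun s => h fun x => (Set.Iio (F x)).indicator 1 s

/-- A quadratic inequality for real functions on a finite set passes to distances in `L₁`. -/
theorem sum_mul_norm_sub_le {Ω : Type*} [MeasurableSpace Ω] {μ : Measure Ω} {v w : X → X → ℝ}
    (h : ∀ G : X → ℝ, ∑ x, ∑ y, v x y * (G x - G y) ^ 2 ≤ ∑ x, ∑ y, w x y * (G x - G y) ^ 2)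
    (F : X → Lp ℝ 1 μ) :
    ∑ x, ∑ y, v x y * ‖F x - F y‖ ≤ ∑ x, ∑ y, w x y * ‖F x - F y‖ := by
  have hi (u : X → X → ℝ) (x y : X) : Integrable (fun t => u x y * |F x t - F y t|) μ :=
    (((L1.integrable_coeFn (F x)).sub (L1.integrable_coeFn (F y))).abs).const_mul _
  have e (u : X → X → ℝ) : ∑ x, ∑ y, u x y * ‖F x - F y‖ =
      ∫ t, ∑ x, ∑ y, u x y * |F x t - F y t| ∂μ := by
    rw [integral_finsetSum _ fun x _ => integrable_finsetSum _ fun y _ => hi u x y]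
    refine Finset.sum_congr rfl fun x _ => ?_
    rw [integral_finsetSum _ fun y _ => hi u x y]
    refine Finset.sum_congr rfl fun y _ => ?_
    rw [integral_const_mul, L1.norm_eq_integral_norm]
    congr 1
    refine integral_congr_ae ?_
    filter_upwards [Lp.coeFn_sub (F x) (F y)] with t ht
    rw [ht, Pi.sub_apply, Real.norm_eq_abs]
  rw [e, e]
  exact integral_mono
    (integrable_finsetSum _ fun x _ => integrable_finsetSum _ fun y _ => hi v x y)
    (integrable_finsetSum _ fun x _ => integrable_finsetSum _ fun y _ => hi w x y)
    fun t => sum_mul_abs_sub_le h fun x => F x t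

end L1

section Cycle

open Matrix

/-- The transition matrix of the simple random walk on the cycle `ℤ/N`. -/
noncomputable def cycleWalk (N : ℕ) : Matrix (ZMod N) (ZMod N) ℝ :=
  Matrix.of fun x y => ((if y = x + 1 then 1 else 0) + (if y = x - 1 then 1 else 0)) / 2

theorem cycleWalk_isSymm (N : ℕ) : (cycleWalk N).IsSymm := by
  ext x y
  simp only [cycleWalk, Matrix.transpose_apply, Matrix.of_apply, eq_sub_iff_add_eq,
    eq_comm (b := x + 1), eq_comm (b := y + 1)]
  rw [add_comm]

theorem cycleWalk_nonneg (N : ℕ) (x y : ZMod N) : 0 ≤ cycleWalk N x y := by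
  simp only [cycleWalk, Matrix.of_apply]
  split_ifs <;> norm_num

theorem cycleWalk_mulVec (N : ℕ) [NeZero N] (g : ZMod N → ℝ) (x : ZMod N) :
    (cycleWalk N *ᵥ g) x = (g (x + 1) + g (x - 1)) / 2 := by
  simp only [cycleWalk, Matrix.mulVec, dotProduct, Matrix.of_apply, div_mul_eq_mul_div, add_mul,
    ← Finset.sum_div, Finset.sum_add_distrib, ite_mul, one_mul, zero_mul, Finset.sum_ite_eq',
    Finset.mem_univ, if_true]

theorem cycleWalk_mulVec_one (N : ℕ) [NeZero N] : cycleWalk N *ᵥ 1 = 1 := by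
  ext x
  simp [cycleWalk_mulVec]

theorem stdAddChar_one (N : ℕ) [NeZero N] :
    ZMod.stdAddChar (1 : ZMod N) = Complex.exp (Complex.I * (2 * Real.pi / N : ℝ)) := by
  have := ZMod.stdAddChar_coe (N := N) 1
  rw [Int.cast_one] at this
  rw [this]
  congr 1
  push_cast
  ring

theorem norm_stdAddChar_add_one_sub_le (N : ℕ) [NeZero N] (x : ZMod N) :
    ‖ZMod.stdAddChar (x + 1) - ZMod.stdAddChar x‖ ≤ 2 * Real.pi / N := by
  have h : ZMod.stdAddChar (x + 1) - ZMod.stdAddChar x =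
      ZMod.stdAddChar x * (Complex.exp (Complex.I * (2 * Real.pi / N : ℝ)) - 1) := by
    rw [AddChar.map_add_eq_mul, stdAddChar_one]; ring
  rw [h, norm_mul, ZMod.stdAddChar_apply, Circle.norm_coe, one_mul]
  refine Real.norm_exp_I_mul_ofReal_sub_one_le.trans (le_of_eq ?_)
  rw [Real.norm_eq_abs, abs_of_nonneg (by positivity)]

theorem stdAddChar_add_one_add_sub_one (N : ℕ) [NeZero N] (x : ZMod N) :
    ZMod.stdAddChar (x + 1) + ZMod.stdAddChar (x - 1) =
      (2 * Real.cos (2 * Real.pi / N) : ℝ) * ZMod.stdAddChar x := by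
  rw [sub_eq_add_neg, AddChar.map_add_eq_mul, AddChar.map_add_eq_mul,
    AddChar.map_neg_eq_conj, stdAddChar_one, ← mul_add, Complex.add_conj, mul_comm Complex.I,
    Complex.exp_ofReal_mul_I_re, mul_comm]

/-- The real part of a rotated standard character, as a function on the cycle. -/
noncomputable def cycleWave (N : ℕ) [NeZero N] (u : ℂ) (x : ZMod N) : ℝ :=
  (u * ZMod.stdAddChar x).re

theorem cycleWalk_mulVec_cycleWave (N : ℕ) [NeZero N] (u : ℂ) :
    cycleWalk N *ᵥ cycleWave N u = Real.cos (2 * Real.pi / N) • cycleWave N u := by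
  ext x
  rw [cycleWalk_mulVec, cycleWave, cycleWave, ← Complex.add_re, ← mul_add,
    stdAddChar_add_one_add_sub_one, mul_left_comm, Complex.re_ofReal_mul, Pi.smul_apply,
    smul_eq_mul, cycleWave]
  ring

theorem abs_cycleWave_le (N : ℕ) [NeZero N] {u : ℂ} (hu : ‖u‖ = 1) (x : ZMod N) :
    |cycleWave N u x| ≤ 1 := by
  refine (Complex.abs_re_le_norm _).trans (le_of_eq ?_)
  rw [norm_mul, hu, ZMod.stdAddChar_apply, Circle.norm_coe, one_mul]

theorem abs_cycleWave_sub_le_of_ne_zero (N : ℕ) [NeZero N] {u : ℂ} (hu : ‖u‖ = 1) {x y : ZMod N}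
    (h : cycleWalk N x y ≠ 0) : |cycleWave N u x - cycleWave N u y| ≤ 2 * Real.pi / N := by
  have key (z : ZMod N) : |cycleWave N u (z + 1) - cycleWave N u z| ≤ 2 * Real.pi / N := by
    rw [cycleWave, cycleWave, ← Complex.sub_re, ← mul_sub]
    refine (Complex.abs_re_le_norm _).trans ?_
    rw [norm_mul, hu, one_mul]
    exact norm_stdAddChar_add_one_sub_le N z
  by_cases h1 : y = x + 1
  · rw [abs_sub_comm, h1]
    exact key x
  · by_cases h2 : y = x - 1
    · have := key y
      rwa [h2, sub_add_cancel, ← h2] at this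
    · exact absurd (by simp [cycleWalk, h1, h2]) h

theorem abs_cycleWave_sub_le_of_sq_ne_zero (N : ℕ) [NeZero N] {u : ℂ} (hu : ‖u‖ = 1)
    {x y : ZMod N} (h : (cycleWalk N ^ 2) x y ≠ 0) :
    |cycleWave N u x - cycleWave N u y| ≤ 4 * Real.pi / N := by
  rw [sq, Matrix.mul_apply] at h
  obtain ⟨z, -, hz⟩ := Finset.exists_ne_zero_of_sum_ne_zero h
  have h1 := abs_cycleWave_sub_le_of_ne_zero N hu (left_ne_zero_of_mul hz)
  have h2 := abs_cycleWave_sub_le_of_ne_zero N hu (right_ne_zero_of_mul hz)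
  refine (abs_sub_le _ (cycleWave N u z) _).trans ((add_le_add h1 h2).trans (le_of_eq ?_))
  ring

theorem cycleWave_one_sq_add (N : ℕ) [NeZero N] (x : ZMod N) :
    cycleWave N 1 x ^ 2 + cycleWave N Complex.I x ^ 2 = 1 := by
  have h : ‖(ZMod.stdAddChar x : ℂ)‖ ^ 2 = 1 := by
    rw [ZMod.stdAddChar_apply, Circle.norm_coe, one_pow]
  rw [Complex.sq_norm, Complex.normSq_apply] at h
  simp only [cycleWave, one_mul, Complex.mul_re, Complex.I_re, Complex.I_im]
  linarith

/-- One of the two quadratures has mean square at least `1 / 2` on any finite set of coordinates. -/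
theorem exists_le_sum_cycleWave_sq (N : ℕ) [NeZero N] {X ι : Type*} [Fintype X] [Fintype ι]
    (e : ι → X → ZMod N) : ∃ u : ℂ, ‖u‖ = 1 ∧
      (Fintype.card ι * Fintype.card X / 2 : ℝ) ≤ ∑ i, ∑ x, cycleWave N u (e i x) ^ 2 := by
  have h : ∑ i, ∑ x, cycleWave N 1 (e i x) ^ 2 + ∑ i, ∑ x, cycleWave N Complex.I (e i x) ^ 2 =
      Fintype.card ι * Fintype.card X := by
    simp only [← Finset.sum_add_distrib, cycleWave_one_sq_add]
    simp
  by_contra! hc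
  have h1 := hc 1 (by simp)
  have h2 := hc Complex.I (by simp)
  linarith

theorem cos_two_pi_div_pow_le {N : ℕ} (hN : 4 ≤ N) :
    Real.cos (2 * Real.pi / N) ^ (2 * N ^ 2) ≤ 1 / 2 := by
  have hN' : (4 : ℝ) ≤ N := by exact_mod_cast hN
  have hpi := Real.pi_pos
  have hs : 4 / N ≤ Real.sin (2 * Real.pi / N) := by
    have := Real.mul_le_sin (x := 2 * Real.pi / N) (by positivity) (by
      rw [div_le_div_iff₀ (by positivity) (by positivity)]; nlinarith)
    refine le_trans (le_of_eq ?_) this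
    field_simp
    ring
  have hs2 : (4 / N : ℝ) ^ 2 ≤ Real.sin (2 * Real.pi / N) ^ 2 := by gcongr
  have hexp : Real.cos (2 * Real.pi / N) ^ 2 ≤ Real.exp (-(4 / N : ℝ) ^ 2) := by
    rw [Real.cos_sq']
    have := Real.add_one_le_exp (-(4 / N : ℝ) ^ 2)
    linarith
  calc Real.cos (2 * Real.pi / N) ^ (2 * N ^ 2)
      = (Real.cos (2 * Real.pi / N) ^ 2) ^ (N ^ 2) := pow_mul _ _ _
    _ ≤ Real.exp (-(4 / N : ℝ) ^ 2) ^ (N ^ 2) := by gcongr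
    _ = Real.exp (-16) := by
        rw [← Real.exp_nat_mul]
        congr 1
        push_cast
        field_simp
        norm_num
    _ ≤ 1 / 2 := by
        rw [Real.exp_neg, one_div]
        have := Real.add_one_le_exp (16 : ℝ)
        gcongr
        linarith

end Cycle

section LqEmbedding

/-- The step function on `(0, 1]` whose value on `(j/n, (j+1)/n]` is `a j`. -/
noncomputable def stepFun (n : ℕ) (a : Fin n → ℝ) (t : ℝ) : ℝ :=
  ∑ j : Fin n, (Set.Ioc (j / n : ℝ) ((j + 1) / n)).indicator (fun _ => a j) t

theorem stepFun_of_mem {n : ℕ} (a : Fin n → ℝ) (i : Fin n) {t : ℝ}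
    (ht : t ∈ Set.Ioc (i / n : ℝ) ((i + 1) / n)) : stepFun n a t = a i := by
  rw [stepFun, Finset.sum_eq_single i, Set.indicator_of_mem ht]
  · intro j _ hj
    refine Set.indicator_of_notMem (fun hj' => hj ?_) _
    have hn : (0 : ℝ) < n := by exact_mod_cast i.pos
    have h1 := (div_lt_div_iff_of_pos_right hn).1 (ht.1.trans_le hj'.2)
    have h2 := (div_lt_div_iff_of_pos_right hn).1 (hj'.1.trans_le ht.2)
    have h1' : (i : ℕ) < j + 1 := by exact_mod_cast h1
    have h2' : (j : ℕ) < i + 1 := by exact_mod_cast h2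
    ext
    omega
  · simp

theorem abs_stepFun_le {n : ℕ} {a : Fin n → ℝ} {C : ℝ} (hC : 0 ≤ C) (ha : ∀ j, |a j| ≤ C) (t : ℝ) :
    |stepFun n a t| ≤ C := by
  by_cases h : ∃ i : Fin n, t ∈ Set.Ioc (i / n : ℝ) ((i + 1) / n)
  · obtain ⟨i, hi⟩ := h
    rw [stepFun_of_mem a i hi]
    exact ha i
  · push Not at h
    rw [stepFun, Finset.sum_eq_zero fun j _ => Set.indicator_of_notMem (h j) _]
    simpa using hC

theorem measurable_stepFun (n : ℕ) (a : Fin n → ℝ) : Measurable (stepFun n a) :=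
  Finset.measurable_fun_sum _ fun _ _ => measurable_const.indicator measurableSet_Ioc

theorem stepFun_sub (n : ℕ) (a b : Fin n → ℝ) : stepFun n (a - b) = stepFun n a - stepFun n b := by
  ext t
  simp only [stepFun, Pi.sub_apply, ← Finset.sum_sub_distrib]
  refine Finset.sum_congr rfl fun j _ => ?_
  by_cases h : t ∈ Set.Ioc (j / n : ℝ) ((j + 1) / n) <;> simp [h]

theorem memLp_stepFun (n : ℕ) (a : Fin n → ℝ) (p : ENNReal) :
    MemLp (stepFun n a) p (volume.restrict (Set.Icc (0 : ℝ) 1)) :=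
  MemLp.of_bound (measurable_stepFun n a).aestronglyMeasurable (∑ j, |a j|) <| .of_forall fun t =>
    abs_stepFun_le (Finset.sum_nonneg fun _ _ => abs_nonneg _)
      (fun j => Finset.single_le_sum (f := fun j => |a j|) (fun _ _ => abs_nonneg _)
        (Finset.mem_univ j)) t

theorem norm_toLp_stepFun_le {n : ℕ} {a : Fin n → ℝ} {C : ℝ} (hC : 0 ≤ C) (ha : ∀ j, |a j| ≤ C)
    (p : ENNReal) [Fact (1 ≤ p)] : ‖(memLp_stepFun n a p).toLp‖ ≤ C := by
  refine (Lp.norm_le_of_ae_bound (C := C) hC ?_).trans (le_of_eq ?_)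
  · filter_upwards [(memLp_stepFun n a p).coeFn_toLp] with t ht
    rw [ht]
    exact abs_stepFun_le hC ha t
  · simp [measureUnivNNReal]

theorem abs_le_norm_toLp_stepFun {n : ℕ} (a : Fin n → ℝ) {q : ℝ} (hq : 0 < q) (i : Fin n) :
    (1 / n : ℝ) ^ (1 / q) * |a i| ≤ ‖(memLp_stepFun n a (ENNReal.ofReal q)).toLp‖ := by
  set I := Set.Ioc (i / n : ℝ) ((i + 1) / n)
  have hn : (0 : ℝ) < n := by exact_mod_cast i.pos
  have hI : volume.restrict (Set.Icc (0 : ℝ) 1) I = ENNReal.ofReal (1 / n) := by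
    rw [Measure.restrict_apply measurableSet_Ioc, Set.inter_eq_left.2, Real.volume_Ioc]
    · congr 1
      ring
    · refine fun t ht => ⟨(by positivity : (0 : ℝ) ≤ i / n).trans ht.1.le, ht.2.trans ?_⟩
      rw [div_le_one hn]
      exact_mod_cast i.2
  have h := eLpNorm_indicator_le (s := I) (p := ENNReal.ofReal q)
    (μ := volume.restrict (Set.Icc (0 : ℝ) 1)) (stepFun n a)
  have e : I.indicator (stepFun n a) = I.indicator fun _ => a i := by
    ext t
    by_cases ht : t ∈ I
    · simp [ht, stepFun_of_mem a i ht]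
    · simp [ht]
  rw [e, eLpNorm_indicator_const measurableSet_Ioc (by simpa using hq) (by simp), hI,
    ENNReal.toReal_ofReal hq.le] at h
  rw [Lp.norm_toLp]
  refine le_trans (le_of_eq ?_)
    (ENNReal.toReal_mono (memLp_stepFun n a (ENNReal.ofReal q)).eLpNorm_ne_top h)
  rw [ENNReal.toReal_mul, ← ENNReal.toReal_rpow, ENNReal.toReal_ofReal (by positivity),
    toReal_enorm, Real.norm_eq_abs, mul_comm]

end LqEmbedding

section NonEmbedding

open Matrix

/-- The image in `L_p` of a point of the discrete torus `(ℤ/N)ⁿ`. -/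
noncomputable def cycleWaveLp (N n : ℕ) [NeZero N] (u : ℂ) (p : ENNReal) (x : Fin n → ZMod N) :
    Lp ℝ p (volume.restrict (Set.Icc (0 : ℝ) 1)) :=
  (memLp_stepFun n (fun j => cycleWave N u (x j)) p).toLp

theorem cycleWaveLp_sub (N n : ℕ) [NeZero N] (u : ℂ) (p : ENNReal) (x y : Fin n → ZMod N) :
    cycleWaveLp N n u p x - cycleWaveLp N n u p y =
      (memLp_stepFun n (fun j => cycleWave N u (x j) - cycleWave N u (y j)) p).toLp := by
  rw [cycleWaveLp, cycleWaveLp, ← MemLp.toLp_sub]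
  congr 1
  exact (stepFun_sub n _ _).symm

/-- The quantitative obstruction to embedding `L_q` into `L₁`, from the discrete torus of side `N`
and dimension `N ^ 2`. -/
theorem mul_rpow_le_of_lipschitz_embedding {q : ℝ} (hq : 0 < q) [Fact (1 ≤ ENNReal.ofReal q)]
    {Ω : Type*} [MeasurableSpace Ω] {μ : Measure Ω}
    {f : Lp ℝ (ENNReal.ofReal q) (volume.restrict (Set.Icc (0 : ℝ) 1)) → Lp ℝ 1 μ} {K : ℝ}
    (hK : 0 < K) (hf : ∀ x y, K⁻¹ * ‖x - y‖ ≤ ‖f x - f y‖ ∧ ‖f x - f y‖ ≤ K * ‖x - y‖)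
    {N k : ℕ} (hN : 4 ≤ N) (hk : N ^ 2 = 2 ^ k) :
    N * (1 / (N ^ 2 : ℕ) : ℝ) ^ (1 / q) ≤ 16 * Real.pi * K ^ 2 := by
  have : NeZero N := ⟨by omega⟩
  have hN0 : (0 : ℝ) < N := by exact_mod_cast (by omega : 0 < N)
  have hn0 : (0 : ℝ) < (2 : ℝ) ^ k := by positivity
  set n := N ^ 2
  set r : ℝ := (1 / (n : ℕ) : ℝ) ^ (1 / q)
  have hr : 0 ≤ r := by positivity
  obtain ⟨u, hu, hsum⟩ := exists_le_sum_cycleWave_sq N (fun (i : Fin n) (x : Fin n → ZMod N) => x i)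
  set F : (Fin n → ZMod N) → Lp ℝ 1 μ := fun x => f (cycleWaveLp N n u (ENNReal.ofReal q) x)
  set A := cycleWalk N
  have hA : A.IsSymm := cycleWalk_isSymm N
  have hA0 : ∀ x y, 0 ≤ A x y := cycleWalk_nonneg N
  have hA1 : A *ᵥ 1 = 1 := cycleWalk_mulVec_one N
  set cX : ℝ := ((Fintype.card (Fin n → ZMod N) : ℕ) : ℝ)
  have hcX : 0 < cX := Nat.cast_pos.2 Fintype.card_pos
  have main := sum_mul_norm_sub_le (sum_tensorPow_mul_sub_sq_le (ι := Fin n) hA hA1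
    (by rw [Fintype.card_fin, hk])) F
  have upper : ∑ x, ∑ y, (2 ^ k * tensorPow A (fun _ : Fin n => 2) x y) * ‖F x - F y‖ ≤
      2 ^ k * cX * (K * (4 * Real.pi / N)) := by
    have hrow (x : Fin n → ZMod N) : ∑ y, tensorPow A (fun _ : Fin n => 2) x y = 1 := by
      simpa [Matrix.mulVec, dotProduct] using
        congrFun (tensorPow_mulVec_one hA1 (fun _ : Fin n => 2)) x
    calc ∑ x, ∑ y, (2 ^ k * tensorPow A (fun _ : Fin n => 2) x y) * ‖F x - F y‖
        ≤ ∑ x, ∑ y, (2 ^ k * tensorPow A (fun _ : Fin n => 2) x y) * (K * (4 * Real.pi / N)) := by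
          refine Finset.sum_le_sum fun x _ => Finset.sum_le_sum fun y _ => ?_
          rw [mul_assoc, mul_assoc]
          refine mul_le_mul_of_nonneg_left ?_ hn0.le
          by_cases h0 : tensorPow A (fun _ : Fin n => 2) x y = 0
          · rw [h0, zero_mul, zero_mul]
          · refine mul_le_mul_of_nonneg_left ?_ (tensorPow_nonneg hA0 _ x y)
            refine (hf _ _).2.trans (mul_le_mul_of_nonneg_left ?_ hK.le)
            rw [cycleWaveLp_sub]
            have h0' : ∏ j, (A ^ 2) (x j) (y j) ≠ 0 := h0
            refine norm_toLp_stepFun_le (by positivity) (fun j => ?_) _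
            exact abs_cycleWave_sub_le_of_sq_ne_zero N hu
              (Finset.prod_ne_zero_iff.1 h0' j (Finset.mem_univ j))
      _ = _ := by
          simp only [← Finset.sum_mul, ← Finset.mul_sum, hrow, Finset.sum_const, Finset.card_univ,
            nsmul_eq_mul, mul_one, cX]
          ring
  have lower : 2 ^ k * cX * (K⁻¹ * r / 4) ≤
      ∑ x, ∑ y, (∑ i, tensorPow A (Pi.single i (2 * 2 ^ k)) x y) * ‖F x - F y‖ := by
    have hcos := cos_two_pi_div_pow_le hN
    have hdist (i : Fin n) (x y : Fin n → ZMod N) :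
        K⁻¹ * r / 2 * (cycleWave N u (x i) - cycleWave N u (y i)) ^ 2 ≤ ‖F x - F y‖ := by
      refine le_trans ?_ (hf _ _).1
      rw [mul_div_assoc, mul_assoc]
      refine mul_le_mul_of_nonneg_left ?_ (inv_nonneg.2 hK.le)
      rw [cycleWaveLp_sub]
      refine le_trans ?_ (abs_le_norm_toLp_stepFun _ hq i)
      rw [div_mul_eq_mul_div, mul_div_assoc]
      refine mul_le_mul_of_nonneg_left ?_ hr
      have h1 := abs_cycleWave_le N hu (x i)
      have h2 := abs_cycleWave_le N hu (y i)
      have h3 := abs_sub (cycleWave N u (x i)) (cycleWave N u (y i))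
      rw [← sq_abs]
      nlinarith [abs_nonneg (cycleWave N u (x i) - cycleWave N u (y i))]
    calc 2 ^ k * cX * (K⁻¹ * r / 4)
        ≤ K⁻¹ * r / 2 * ∑ i, ∑ x : Fin n → ZMod N, cycleWave N u (x i) ^ 2 := by
          have hn : (n : ℝ) = 2 ^ k := by exact_mod_cast hk
          rw [Fintype.card_fin, hn] at hsum
          refine le_trans (le_of_eq ?_)
            (mul_le_mul_of_nonneg_left hsum (by positivity : 0 ≤ K⁻¹ * r / 2))
          ring
      _ ≤ K⁻¹ * r / 2 * ∑ i, ∑ x : Fin n → ZMod N, ∑ y, tensorPow A (Pi.single i (2 * 2 ^ k)) x y *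
            (cycleWave N u (x i) - cycleWave N u (y i)) ^ 2 := by
          refine mul_le_mul_of_nonneg_left (Finset.sum_le_sum fun i _ => ?_) (by positivity)
          rw [sum_mul_sub_sq_eq (tensorPow_isSymm hA _) (tensorPow_mulVec_one hA1 _)
            (fun x => cycleWave N u (x i)),
            tensorPow_mulVec_eval hA1 (cycleWalk_mulVec_cycleWave N u) _ i, Pi.single_eq_same,
            dotProduct_smul, smul_eq_mul, ← hk]
          have e : (fun x : Fin n → ZMod N => cycleWave N u (x i)) ⬝ᵥ
              (fun x => cycleWave N u (x i)) = ∑ x : Fin n → ZMod N, cycleWave N u (x i) ^ 2 := by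
            simp [dotProduct, sq]
          rw [e]
          have : 0 ≤ ∑ x : Fin n → ZMod N, cycleWave N u (x i) ^ 2 := by positivity
          nlinarith
      _ ≤ ∑ i, ∑ x : Fin n → ZMod N, ∑ y,
            tensorPow A (Pi.single i (2 * 2 ^ k)) x y * ‖F x - F y‖ := by
          simp only [Finset.mul_sum]
          refine Finset.sum_le_sum fun i _ => Finset.sum_le_sum fun x _ =>
            Finset.sum_le_sum fun y _ => ?_
          rw [mul_left_comm]
          exact mul_le_mul_of_nonneg_left (hdist i x y) (tensorPow_nonneg hA0 _ x y)
      _ = _ := by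
          rw [Finset.sum_comm]
          refine Finset.sum_congr rfl fun x _ => ?_
          rw [Finset.sum_comm]
          simp only [Finset.sum_mul]
  have h := le_of_mul_le_mul_left (lower.trans (main.trans upper)) (by positivity)
  have e1 : N * r = 4 * N * K * (K⁻¹ * r / 4) := by field_simp
  have e2 : 16 * Real.pi * K ^ 2 = 4 * N * K * (K * (4 * Real.pi / N)) := by field_simp; ring
  rw [e1, e2]
  exact mul_le_mul_of_nonneg_left h (by positivity)

end NonEmbedding

/-- For `q > 2`, `L_q([0,1])` does not Lipschitz embed into `L_1([0,1])`. -/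
theorem no_lipschitz_embedding_Lq_into_L1
    (q : ℝ) (hq : 2 < q) [Fact (1 ≤ ENNReal.ofReal q)] :
    ¬ ∃ (f : Lp ℝ (ENNReal.ofReal q) (volume.restrict (Set.Icc (0:ℝ) 1)) →
          Lp ℝ 1 (volume.restrict (Set.Icc (0:ℝ) 1))) (K : ℝ),
        1 ≤ K ∧
        ∀ x y, K⁻¹ * ‖x - y‖ ≤ ‖f x - f y‖ ∧ ‖f x - f y‖ ≤ K * ‖x - y‖ := by
  rintro ⟨f, K, hK, hf⟩
  have hq0 : 0 < q := by linarith
  have hexp : 0 < 1 - 2 / q := by rw [sub_pos, div_lt_one hq0]; exact hq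
  have hlim : Filter.Tendsto (fun l : ℕ => ((2 ^ l : ℕ) : ℝ) ^ (1 - 2 / q)) Filter.atTop
      Filter.atTop :=
    (tendsto_rpow_atTop hexp).comp (tendsto_natCast_atTop_atTop.comp
      (tendsto_pow_atTop_atTop_of_one_lt one_lt_two))
  obtain ⟨l, hl, hl2⟩ := ((hlim.eventually_gt_atTop (16 * Real.pi * K ^ 2)).and
    (Filter.eventually_ge_atTop 2)).exists
  have hN : 4 ≤ 2 ^ l := (by norm_num : 4 = 2 ^ 2).trans_le (Nat.pow_le_pow_right two_pos hl2)
  have h := mul_rpow_le_of_lipschitz_embedding hq0 (by linarith) hf hN (pow_mul 2 l 2).symm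
  refine absurd hl (not_lt.2 (le_trans (le_of_eq ?_) h))
  have hpos : (0 : ℝ) < (2 ^ l : ℕ) := by positivity
  rw [Real.rpow_sub hpos, Real.rpow_one, div_eq_mul_inv, one_div, Real.inv_rpow (by positivity),
    Nat.cast_pow (2 ^ l) 2, ← Real.rpow_natCast _ 2, ← Real.rpow_mul hpos.le]
  congr 3
  push_cast
  ring
end

section
/- (Lindenstrauss) There is a Lipschitz retraction with Lipschitz constant 2 from ℓ_∞ onto c₀: there exists a map f : ℓ_∞ → ℓ_∞ such that ‖f x − f y‖ ≤ 2‖x − y‖ for all x, y ∈ ℓ_∞, f(x) n → 0 as n → ∞ for every x ∈ ℓ_∞, and f(x) = x whenever x n → 0 as n → ∞. -/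
open Filter Topology ENNReal

/-- Soft thresholding of `t` at level `d`: for `0 ≤ d`, it moves `t` towards `0` by `d`. -/
noncomputable def softThreshold (d t : ℝ) : ℝ := max (t - d) 0 - max (-t - d) 0

lemma softThreshold_zero (t : ℝ) : softThreshold 0 t = t := by
  simp [softThreshold, max_zero_sub_max_neg_zero_eq_self]

lemma abs_softThreshold {d : ℝ} (hd : 0 ≤ d) (t : ℝ) :
    |softThreshold d t| = max (|t| - d) 0 := by
  unfold softThreshold
  grind

lemma abs_softThreshold_sub_le {d e : ℝ} (hd : 0 ≤ d) (he : 0 ≤ e) (s t : ℝ) :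
    |softThreshold d s - softThreshold e t| ≤ |s - t| + |d - e| := by
  unfold softThreshold
  grind

/-- The sequences in `ℓ_∞` which tend to `0`. -/
def nullSequences : Set (lp (fun _ : ℕ => ℝ) ∞) :=
  {x | Tendsto (fun n : ℕ => (x : ∀ _ : ℕ, ℝ) n) atTop (𝓝 0)}

lemma nullSequences_nonempty : nullSequences.Nonempty :=
  ⟨0, by simp [nullSequences]⟩

lemma eventually_abs_sub_infDist_lt (x : lp (fun _ : ℕ => ℝ) ∞) {ε : ℝ} (hε : 0 < ε) :
    ∀ᶠ n in atTop, |x n| - Metric.infDist x nullSequences < ε := by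
  obtain ⟨y, hy, hxy⟩ := (Metric.infDist_lt_iff nullSequences_nonempty).1
    (lt_add_of_pos_right (Metric.infDist x nullSequences) (half_pos hε))
  filter_upwards [hy.abs.eventually_lt_const (u := ε / 2) (by simpa using hε)] with n hn
  have h := lp.norm_apply_le_norm ENNReal.top_ne_zero (x - y) n
  rw [← dist_eq_norm, lp.coeFn_sub, Pi.sub_apply, Real.norm_eq_abs] at h
  linarith [abs_sub_abs_le_abs_sub (x n) (y n)]

/-- Soft thresholding of a bounded sequence at its distance to the null sequences. -/
noncomputable def nullRetraction (x : lp (fun _ : ℕ => ℝ) ∞) : lp (fun _ : ℕ => ℝ) ∞ :=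
  ⟨fun n => softThreshold (Metric.infDist x nullSequences) (x n), memℓp_infty <| by
    refine ⟨‖x‖, ?_⟩
    rintro _ ⟨n, rfl⟩
    have h := lp.norm_apply_le_norm ENNReal.top_ne_zero x n
    have hd : 0 ≤ Metric.infDist x nullSequences := Metric.infDist_nonneg
    rw [Real.norm_eq_abs] at h
    simp only [Real.norm_eq_abs, abs_softThreshold hd]
    exact max_le (by linarith) (norm_nonneg x)⟩

lemma nullRetraction_apply (x : lp (fun _ : ℕ => ℝ) ∞) (n : ℕ) :
    nullRetraction x n = softThreshold (Metric.infDist x nullSequences) (x n) := rfl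

/-- (Lindenstrauss) There is a Lipschitz retraction, with Lipschitz constant 2, from
`ℓ_∞` onto `c₀` (the subspace of sequences tending to `0`). -/
theorem lipschitz_retraction_linfty_onto_c0 :
    ∃ f : lp (fun _ : ℕ => ℝ) ∞ → lp (fun _ : ℕ => ℝ) ∞,
      (∀ x y : lp (fun _ : ℕ => ℝ) ∞, ‖f x - f y‖ ≤ 2 * ‖x - y‖) ∧
      (∀ x : lp (fun _ : ℕ => ℝ) ∞,
        Tendsto (fun n : ℕ => (f x : ∀ _ : ℕ, ℝ) n) atTop (𝓝 0)) ∧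
      (∀ x : lp (fun _ : ℕ => ℝ) ∞,
        Tendsto (fun n : ℕ => (x : ∀ _ : ℕ, ℝ) n) atTop (𝓝 0) → f x = x) := by
  refine ⟨nullRetraction, fun x y => ?_, fun x => ?_, fun x hx => ?_⟩
  · refine lp.norm_le_of_forall_le (by positivity) fun n => ?_
    have h := lp.norm_apply_le_norm ENNReal.top_ne_zero (x - y) n
    rw [lp.coeFn_sub, Pi.sub_apply, Real.norm_eq_abs] at h ⊢
    have hd := (Metric.lipschitz_infDist_pt nullSequences).dist_le_mul x y
    rw [Real.dist_eq, NNReal.coe_one, one_mul, dist_eq_norm] at hd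
    rw [nullRetraction_apply, nullRetraction_apply]
    linarith [abs_softThreshold_sub_le (Metric.infDist_nonneg (x := x) (s := nullSequences))
      (Metric.infDist_nonneg (x := y) (s := nullSequences)) (x n) (y n)]
  · rw [Metric.tendsto_nhds]
    intro ε hε
    filter_upwards [eventually_abs_sub_infDist_lt x hε] with n hn
    rw [Real.dist_0_eq_abs, nullRetraction_apply, abs_softThreshold Metric.infDist_nonneg]
    exact max_lt hn hε
  · ext n
    rw [nullRetraction_apply, Metric.infDist_zero_of_mem (show x ∈ nullSequences from hx),
      softThreshold_zero]
end

section
/- (Heinrich–Mankiewicz) Let X and Y be separable reflexive real Banach spaces (the canonical embeddings J_X : X → X** and J_Y : Y → Y** are surjective) each linearly isomorphic to its square (there exist continuous linear equivalences X ≃ X × X and Y ≃ Y × Y). If X and Y are Lipschitz equivalent — there is a bijection f : X → Y with f and f⁻¹ both Lipschitz — then X and Y are linearly isomorphic: there is a continuous linear equivalence X ≃ Y. -/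
open NormedSpace NNReal
open Filter MeasureTheory Topology

section WeakLimits

variable {E : Type*} [NormedAddCommGroup E] [NormedSpace ℝ E]

/-- In a reflexive space, bounded families have weak limits along ultrafilters. -/
lemma exists_weak_limit (hE : Function.Surjective (inclusionInDoubleDual ℝ E))
    {ι : Type*} (l : Ultrafilter ι) (u : ι → E) (C : ℝ) (hu : ∀ᶠ i in (l : Filter ι), ‖u i‖ ≤ C) :
    ∃ x : E, ∀ φ : StrongDual ℝ E, Tendsto (fun i ↦ φ (u i)) l (𝓝 (φ x)) := by
  have bound (φ : StrongDual ℝ E) : ∀ᶠ i in (l : Filter ι), ‖φ (u i)‖ ≤ C * ‖φ‖ := by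
    filter_upwards [hu] with i hi
    rw [mul_comm]
    exact (φ.le_opNorm _).trans (by gcongr)
  have lim (φ : StrongDual ℝ E) : ∃ a : ℝ, Tendsto (fun i ↦ φ (u i)) l (𝓝 a) := by
    obtain ⟨a, -, ha⟩ := (isCompact_closedBall (0 : ℝ) (C * ‖φ‖)).ultrafilter_le_nhds
      (l.map fun i ↦ φ (u i)) (by
        rw [le_principal_iff, Ultrafilter.coe_map, mem_map]
        filter_upwards [bound φ] with i hi
        simpa using hi)
    exact ⟨a, ha⟩
  choose a ha using lim
  let Λ : StrongDual ℝ E →ₗ[ℝ] ℝ :=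
    { toFun := a
      map_add' := fun φ ψ ↦ tendsto_nhds_unique (ha (φ + ψ)) ((ha φ).add (ha ψ))
      map_smul' := fun c φ ↦ tendsto_nhds_unique (ha (c • φ)) ((ha φ).const_mul c) }
  obtain ⟨x, hx⟩ := hE (Λ.mkContinuous C fun φ ↦ le_of_tendsto (ha φ).norm (bound φ))
  refine ⟨x, fun φ ↦ ?_⟩
  have : φ x = a φ := by rw [← dual_def ℝ E x φ, hx]; rfl
  rw [this]
  exact ha φ

lemma norm_le_of_weak_limit {ι : Type*} {l : Filter ι} [l.NeBot] {u : ι → E} {x : E} {C : ℝ}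
    (hx : ∀ φ : StrongDual ℝ E, Tendsto (fun i ↦ φ (u i)) l (𝓝 (φ x)))
    (hu : ∀ᶠ i in l, ‖u i‖ ≤ C) : ‖x‖ ≤ C := by
  obtain ⟨φ, hφ, hφx⟩ := exists_dual_vector'' ℝ x
  have h : φ x = ‖x‖ := hφx
  rw [← h]
  refine le_of_tendsto (hx φ) ?_
  filter_upwards [hu] with i hi
  calc φ (u i) ≤ ‖φ (u i)‖ := Real.le_norm_self _
    _ ≤ ‖φ‖ * ‖u i‖ := φ.le_opNorm _
    _ ≤ 1 * C := by gcongr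
    _ = C := one_mul C

lemma weak_limit_unique {ι : Type*} {l : Filter ι} [l.NeBot] {u : ι → E} {x y : E}
    (hx : ∀ φ : StrongDual ℝ E, Tendsto (fun i ↦ φ (u i)) l (𝓝 (φ x)))
    (hy : ∀ φ : StrongDual ℝ E, Tendsto (fun i ↦ φ (u i)) l (𝓝 (φ y))) : x = y :=
  (SeparatingDual.eq_iff_forall_dual_eq (R := ℝ)).2 fun φ ↦ tendsto_nhds_unique (hx φ) (hy φ)

/-- A separable normed space admits a countable norming family of functionals. -/
lemma exists_seq_norming [TopologicalSpace.SeparableSpace E] :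
    ∃ φ : ℕ → StrongDual ℝ E, (∀ k, ‖φ k‖ ≤ 1) ∧
      ∀ (y : E) (c : ℝ), (∀ k, φ k y ≤ c) → ‖y‖ ≤ c := by
  choose φ hφ hφy using fun y : E ↦ exists_dual_vector'' ℝ y
  refine ⟨fun k ↦ φ (TopologicalSpace.denseSeq E k), fun k ↦ hφ _, fun y c hc ↦ ?_⟩
  refine le_of_forall_pos_le_add fun ε hε ↦ ?_
  obtain ⟨k, hk⟩ := (TopologicalSpace.denseRange_denseSeq E).exists_dist_lt y (half_pos hε)
  set z := TopologicalSpace.denseSeq E k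
  have h1 : φ z z = ‖z‖ := hφy z
  have h2 : ‖φ z (z - y)‖ ≤ 1 * ‖z - y‖ := (φ z).le_of_opNorm_le (hφ z) _
  rw [map_sub, h1, Real.norm_eq_abs] at h2
  rw [dist_eq_norm] at hk
  have h3 := hc k
  have h4 := le_abs_self (‖z‖ - φ z y)
  have h5 := norm_sub_norm_le y z
  rw [norm_sub_rev z y] at h2
  change φ z y ≤ c at h3
  linarith

end WeakLimits

section Gelfand

variable {Y : Type*} [NormedAddCommGroup Y] [NormedSpace ℝ Y]
  [TopologicalSpace.SeparableSpace Y] {C : ℝ≥0}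

/-- Lipschitz curves in separable reflexive spaces are differentiable almost everywhere. -/
theorem LipschitzWith.ae_differentiableAt_of_reflexive
    (hY : Function.Surjective (inclusionInDoubleDual ℝ Y)) {γ : ℝ → Y} (hγ : LipschitzWith C γ) :
    ∀ᵐ t, DifferentiableAt ℝ γ t := by
  obtain ⟨φ, hφ, hφn⟩ := exists_seq_norming (E := Y)
  have hφγ (k : ℕ) : LipschitzWith C (fun t ↦ φ k (γ t)) := by
    refine LipschitzWith.of_dist_le_mul fun s t ↦ ?_
    rw [dist_eq_norm, ← map_sub]
    refine ((φ k).le_of_opNorm_le (hφ k) _).trans ?_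
    rw [one_mul, ← dist_eq_norm]
    exact hγ.dist_le_mul s t
  have hφ_le (k : ℕ) (y : Y) : |φ k y| ≤ ‖y‖ := by
    simpa using (φ k).le_of_opNorm_le (hφ k) y
  have deriv_le (k : ℕ) (t : ℝ) : |deriv (fun t ↦ φ k (γ t)) t| ≤ C :=
    norm_deriv_le_of_lipschitz (hφγ k)
  let h (y : Y) (t : ℝ) : ℝ := ⨆ k, |deriv (fun t ↦ φ k (γ t)) t - φ k y|
  have term_le (y : Y) (t : ℝ) (k : ℕ) :
      |deriv (fun t ↦ φ k (γ t)) t - φ k y| ≤ C + ‖y‖ :=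
    (abs_sub _ _).trans (add_le_add (deriv_le k t) (hφ_le k y))
  have le_h (y : Y) (t : ℝ) (k : ℕ) : |deriv (fun t ↦ φ k (γ t)) t - φ k y| ≤ h y t :=
    le_ciSup (f := fun k ↦ |deriv (fun t ↦ φ k (γ t)) t - φ k y|)
      ⟨C + ‖y‖, by rintro _ ⟨k, rfl⟩; exact term_le y t k⟩ k
  have h_le (y : Y) (t : ℝ) : h y t ≤ C + ‖y‖ := ciSup_le (term_le y t)
  have h_nonneg (y : Y) (t : ℝ) : 0 ≤ h y t := (abs_nonneg _).trans (le_h y t 0)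
  have h_meas (y : Y) : Measurable (h y) :=
    Measurable.iSup fun k ↦ ((measurable_deriv _).sub_const _).abs
  have h_int (y : Y) : LocallyIntegrable (h y) volume := by
    refine (locallyIntegrable_const (C + ‖y‖)).mono (h_meas y).aestronglyMeasurable ?_
    filter_upwards with t
    rw [Real.norm_of_nonneg (h_nonneg y t)]
    exact (h_le y t).trans (Real.le_norm_self _)
  have h_ii (y : Y) (a b : ℝ) : IntervalIntegrable (h y) volume a b :=
    intervalIntegrable_iff.mpr <|
      ((h_int y).integrableOn_isCompact isCompact_uIcc).mono_set Set.uIoc_subset_uIcc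
  have increment_le (y : Y) (t s : ℝ) :
      ‖γ s - γ t - (s - t) • y‖ ≤ |∫ r in t..s, h y r| := by
    refine hφn _ _ fun k ↦ ?_
    have dii : IntervalIntegrable (deriv fun t ↦ φ k (γ t)) volume t s :=
      AbsolutelyContinuousOnInterval.intervalIntegrable_deriv
        (hφγ k).lipschitzOnWith.absolutelyContinuousOnInterval
    have e : φ k (γ s - γ t - (s - t) • y)
        = ∫ r in t..s, (deriv (fun t ↦ φ k (γ t)) r - φ k y) := by
      rw [intervalIntegral.integral_sub dii (by simp),
        ((hφγ k).lipschitzOnWith.absolutelyContinuousOnInterval).integral_deriv_eq_sub]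
      simp
    rw [e]
    refine (le_abs_self _).trans ?_
    rw [← Real.norm_eq_abs]
    exact intervalIntegral.norm_integral_le_abs_of_norm_le
      (Eventually.of_forall fun r ↦ le_h y r k) (h_ii y t s)
  have ae1 : ∀ᵐ t, ∀ k, DifferentiableAt ℝ (fun t ↦ φ k (γ t)) t :=
    ae_all_iff.2 fun k ↦ (hφγ k).ae_differentiableAt_real
  have ae2 : ∀ᵐ t, ∀ j, ∀ c, HasDerivAt
      (fun x ↦ ∫ r in c..x, h (TopologicalSpace.denseSeq Y j) r)
      (h (TopologicalSpace.denseSeq Y j) t) t :=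
    ae_all_iff.2 fun j ↦ LocallyIntegrable.ae_hasDerivAt_integral (h_int _)
  filter_upwards [ae1, ae2] with t ht1 ht2
  obtain ⟨w, hw⟩ := exists_weak_limit hY (Ultrafilter.of (𝓝[≠] t)) (slope γ t) C
    (by
      filter_upwards with s
      rw [slope_def_module, norm_smul, norm_inv]
      rcases eq_or_ne s t with rfl | hst
      · simp
      · have : 0 < ‖s - t‖ := norm_pos_iff.2 (sub_ne_zero.2 hst)
        rw [inv_mul_le_iff₀ this, mul_comm]
        exact hγ.norm_sub_le s t)
  have hφw (k : ℕ) : φ k w = deriv (fun t ↦ φ k (γ t)) t := by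
    have h1 := (hasDerivAt_iff_tendsto_slope.1 (ht1 k).hasDerivAt).mono_left
      (Ultrafilter.of_le (𝓝[≠] t))
    refine tendsto_nhds_unique (hw (φ k)) (h1.congr fun s ↦ ?_)
    simp [slope_def_module]
  refine HasDerivAt.differentiableAt (f' := w) ?_
  rw [hasDerivAt_iff_isLittleO, Asymptotics.isLittleO_iff]
  intro ε hε
  obtain ⟨j, hj⟩ := (TopologicalSpace.denseRange_denseSeq Y).exists_dist_lt w
    (show 0 < ε / 3 by positivity)
  set y := TopologicalSpace.denseSeq Y j
  rw [dist_eq_norm] at hj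
  have h_small : h y t ≤ ε / 3 := by
    refine ciSup_le fun k ↦ ?_
    rw [← hφw, ← map_sub]
    exact (hφ_le k _).trans hj.le
  have hd := ht2 j t
  rw [hasDerivAt_iff_isLittleO, Asymptotics.isLittleO_iff] at hd
  filter_upwards [hd (show 0 < ε / 3 by positivity)] with s hs
  simp only [intervalIntegral.integral_same, sub_zero, smul_eq_mul, Real.norm_eq_abs] at hs ⊢
  have e : γ s - γ t - (s - t) • w = (γ s - γ t - (s - t) • y) + (s - t) • (y - w) := by
    rw [smul_sub]; abel
  rw [e]
  have n1 := increment_le y t s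
  have n2 : ‖(s - t) • (y - w)‖ ≤ |s - t| * (ε / 3) := by
    rw [norm_smul, Real.norm_eq_abs, norm_sub_rev y w]
    gcongr
  have n3 : |∫ r in t..s, h y r| ≤ ε / 3 * |s - t| + |s - t| * (ε / 3) := by
    have := abs_add_le ((∫ r in t..s, h y r) - (s - t) * h y t) ((s - t) * h y t)
    rw [sub_add_cancel, abs_mul, abs_of_nonneg (h_nonneg y t)] at this
    exact this.trans (add_le_add hs (by gcongr))
  have := norm_add_le (γ s - γ t - (s - t) • y) ((s - t) • (y - w))
  linarith

/-- Lipschitz maps from a finite-dimensional space to a separable reflexive space are almost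
everywhere differentiable in any given direction. -/
theorem LipschitzWith.ae_lineDifferentiableAt_of_reflexive [CompleteSpace Y]
    (hY : Function.Surjective (inclusionInDoubleDual ℝ Y))
    {E : Type*} [NormedAddCommGroup E] [NormedSpace ℝ E] [MeasurableSpace E] [BorelSpace E]
    [FiniteDimensional ℝ E] (μ : Measure E) [μ.IsAddHaarMeasure] {f : E → Y}
    (hf : LipschitzWith C f) (v : E) : ∀ᵐ p ∂μ, LineDifferentiableAt ℝ f p v := by
  let L : ℝ →L[ℝ] E := ContinuousLinearMap.smulRight (1 : ℝ →L[ℝ] ℝ) v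
  suffices A : ∀ p, ∀ᵐ (t : ℝ) ∂volume, LineDifferentiableAt ℝ f (p + t • v) v from
    ae_mem_of_ae_add_linearMap_mem L.toLinearMap volume μ
      (measurableSet_lineDifferentiableAt hf.continuous) A
  intro p
  have : ∀ᵐ (s : ℝ), DifferentiableAt ℝ (fun t ↦ f (p + t • v)) s :=
    (hf.comp ((LipschitzWith.const p).add L.lipschitz)).ae_differentiableAt_of_reflexive hY
  filter_upwards [this] with s hs
  have h's : DifferentiableAt ℝ (fun t ↦ f (p + t • v)) (s + 0) := by simpa using hs
  have : DifferentiableAt ℝ (fun t ↦ s + t) 0 := differentiableAt_id.const_add _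
  simp only [LineDifferentiableAt]
  convert! h's.comp 0 this with _ t
  simp only [add_assoc, Function.comp_apply, add_smul]

/-- Almost everywhere, line derivatives of a Lipschitz map from a finite-dimensional space to a
separable reflexive space exist and are additive on a given pair of directions. -/
theorem LipschitzWith.ae_lineDeriv_add_of_reflexive [CompleteSpace Y]
    (hY : Function.Surjective (inclusionInDoubleDual ℝ Y))
    {E : Type*} [NormedAddCommGroup E] [NormedSpace ℝ E] [MeasurableSpace E] [BorelSpace E]
    [FiniteDimensional ℝ E] (μ : Measure E) [μ.IsAddHaarMeasure] {f : E → Y}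
    (hf : LipschitzWith C f) (u v : E) :
    ∀ᵐ p ∂μ, LineDifferentiableAt ℝ f p u ∧ LineDifferentiableAt ℝ f p v ∧
      LineDifferentiableAt ℝ f p (u + v) ∧
      lineDeriv ℝ f p (u + v) = lineDeriv ℝ f p u + lineDeriv ℝ f p v := by
  obtain ⟨φ, hφ, hφn⟩ := exists_seq_norming (E := Y)
  have hd : ∀ᵐ p ∂μ, ∀ k, DifferentiableAt ℝ (fun x ↦ φ k (f x)) p :=
    ae_all_iff.2 fun k ↦ ((φ k).lipschitz.comp hf).ae_differentiableAt
  filter_upwards [hd, hf.ae_lineDifferentiableAt_of_reflexive hY μ u,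
    hf.ae_lineDifferentiableAt_of_reflexive hY μ v,
    hf.ae_lineDifferentiableAt_of_reflexive hY μ (u + v)] with p hp hu hv huv
  refine ⟨hu, hv, huv, ?_⟩
  have key (k : ℕ) (w : E) (hw : LineDifferentiableAt ℝ f p w) :
      φ k (lineDeriv ℝ f p w) = fderiv ℝ (fun x ↦ φ k (f x)) p w := by
    have h1 : HasLineDerivAt ℝ (fun x ↦ φ k (f x)) (φ k (lineDeriv ℝ f p w)) p w :=
      (φ k).hasFDerivAt.comp_hasDerivAt (0 : ℝ) hw.hasLineDerivAt
    exact h1.unique ((hp k).hasFDerivAt.hasLineDerivAt w)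
  rw [← sub_eq_zero, ← norm_le_zero_iff]
  refine hφn _ _ fun k ↦ ?_
  rw [map_sub, map_add, key k _ hu, key k _ hv, key k _ huv, map_add, sub_self]

end Gelfand

section LipschitzLeftInverses

variable {X Y : Type*} [NormedAddCommGroup X] [NormedSpace ℝ X]
  [NormedAddCommGroup Y] [NormedSpace ℝ Y] {K : ℝ≥0}

omit [NormedSpace ℝ Y] in
/-- Pointwise weak limits of equi-Lipschitz maps into a reflexive space. -/
lemma exists_lipschitz_weak_limit (hX : Function.Surjective (inclusionInDoubleDual ℝ X))
    {ι : Type*} (l : Ultrafilter ι) {u : ι → Y → X} (hu : ∀ i, LipschitzWith K (u i))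
    (hu0 : ∀ i, u i 0 = 0) :
    ∃ g : Y → X, LipschitzWith K g ∧
      ∀ y (φ : StrongDual ℝ X), Tendsto (fun i ↦ φ (u i y)) l (𝓝 (φ (g y))) := by
  choose g hg using fun y ↦ exists_weak_limit hX l (fun i ↦ u i y) (K * ‖y‖)
    (Eventually.of_forall fun i ↦ by simpa [hu0 i] using (hu i).norm_sub_le y 0)
  refine ⟨g, LipschitzWith.of_dist_le_mul fun y z ↦ ?_, hg⟩
  rw [dist_eq_norm, dist_eq_norm]
  refine norm_le_of_weak_limit (l := (l : Filter ι)) (u := fun i ↦ u i y - u i z) (fun φ ↦ ?_)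
    (Eventually.of_forall fun i ↦ (hu i).norm_sub_le y z)
  simpa using (hg y φ).sub (hg z φ)

/-- The inverse of a Lipschitz equivalence, blown up at a point of Gateaux differentiability,
yields a Lipschitz left inverse of the derivative. -/
lemma exists_lipschitz_leftInverse_of_hasLineDerivAt
    (hX : Function.Surjective (inclusionInDoubleDual ℝ X))
    (f : X ≃ Y) (hf' : LipschitzWith K f.symm) {p : X} {D : X →L[ℝ] Y}
    (hD : ∀ v, HasLineDerivAt ℝ f (D v) p v) :
    ∃ g : Y → X, LipschitzWith K g ∧ ∀ x, g (D x) = x := by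
  let l : Ultrafilter ℝ := Ultrafilter.of (𝓝[≠] 0)
  let u (t : ℝ) (y : Y) : X := t⁻¹ • (f.symm (f p + t • y) - p)
  have hu (t : ℝ) : LipschitzWith K (u t) := by
    refine LipschitzWith.of_dist_le_mul fun y z ↦ ?_
    rw [dist_eq_norm, dist_eq_norm]
    have e : u t y - u t z = t⁻¹ • (f.symm (f p + t • y) - f.symm (f p + t • z)) := by
      simp only [u, ← smul_sub]; congr 1; abel
    have h := hf'.norm_sub_le (f p + t • y) (f p + t • z)
    rw [add_sub_add_left_eq_sub, ← smul_sub, norm_smul] at h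
    rw [e, norm_smul, norm_inv]
    rcases eq_or_ne t 0 with rfl | ht
    · simp; positivity
    · rw [inv_mul_le_iff₀ (norm_pos_iff.2 ht)]
      linarith
  obtain ⟨g, hg, hgl⟩ := exists_lipschitz_weak_limit hX l hu (fun t ↦ by simp [u])
  refine ⟨g, hg, fun x ↦ weak_limit_unique (hgl (D x)) fun φ ↦ ?_⟩
  refine (φ.continuous.tendsto x).comp (Tendsto.mono_left ?_ (Ultrafilter.of_le (𝓝[≠] (0 : ℝ))))
  have h0 : Tendsto (fun t : ℝ ↦ K * ‖t⁻¹ • (f (p + t • x) - f p) - D x‖) (𝓝[≠] 0) (𝓝 0) := by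
    simpa using ((hD x).tendsto_slope_zero.sub_const (D x)).norm.const_mul (K : ℝ)
  rw [tendsto_iff_norm_sub_tendsto_zero]
  refine squeeze_zero' (Eventually.of_forall fun _ ↦ norm_nonneg _) ?_ h0
  filter_upwards [self_mem_nhdsWithin] with t ht
  have ht : t ≠ 0 := ht
  have e1 : u t (D x) - x
      = t⁻¹ • (f.symm (f p + t • D x) - f.symm (f (p + t • x))) := by
    rw [f.symm_apply_apply, ← sub_sub, smul_sub _ _ (t • x), smul_smul, inv_mul_cancel₀ ht,
      one_smul]
  have e2 : t⁻¹ • (f (p + t • x) - f p) - D x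
      = t⁻¹ • (f (p + t • x) - (f p + t • D x)) := by
    rw [← sub_sub, smul_sub _ _ (t • D x), smul_smul, inv_mul_cancel₀ ht, one_smul]
  rw [e1, e2, norm_smul, norm_smul]
  have := hf'.norm_sub_le (f p + t • D x) (f (p + t • x))
  rw [norm_sub_rev (f p + t • D x)] at this
  calc _ ≤ ‖t⁻¹‖ * (K * ‖f (p + t • x) - (f p + t • D x)‖) := by gcongr
    _ = _ := by ring

/-- Averaging a Lipschitz left inverse of `D` along the direction `D d` makes it equivariant in
that direction, without destroying equivariance in other directions. -/
lemma exists_equivariant_leftInverse (hX : Function.Surjective (inclusionInDoubleDual ℝ X))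
    (D : X →L[ℝ] Y) (d : X) {h : Y → X} (hK : LipschitzWith K h) (hD : ∀ x, h (D x) = x) :
    ∃ g : Y → X, (LipschitzWith K g ∧ ∀ x, g (D x) = x) ∧ (∀ y, g (y + D d) = g y + d) ∧
      ∀ e, (∀ y, h (y + D e) = h y + e) → ∀ y, g (y + D e) = g y + e := by
  let b (k : ℕ) (y : Y) : X := h (y + (k : ℝ) • D d) - (k : ℝ) • d
  let A (n : ℕ) (y : Y) : X := ((n : ℝ) + 1)⁻¹ • ∑ k ∈ Finset.range (n + 1), b k y
  have hn (n : ℕ) : (n : ℝ) + 1 ≠ 0 := by positivity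
  have hb (k : ℕ) (y z : Y) : ‖b k y - b k z‖ ≤ K * ‖y - z‖ := by
    have := hK.norm_sub_le (y + (k : ℝ) • D d) (z + (k : ℝ) • D d)
    simpa [b] using this
  have hbD (k : ℕ) (x : X) : b k (D x) = x := by
    simp only [b]
    rw [← map_smul, ← map_add, hD]; abel
  have avg (n : ℕ) (x : X) : ((n : ℝ) + 1)⁻¹ • ∑ _k ∈ Finset.range (n + 1), x = x := by
    rw [Finset.sum_const, Finset.card_range, ← Nat.cast_smul_eq_nsmul ℝ, smul_smul]
    push_cast
    rw [inv_mul_cancel₀ (hn n), one_smul]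
  have hAD (n : ℕ) (x : X) : A n (D x) = x := by
    simp only [A, hbD]
    exact avg n x
  have hA (n : ℕ) : LipschitzWith K (A n) := by
    refine LipschitzWith.of_dist_le_mul fun y z ↦ ?_
    rw [dist_eq_norm, dist_eq_norm]
    simp only [A]
    rw [← smul_sub, ← Finset.sum_sub_distrib, norm_smul, norm_inv,
      inv_mul_le_iff₀ (norm_pos_iff.2 (hn n)), Real.norm_of_nonneg (by positivity)]
    refine (norm_sum_le_of_le _ fun k _ ↦ hb k y z).trans_eq ?_
    simp
  obtain ⟨g, hg, hgl⟩ := exists_lipschitz_weak_limit hX (hyperfilter ℕ) hA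
    (fun n ↦ by simpa using hAD n 0)
  refine ⟨g, ⟨hg, fun x ↦ ?_⟩, fun y ↦ ?_, fun e he y ↦ ?_⟩
  · refine weak_limit_unique (hgl (D x)) fun φ ↦ ?_
    simp only [hAD]
    exact tendsto_const_nhds
  · refine weak_limit_unique (hgl (y + D d)) fun φ ↦ ?_
    have shift (n : ℕ) : A n (y + D d)
        = A n y + d + ((n : ℝ) + 1)⁻¹ • (b (n + 1) y - b 0 y) := by
      rw [← Finset.sum_range_sub (fun k ↦ b k y) (n + 1)]
      conv_rhs => rw [← avg n d]
      simp only [A]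
      rw [← smul_add, ← smul_add, ← Finset.sum_add_distrib, ← Finset.sum_add_distrib]
      congr 1
      refine Finset.sum_congr rfl fun k _ ↦ ?_
      simp only [b]
      push_cast
      rw [add_smul, add_smul, one_smul, one_smul, add_assoc y (D d), add_comm (D d)]
      abel
    have small : Tendsto (fun n : ℕ ↦ ((n : ℝ) + 1)⁻¹ • (b (n + 1) y - b 0 y)) atTop (𝓝 0) := by
      have hlim : Tendsto (fun n : ℕ ↦ ((n : ℝ) + 1)⁻¹ * (2 * (K * ‖y‖))) atTop (𝓝 0) := by
        have := tendsto_one_div_add_atTop_nhds_zero_nat (𝕜 := ℝ)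
        simpa using this.mul_const (2 * (K * ‖y‖))
      refine squeeze_zero_norm (fun n ↦ ?_) hlim
      rw [norm_smul, norm_inv, Real.norm_of_nonneg (show (0 : ℝ) ≤ n + 1 by positivity)]
      have hb0 (k : ℕ) : ‖b k y‖ ≤ K * ‖y‖ := by
        have h0 : b k 0 = 0 := by simpa using hbD k 0
        simpa [h0] using hb k y 0
      gcongr
      linarith [norm_sub_le (b (n + 1) y) (b 0 y), hb0 (n + 1), hb0 0]
    have small' := ((φ.continuous.tendsto 0).comp small).mono_left (Nat.hyperfilter_le_atTop)
    simp only [shift, map_add]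
    simpa using ((hgl y φ).add_const (φ d)).add small'
  · refine weak_limit_unique (hgl (y + D e)) fun φ ↦ ?_
    have shift (n : ℕ) : A n (y + D e) = A n y + e := by
      conv_rhs => rw [← avg n e]
      simp only [A]
      rw [← smul_add, ← Finset.sum_add_distrib]
      congr 1
      refine Finset.sum_congr rfl fun k _ ↦ ?_
      simp only [b]
      rw [add_right_comm, he]
      abel
    simp only [shift, map_add]
    exact (hgl y φ).add_const _

/-- A Lipschitz left inverse of `D` can be made equivariant under translations along the range
of `D`. -/
lemma exists_forall_equivariant_leftInverse [TopologicalSpace.SeparableSpace X]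
    (hX : Function.Surjective (inclusionInDoubleDual ℝ X))
    (D : X →L[ℝ] Y) {h : Y → X} (hK : LipschitzWith K h) (hD : ∀ x, h (D x) = x) :
    ∃ g : Y → X, LipschitzWith K g ∧ ∀ y z, g (y + D z) = g y + z := by
  let S := {g : Y → X // LipschitzWith K g ∧ ∀ x, g (D x) = x}
  let d := TopologicalSpace.denseSeq X
  choose F hF1 hF2 hF3 using fun (v : X) (g : S) ↦
    exists_equivariant_leftInverse hX D v g.2.1 g.2.2
  let a (n : ℕ) : S := Nat.rec ⟨h, hK, hD⟩ (fun n g ↦ ⟨F (d n) g, hF1 (d n) g⟩) n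
  have ha (n k : ℕ) (hkn : k < n) (y : Y) : (a n).1 (y + D (d k)) = (a n).1 y + d k := by
    induction n generalizing y with
    | zero => omega
    | succ n ih =>
      rcases Nat.lt_succ_iff_lt_or_eq.1 hkn with hlt | rfl
      · exact hF3 (d n) (a n) (d k) (ih hlt) y
      · exact hF2 (d k) (a k) y
  obtain ⟨g, hg, hgl⟩ := exists_lipschitz_weak_limit hX (hyperfilter ℕ) (fun n ↦ (a n).2.1)
    (fun n ↦ by simpa using (a n).2.2 0)
  refine ⟨g, hg, fun y z ↦ ?_⟩
  refine (TopologicalSpace.denseRange_denseSeq X).induction_on z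
    (isClosed_eq (hg.continuous.comp (by fun_prop)) (by fun_prop)) fun k ↦ ?_
  refine weak_limit_unique (hgl _) fun φ ↦ ?_
  have := (hgl y φ).add_const (φ (d k))
  rw [map_add]
  refine this.congr' ?_
  have hk : ∀ᶠ n in (hyperfilter ℕ : Filter ℕ), k < n :=
    Nat.hyperfilter_le_atTop (eventually_gt_atTop k)
  filter_upwards [hk] with n hn
  rw [← map_add, ← ha n k hn y]

end LipschitzLeftInverses

section ProductMeasure

/-- Replacing one coordinate of a random sequence by an independent copy does not change
its law. -/
lemma measurePreserving_update_infinitePi {ι Ω : Type*} [DecidableEq ι] [MeasurableSpace Ω]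
    (ν : Measure Ω) [IsProbabilityMeasure ν] (i : ι) :
    MeasurePreserving (fun q : (ι → Ω) × Ω ↦ Function.update q.1 i q.2)
      ((Measure.infinitePi fun _ : ι ↦ ν).prod ν) (Measure.infinitePi fun _ : ι ↦ ν) := by
  have hm : Measurable (fun q : (ι → Ω) × Ω ↦ Function.update q.1 i q.2) := by
    refine measurable_pi_lambda _ fun j ↦ ?_
    rcases eq_or_ne j i with rfl | hj
    · simpa using measurable_snd
    · simp only [Function.update_of_ne hj]
      fun_prop
  refine ⟨hm, Measure.eq_infinitePi _ fun s t ht ↦ ?_⟩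
  rw [Measure.map_apply hm (MeasurableSet.pi s.countable_toSet fun j _ ↦ ht j)]
  have e : (fun q : (ι → Ω) × Ω ↦ Function.update q.1 i q.2) ⁻¹' Set.pi s t
      = Set.pi (s.erase i) t ×ˢ (if i ∈ s then t i else Set.univ) := by
    ext ⟨ω, a⟩
    simp only [Set.mem_preimage, Set.mem_pi, SetLike.mem_coe, Set.mem_prod, Finset.mem_erase]
    constructor
    · refine fun h ↦ ⟨fun j hj ↦ by simpa [hj.1] using h j hj.2, ?_⟩
      split_ifs with hi
      · simpa using h i hi
      · trivial
    · rintro ⟨h1, h2⟩ j hj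
      rcases eq_or_ne j i with rfl | hji
      · simpa [hj] using h2
      · simpa [hji] using h1 j ⟨hji, hj⟩
  rw [e, Measure.prod_prod, Measure.infinitePi_pi _ fun j _ ↦ ht j]
  split_ifs with hi
  · exact Finset.prod_erase_mul s _ hi
  · simp [Finset.erase_eq_of_notMem hi]

/-- A measurable event which holds for almost every choice of the coordinates `i` and `j`,
the other coordinates being frozen, holds almost surely. -/
lemma ae_infinitePi_of_forall_ae_update {ι Ω : Type*} [DecidableEq ι] [MeasurableSpace Ω]
    (ν : Measure Ω) [IsProbabilityMeasure ν] (i j : ι) {s : Set (ι → Ω)} (hs : MeasurableSet s)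
    (h : ∀ ω : ι → Ω, ∀ᵐ q ∂ν.prod ν,
      Function.update (Function.update ω i q.1) j q.2 ∈ s) :
    ∀ᵐ ω ∂Measure.infinitePi fun _ : ι ↦ ν, ω ∈ s := by
  have hi := (measurePreserving_update_infinitePi ν i).prod (MeasurePreserving.id ν)
  have hG := ((measurePreserving_update_infinitePi ν j).comp hi).comp
    ((measurePreserving_prodAssoc (Measure.infinitePi fun _ : ι ↦ ν) ν ν).symm
      MeasurableEquiv.prodAssoc)
  rw [← hG.map_eq]
  refine (ae_map_iff (p := (· ∈ s)) hG.measurable.aemeasurable hs).2 ?_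
  exact (Measure.ae_prod_mem_iff_ae_ae_mem (hG.measurable hs)).2 (Eventually.of_forall h)

end ProductMeasure

section Gateaux

variable {X Y : Type*} [NormedAddCommGroup X] [NormedSpace ℝ X]
  [NormedAddCommGroup Y] [NormedSpace ℝ Y] {C : ℝ≥0}

/-- For a Lipschitz map, line differentiability in a dense set of directions implies
line differentiability in every direction. -/
lemma LipschitzWith.lineDifferentiableAt_of_dense [CompleteSpace Y] {f : X → Y}
    (hf : LipschitzWith C f) {p : X} {s : Set X} (hs : Dense s)
    (h : ∀ v ∈ s, LineDifferentiableAt ℝ f p v) (v : X) : LineDifferentiableAt ℝ f p v := by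
  suffices H : ∃ w, Tendsto (fun t : ℝ ↦ t⁻¹ • (f (p + t • v) - f p)) (𝓝[≠] 0) (𝓝 w) by
    obtain ⟨w, hw⟩ := H
    exact (hasLineDerivAt_iff_tendsto_slope_zero.2 hw).lineDifferentiableAt
  refine cauchy_map_iff_exists_tendsto.1 (Metric.cauchy_iff.2 ⟨inferInstance, fun ε hε ↦ ?_⟩)
  obtain ⟨u, hus, hu⟩ := hs.exists_dist_lt v (show 0 < ε / (4 * (C + 1)) by positivity)
  have close (t : ℝ) : dist (t⁻¹ • (f (p + t • v) - f p)) (t⁻¹ • (f (p + t • u) - f p))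
      ≤ ε / 4 := by
    rw [dist_eq_norm, ← smul_sub, sub_sub_sub_cancel_right, norm_smul, norm_inv]
    rcases eq_or_ne t 0 with rfl | ht
    · simp; positivity
    · rw [inv_mul_le_iff₀ (norm_pos_iff.2 ht)]
      have h1 := hf.norm_sub_le (p + t • v) (p + t • u)
      rw [add_sub_add_left_eq_sub, ← smul_sub, norm_smul, ← dist_eq_norm v u] at h1
      refine h1.trans ?_
      rw [mul_left_comm]
      gcongr
      calc (C : ℝ) * dist v u ≤ (C + 1) * (ε / (4 * (C + 1))) := by gcongr; simp
        _ = ε / 4 := by field_simp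
  have hlim := (h u hus).hasLineDerivAt.tendsto_slope_zero
  refine ⟨_, image_mem_map (Metric.tendsto_nhds.1 hlim (ε / 4) (by positivity)), ?_⟩
  rintro _ ⟨t, ht, rfl⟩ _ ⟨t', ht', rfl⟩
  simp only [Set.mem_ofPred_eq] at ht ht'
  have e1 := close t
  have e2 := close t'
  rw [dist_comm] at e2
  rw [dist_comm] at ht'
  calc _ ≤ _ := dist_triangle4 _ _ _ _
    _ ≤ _ := add_le_add_left (add_le_add_right (dist_triangle _ (lineDeriv ℝ f p u) _) _) _
    _ < ε := by linarith

/-- The line derivatives of a Lipschitz map depend in a Lipschitz way on the direction. -/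
lemma LipschitzWith.lipschitzWith_lineDeriv {f : X → Y} (hf : LipschitzWith C f) {p : X}
    (h : ∀ v, LineDifferentiableAt ℝ f p v) : LipschitzWith C (lineDeriv ℝ f p) := by
  refine LipschitzWith.of_dist_le_mul fun u v ↦ ?_
  rw [dist_eq_norm, dist_eq_norm]
  refine le_of_tendsto ((h u).hasLineDerivAt.tendsto_slope_zero.sub
    (h v).hasLineDerivAt.tendsto_slope_zero).norm ?_
  filter_upwards [self_mem_nhdsWithin] with t ht
  rw [← smul_sub, sub_sub_sub_cancel_right, norm_smul, norm_inv,
    inv_mul_le_iff₀ (norm_pos_iff.2 ht)]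
  have h1 := hf.norm_sub_le (p + t • u) (p + t • v)
  rw [add_sub_add_left_eq_sub, ← smul_sub, norm_smul] at h1
  linarith

/-- If the line derivatives of a Lipschitz map at a point exist and are additive along distinct
members of a dense sequence of directions, then the map is Gateaux differentiable there. -/
lemma LipschitzWith.exists_hasLineDerivAt_of_denseRange [CompleteSpace Y] {f : X → Y}
    (hf : LipschitzWith C f) {p : X} {d : ℕ → X} (hd : DenseRange d)
    (hdiff : ∀ i, LineDifferentiableAt ℝ f p (d i))
    (hadd : ∀ i j, i ≠ j →
      lineDeriv ℝ f p (d i + d j) = lineDeriv ℝ f p (d i) + lineDeriv ℝ f p (d j)) :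
    ∃ D : X →L[ℝ] Y, ∀ v, HasLineDerivAt ℝ f (D v) p v := by
  have hall := hf.lineDifferentiableAt_of_dense hd (by rintro _ ⟨i, rfl⟩; exact hdiff i)
  have hlip := hf.lipschitzWith_lineDeriv hall
  have hc := hlip.continuous
  have additive (u v : X) :
      lineDeriv ℝ f p (u + v) = lineDeriv ℝ f p u + lineDeriv ℝ f p v := by
    refine hd.induction_on₂ (p := fun u v ↦ lineDeriv ℝ f p (u + v)
      = lineDeriv ℝ f p u + lineDeriv ℝ f p v) ?_ (fun i j ↦ ?_) u v
    · exact isClosed_eq (by fun_prop) (by fun_prop)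
    · rcases eq_or_ne i j with rfl | hij
      · rw [← two_smul ℝ, ← two_smul ℝ, lineDeriv_smul]
      · exact hadd i j hij
  let D : X →ₗ[ℝ] Y :=
    { toFun := lineDeriv ℝ f p
      map_add' := additive
      map_smul' := fun c v ↦ lineDeriv_smul }
  exact ⟨⟨D, hc⟩, fun v ↦ (hall v).hasLineDerivAt⟩

/-- A Lipschitz map from a separable Banach space to a separable reflexive space is Gateaux
differentiable at some point. -/
theorem LipschitzWith.exists_hasLineDerivAt_of_reflexive
    [CompleteSpace X] [TopologicalSpace.SeparableSpace X]
    [CompleteSpace Y] [TopologicalSpace.SeparableSpace Y]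
    (hY : Function.Surjective (inclusionInDoubleDual ℝ Y)) {f : X → Y} (hf : LipschitzWith C f) :
    ∃ (p : X) (D : X →L[ℝ] Y), ∀ v, HasLineDerivAt ℝ f (D v) p v := by
  borelize X Y
  have : SecondCountableTopology Y := UniformSpace.secondCountable_of_separable Y
  let d := TopologicalSpace.denseSeq X
  let c (i : ℕ) : ℝ := (1 / 2) ^ i * (1 + ‖d i‖)⁻¹
  have hc (i : ℕ) : 0 < c i := by positivity
  let x (i : ℕ) : X := c i • d i
  have hterm (ω : ℕ → unitInterval) (i : ℕ) : ‖(ω i : ℝ) • x i‖ ≤ (1 / 2) ^ i := by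
    have h1 : ‖(ω i : ℝ)‖ ≤ 1 := by
      rw [Real.norm_of_nonneg (ω i).2.1]; exact (ω i).2.2
    have h2 : (1 + ‖d i‖)⁻¹ * ‖d i‖ ≤ 1 := by
      rw [inv_mul_le_iff₀ (by positivity)]; linarith
    rw [norm_smul, norm_smul, Real.norm_of_nonneg (hc i).le]
    calc _ ≤ 1 * ((1 / 2) ^ i * (1 + ‖d i‖)⁻¹ * ‖d i‖) := by gcongr
      _ = (1 / 2) ^ i * ((1 + ‖d i‖)⁻¹ * ‖d i‖) := by ring
      _ ≤ (1 / 2) ^ i * 1 := by gcongr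
      _ = _ := mul_one _
  let T (ω : ℕ → unitInterval) : X := ∑' i, (ω i : ℝ) • x i
  have hTs (ω : ℕ → unitInterval) : Summable fun i ↦ (ω i : ℝ) • x i :=
    Summable.of_norm_bounded summable_geometric_two (hterm ω)
  have hT : Continuous T :=
    continuous_tsum (fun i ↦ by fun_prop) summable_geometric_two fun i ω ↦ hterm ω i
  have hTu (ω : ℕ → unitInterval) (i : ℕ) (a : unitInterval) :
      T (Function.update ω i a) = T ω + ((a : ℝ) - ω i) • x i := by
    rw [← sub_eq_iff_eq_add', ← (hTs _).tsum_sub (hTs ω), tsum_eq_single i]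
    · simp [sub_smul]
    · intro j hj
      simp [hj]
  let G (i j : ℕ) : Set X := {p | LineDifferentiableAt ℝ f p (d i) ∧
    LineDifferentiableAt ℝ f p (d j) ∧ LineDifferentiableAt ℝ f p (d i + d j) ∧
      lineDeriv ℝ f p (d i + d j) = lineDeriv ℝ f p (d i) + lineDeriv ℝ f p (d j)}
  have hG (i j : ℕ) : MeasurableSet (G i j) := by
    have hm (v : X) := measurable_lineDeriv (𝕜 := ℝ) (v := v) hf.continuous
    have hs (v : X) := measurableSet_lineDifferentiableAt (𝕜 := ℝ) (v := v) hf.continuous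
    exact (hs _).inter ((hs _).inter ((hs _).inter
      (measurableSet_eq_fun (hm _) ((hm _).add (hm _)))))
  have hae (i j : ℕ) (hij : i ≠ j) :
      ∀ᵐ ω ∂Measure.infinitePi fun _ : ℕ ↦ (volume : Measure unitInterval), T ω ∈ G i j := by
    refine ae_infinitePi_of_forall_ae_update volume i j (hT.measurable (hG i j)) fun ω ↦ ?_
    let L : ℝ × ℝ →L[ℝ] X :=
      (ContinuousLinearMap.fst ℝ ℝ ℝ).smulRight (x i) +
        (ContinuousLinearMap.snd ℝ ℝ ℝ).smulRight (x j)
    let b : X := T ω - (ω i : ℝ) • x i - (ω j : ℝ) • x j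
    have hL1 : L ((c i)⁻¹, 0) = d i := by
      simp [L, x, smul_smul, inv_mul_cancel₀ (hc i).ne']
    have hL2 : L (0, (c j)⁻¹) = d j := by
      simp [L, x, smul_smul, inv_mul_cancel₀ (hc j).ne']
    have hplane := ((hf.comp ((LipschitzWith.const b).add L.lipschitz))
      ).ae_lineDeriv_add_of_reflexive hY (volume : Measure (ℝ × ℝ)) ((c i)⁻¹, 0) (0, (c j)⁻¹)
    have hcoe : Measure.QuasiMeasurePreserving
        (Prod.map ((↑) : unitInterval → ℝ) ((↑) : unitInterval → ℝ))
        (volume.prod volume) (volume : Measure (ℝ × ℝ)) := by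
      refine (unitInterval.measurePreserving_coe.prod
        unitInterval.measurePreserving_coe).quasiMeasurePreserving.mono_right ?_
      rw [Measure.prod_restrict]
      exact Measure.absolutelyContinuous_of_le Measure.restrict_le_self
    filter_upwards [hcoe.ae hplane] with q hq
    have hbq : T (Function.update (Function.update ω i q.1) j q.2)
        = b + L (Prod.map (↑) (↑) q) := by
      rw [hTu, hTu, Function.update_of_ne hij.symm]
      simp only [b, L, Prod.map, add_apply,
        ContinuousLinearMap.smulRight_apply, ContinuousLinearMap.coe_fst',
        ContinuousLinearMap.coe_snd', sub_smul]
      abel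
    have line (v : ℝ × ℝ) : (fun t : ℝ ↦ f (b + L (Prod.map (↑) (↑) q) + t • L v))
        = fun t : ℝ ↦ (f ∘ ((fun _ ↦ b) + ⇑L)) (Prod.map (↑) (↑) q + t • v) := by
      ext t
      simp [add_assoc]
    change _ ∈ G i j
    simp only [G, Set.mem_ofPred_eq]
    rw [hbq, ← hL1, ← hL2, ← map_add]
    simp only [LineDifferentiableAt, lineDeriv, line]
    exact hq
  have hall : ∀ᵐ ω ∂Measure.infinitePi fun _ : ℕ ↦ (volume : Measure unitInterval),
      ∀ i j, i ≠ j → T ω ∈ G i j := by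
    rw [ae_all_iff]; intro i
    rw [ae_all_iff]; intro j
    by_cases hij : i = j
    · simp [hij]
    · filter_upwards [hae i j hij] with ω hω _ using hω
  obtain ⟨ω, hω⟩ := hall.exists
  exact ⟨T ω, hf.exists_hasLineDerivAt_of_denseRange (TopologicalSpace.denseRange_denseSeq X)
    (fun i ↦ (hω i (i + 1) (by simp)).1) fun i j hij ↦ (hω i j hij).2.2.2⟩

end Gateaux

section LipschitzEquivalence

variable {X Y : Type*} [NormedAddCommGroup X] [NormedSpace ℝ X] [CompleteSpace X]
  [TopologicalSpace.SeparableSpace X] [NormedAddCommGroup Y] [NormedSpace ℝ Y] [CompleteSpace Y]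
  [TopologicalSpace.SeparableSpace Y] {K K' : ℝ≥0}

/-- If two separable reflexive spaces are Lipschitz equivalent, then each is isomorphic to a
complemented subspace of the other. -/
lemma exists_complemented_embedding_of_lipschitz_equivalent
    (hX : Function.Surjective (inclusionInDoubleDual ℝ X))
    (hY : Function.Surjective (inclusionInDoubleDual ℝ Y))
    (f : X ≃ Y) (hf : LipschitzWith K f) (hf' : LipschitzWith K' f.symm) :
    ∃ (D : X →L[ℝ] Y) (P : Y →L[ℝ] X), Function.RightInverse D P := by
  obtain ⟨p, D, hD⟩ := hf.exists_hasLineDerivAt_of_reflexive hY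
  obtain ⟨h, hh, hhD⟩ := exists_lipschitz_leftInverse_of_hasLineDerivAt hX f hf' hD
  obtain ⟨g, hg, hgD⟩ := exists_forall_equivariant_leftInverse hX D hh hhD
  obtain ⟨q, P, hP⟩ := hg.exists_hasLineDerivAt_of_reflexive hX
  refine ⟨D, P, fun z ↦ (hP (D z)).unique ?_⟩
  have : (fun t : ℝ ↦ g (q + t • D z)) = fun t : ℝ ↦ g q + t • z := by
    ext t
    rw [← map_smul, hgD]
  simp only [HasLineDerivAt, this]
  simpa using ((hasDerivAt_id (0 : ℝ)).smul_const z).const_add (g q)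

end LipschitzEquivalence

/-- A space with a complemented copy of `E`, where `E` is isomorphic to its square, absorbs `E`. -/
lemma nonempty_continuousLinearEquiv_prod_of_complemented
    {E F : Type*} [NormedAddCommGroup E] [NormedSpace ℝ E] [NormedAddCommGroup F]
    [NormedSpace ℝ F] (e : E ≃L[ℝ] E × E) {D : E →L[ℝ] F} {P : F →L[ℝ] E}
    (h : Function.RightInverse D P) : Nonempty (F ≃L[ℝ] E × F) :=
  let s := ContinuousLinearEquiv.equivOfRightInverse P D h
  ⟨((s.trans (e.prodCongr (.refl ℝ _))).trans (.prodAssoc ℝ E E P.ker)).trans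
    ((ContinuousLinearEquiv.refl ℝ E).prodCongr s.symm)⟩

/-- **Pełczyński decomposition**: two spaces isomorphic to their squares, each of which is
isomorphic to a complemented subspace of the other, are isomorphic. -/
lemma nonempty_continuousLinearEquiv_of_complemented
    {X Y : Type*} [NormedAddCommGroup X] [NormedSpace ℝ X] [NormedAddCommGroup Y]
    [NormedSpace ℝ Y] (hX : Nonempty (X ≃L[ℝ] X × X)) (hY : Nonempty (Y ≃L[ℝ] Y × Y))
    (hXY : ∃ (D : X →L[ℝ] Y) (P : Y →L[ℝ] X), Function.RightInverse D P)
    (hYX : ∃ (D : Y →L[ℝ] X) (P : X →L[ℝ] Y), Function.RightInverse D P) :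
    Nonempty (X ≃L[ℝ] Y) := by
  obtain ⟨eX⟩ := hX
  obtain ⟨eY⟩ := hY
  obtain ⟨D, P, h⟩ := hXY
  obtain ⟨D', P', h'⟩ := hYX
  obtain ⟨a⟩ := nonempty_continuousLinearEquiv_prod_of_complemented eX h
  obtain ⟨b⟩ := nonempty_continuousLinearEquiv_prod_of_complemented eY h'
  exact ⟨(b.trans (.prodComm ℝ Y X)).trans a.symm⟩

/-- (Heinrich–Mankiewicz) Separable reflexive real Banach spaces isomorphic to their
squares are linearly isomorphic as soon as they are Lipschitz equivalent. -/
theorem linearly_isomorphic_of_lipschitz_equivalent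
    {X Y : Type*}
    [NormedAddCommGroup X] [NormedSpace ℝ X] [CompleteSpace X]
    [TopologicalSpace.SeparableSpace X]
    [NormedAddCommGroup Y] [NormedSpace ℝ Y] [CompleteSpace Y]
    [TopologicalSpace.SeparableSpace Y]
    (hXrefl : Function.Surjective (inclusionInDoubleDual ℝ X))
    (hYrefl : Function.Surjective (inclusionInDoubleDual ℝ Y))
    (hXsq : Nonempty (X ≃L[ℝ] X × X)) (hYsq : Nonempty (Y ≃L[ℝ] Y × Y))
    (f : X ≃ Y) (K K' : ℝ≥0)
    (hf : LipschitzWith K f) (hf' : LipschitzWith K' f.symm) :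
    Nonempty (X ≃L[ℝ] Y) :=
  nonempty_continuousLinearEquiv_of_complemented hXsq hYsq
    (exists_complemented_embedding_of_lipschitz_equivalent hXrefl hYrefl f hf hf')
    (exists_complemented_embedding_of_lipschitz_equivalent hYrefl hXrefl f.symm hf' hf)
end

section
/- (Aharoni–Lindenstrauss) There exist real Banach spaces X and Y that are Lipschitz equivalent — there is a bijection f : X → Y with f and f⁻¹ both Lipschitz — such that Y does not embed linearly into X: there is no continuous linear map T : Y → X together with a constant c > 0 satisfying c‖y‖ ≤ ‖T y‖ for all y ∈ Y. In particular X and Y are not linearly isomorphic. -/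
open NNReal

open scoped BoundedContinuousFunction
open Filter

namespace AharoniLindenstrauss

section Shear

variable {E F : Type*} [NormedAddCommGroup E] [NormedAddCommGroup F]

/-- The shear `(x, y) ↦ (x - φ y, y)` of `E × F` along a Lipschitz map `φ : F → E`. -/
def shear {K : ℝ≥0} (φ : F → E) (hφ : LipschitzWith K φ) : E × F ≃ₜ E × F where
  toFun p := (p.1 - φ p.2, p.2)
  invFun p := (p.1 + φ p.2, p.2)
  left_inv p := by simp
  right_inv p := by simp
  continuous_toFun := by
    have := hφ.continuous
    fun_prop
  continuous_invFun := by
    have := hφ.continuous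
    fun_prop

theorem lipschitzWith_shear {K : ℝ≥0} (φ : F → E) (hφ : LipschitzWith K φ) :
    LipschitzWith (max (1 + K * 1) 1) (shear φ hφ) :=
  (LipschitzWith.prod_fst.sub (hφ.comp LipschitzWith.prod_snd)).prodMk LipschitzWith.prod_snd

theorem lipschitzWith_shear_symm {K : ℝ≥0} (φ : F → E) (hφ : LipschitzWith K φ) :
    LipschitzWith (max (1 + K * 1) 1) (shear φ hφ).symm :=
  (LipschitzWith.prod_fst.add (hφ.comp LipschitzWith.prod_snd)).prodMk LipschitzWith.prod_snd

/-- A shear carrying `V` to `W` restricts to a Lipschitz equivalence of their closures. -/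
theorem exists_lipschitz_equiv_closure {K : ℝ≥0} (φ : F → E) (hφ : LipschitzWith K φ)
    (V W : Set (E × F)) (h : shear φ hφ '' V = W) :
    ∃ (f : closure V ≃ closure W) (K K' : ℝ≥0),
      LipschitzWith K f ∧ LipschitzWith K' f.symm := by
  have hcl : shear φ hφ '' closure V = closure W := by
    rw [Homeomorph.image_closure, h]
  refine ⟨((shear φ hφ).toEquiv.image (closure V)).trans (Equiv.setCongr hcl),
    max (1 + K * 1) 1, max (1 + K * 1) 1, fun p q => ?_, fun p q => ?_⟩
  · exact lipschitzWith_shear φ hφ p.1 q.1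
  · have key : ∀ r : closure W,
        ((((shear φ hφ).toEquiv.image (closure V)).trans (Equiv.setCongr hcl)).symm r : E × F)
          = (shear φ hφ).symm r := by
      intro r
      rw [Homeomorph.eq_symm_apply]
      exact congrArg Subtype.val (Equiv.apply_symm_apply
        (((shear φ hφ).toEquiv.image (closure V)).trans (Equiv.setCongr hcl)) r)
    rw [Subtype.edist_eq, key, key]
    exact lipschitzWith_shear_symm φ hφ p.1 q.1

end Shear

/-- A functional vanishes at all but countably many members of a family which, like the unit
vectors of `c₀(Γ)`, has uniformly bounded signed partial sums. -/
theorem countable_ne_zero_of_norm_sum_le {Γ F : Type*} [NormedAddCommGroup F] [NormedSpace ℝ F]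
    (v : Γ → F) (hv : ∀ (s : Finset Γ) (ε : Γ → ℝ), (∀ γ, |ε γ| ≤ 1) → ‖∑ γ ∈ s, ε γ • v γ‖ ≤ 1)
    (φ : F →L[ℝ] ℝ) : {γ | φ (v γ) ≠ 0}.Countable := by
  have hsum : Summable fun γ => |φ (v γ)| := by
    refine summable_of_sum_le (c := ‖φ‖) (fun _ => abs_nonneg _) fun s => ?_
    have h1 : ∑ γ ∈ s, |φ (v γ)| = φ (∑ γ ∈ s, ((SignType.sign (φ (v γ)) : SignType) : ℝ) • v γ) := by
      simp [map_sum, sign_mul_self]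
    rw [h1]
    have h2 := φ.le_opNorm (∑ γ ∈ s, ((SignType.sign (φ (v γ)) : SignType) : ℝ) • v γ)
    have h3 := hv s (fun γ => ((SignType.sign (φ (v γ)) : SignType) : ℝ)) fun γ => by
      rcases SignType.sign (φ (v γ)) with _ | _ | _ <;> simp
    have h4 := mul_le_mul_of_nonneg_left h3 (norm_nonneg φ)
    exact (le_abs_self _).trans (h2.trans (by simpa using h4))
  simpa [Function.support] using hsum.countable_support

/-- If `V` contains an uncountable family behaving like the unit vectors of `c₀(Γ)`, while countably
many functionals separate the points of `W`, then `V` does not embed linearly into `W`. -/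
theorem not_exists_linear_embedding {D Γ E F : Type*} [Countable D] [Uncountable Γ]
    [NormedAddCommGroup E] [NormedSpace ℝ E] [NormedAddCommGroup F] [NormedSpace ℝ F]
    (V W : Submodule ℝ (E × F)) (e : D → E →L[ℝ] ℝ) (he : ∀ x, (∀ d, e d x = 0) → x = 0)
    (hW : ∀ p ∈ W, ‖p.2‖ ≤ ‖p.1‖) (v : Γ → E × F) (hvV : ∀ γ, v γ ∈ V) (hv0 : ∀ γ, v γ ≠ 0)
    (hv : ∀ (s : Finset Γ) (ε : Γ → ℝ), (∀ γ, |ε γ| ≤ 1) → ‖∑ γ ∈ s, ε γ • v γ‖ ≤ 1) :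
    ¬ ∃ (T : V →L[ℝ] W) (c : ℝ), 0 < c ∧ ∀ y, c * ‖y‖ ≤ ‖T y‖ := by
  rintro ⟨T, c, hc, hT⟩
  let u (γ : Γ) : V := ⟨v γ, hvV γ⟩
  have hu : ∀ (s : Finset Γ) (ε : Γ → ℝ), (∀ γ, |ε γ| ≤ 1) → ‖∑ γ ∈ s, ε γ • u γ‖ ≤ 1 := by
    intro s ε hε
    rw [Submodule.coe_norm]
    simpa [u] using hv s ε hε
  let φ (d : D) : V →L[ℝ] ℝ := e d ∘L ContinuousLinearMap.fst ℝ E F ∘L W.subtypeL ∘L T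
  have hcount : (⋃ d, {γ | φ d (u γ) ≠ 0}).Countable :=
    Set.countable_iUnion fun d => countable_ne_zero_of_norm_sum_le _ hu (φ d)
  obtain ⟨γ, hγ⟩ : ∃ γ, γ ∉ ⋃ d, {γ | φ d (u γ) ≠ 0} := by
    by_contra! h
    exact Set.not_countable_univ (hcount.mono fun γ _ => h γ)
  simp only [Set.mem_iUnion, Set.mem_ofPred_eq, not_exists, not_not] at hγ
  have h1 : (T (u γ)).1.1 = 0 := he _ hγ
  have h2 := hW _ (T (u γ)).2
  rw [h1, norm_zero, norm_le_zero_iff] at h2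
  have h3 : T (u γ) = 0 := Subtype.ext (Prod.ext h1 h2)
  have h4 := hT (u γ)
  rw [h3, norm_zero] at h4
  have h5 : u γ ≠ 0 := fun h => hv0 γ (congrArg Subtype.val h)
  exact absurd h4 (not_le.2 (mul_pos hc (norm_pos_iff.2 h5)))

theorem exists_of_closed_submodules {E F : Type} [NormedAddCommGroup E] [NormedSpace ℝ E]
    [CompleteSpace E] [NormedAddCommGroup F] [NormedSpace ℝ F] [CompleteSpace F]
    (V W : Submodule ℝ (E × F)) (hV : IsClosed (V : Set (E × F))) (hW : IsClosed (W : Set (E × F)))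
    (hequiv : ∃ (f : V ≃ W) (K K' : ℝ≥0), LipschitzWith K f ∧ LipschitzWith K' f.symm)
    (hemb : ¬ ∃ (T : W →L[ℝ] V) (c : ℝ), 0 < c ∧ ∀ y, c * ‖y‖ ≤ ‖T y‖) :
    ∃ (X Y : Type) (_ : NormedAddCommGroup X) (_ : NormedSpace ℝ X) (_ : CompleteSpace X)
      (_ : NormedAddCommGroup Y) (_ : NormedSpace ℝ Y) (_ : CompleteSpace Y),
      (∃ (f : X ≃ Y) (K K' : ℝ≥0), LipschitzWith K f ∧ LipschitzWith K' f.symm) ∧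
      (¬ ∃ (T : Y →L[ℝ] X) (c : ℝ), 0 < c ∧ ∀ y : Y, c * ‖y‖ ≤ ‖T y‖) ∧
      ¬ Nonempty (X ≃L[ℝ] Y) := by
  refine ⟨V, W, inferInstance, inferInstance, hV.completeSpace_coe, inferInstance, inferInstance,
    hW.completeSpace_coe, hequiv, hemb, ?_⟩
  rintro ⟨e⟩
  obtain ⟨C, hC, h⟩ := e.toContinuousLinearMap.bound
  refine hemb ⟨e.symm, C⁻¹, inv_pos.2 hC, fun y => ?_⟩
  rw [inv_mul_le_iff₀ hC]
  simpa using h (e.symm y)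

section Lift

variable {D Γ : Type*} [TopologicalSpace Γ] (A : Γ → Set D)

open Classical in
/-- The pointwise supremum of the functions `max (y γ) 0 • 1_{A γ}`. -/
noncomputable def posSup (y : Γ →ᵇ ℝ) (d : D) : ℝ :=
  ⨆ γ, if d ∈ A γ then max (y γ) 0 else 0

theorem abs_apply_le (y : Γ →ᵇ ℝ) (γ : Γ) : |y γ| ≤ ‖y‖ := y.norm_coe_le_norm γ

theorem le_posSup (y : Γ →ᵇ ℝ) {d : D} {γ : Γ} (hd : d ∈ A γ) : max (y γ) 0 ≤ posSup A y d := by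
  classical
  have hb : BddAbove (Set.range fun γ => if d ∈ A γ then max (y γ) 0 else 0) := by
    refine ⟨‖y‖, ?_⟩
    rintro _ ⟨γ, rfl⟩
    dsimp only
    split_ifs
    · exact max_le ((le_abs_self _).trans (abs_apply_le y γ)) (norm_nonneg y)
    · exact norm_nonneg y
  have := le_ciSup hb γ
  simp only [if_pos hd] at this
  unfold posSup
  convert this

theorem posSup_nonneg (y : Γ →ᵇ ℝ) (d : D) : 0 ≤ posSup A y d := by
  refine Real.iSup_nonneg fun γ => ?_
  split_ifs <;> simp

theorem posSup_le_add (y z : Γ →ᵇ ℝ) (d : D) : posSup A y d ≤ posSup A z d + ‖y - z‖ := by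
  refine Real.iSup_le (fun γ => ?_) (add_nonneg (posSup_nonneg A z d) (norm_nonneg _))
  have h0 := posSup_nonneg A z d
  have h2 := (le_abs_self _).trans (abs_apply_le (y - z) γ)
  have h3 := norm_nonneg (y - z)
  rw [BoundedContinuousFunction.sub_apply] at h2
  split_ifs with hd
  · have := (le_max_left (z γ) 0).trans (le_posSup A z hd)
    exact max_le (by linarith) (by linarith)
  · linarith

theorem posSup_eq_zero {y : Γ →ᵇ ℝ} {d : D} (h : ∀ γ, d ∈ A γ → y γ = 0) : posSup A y d = 0 := by
  refine le_antisymm (Real.iSup_le (fun γ => ?_) le_rfl) (posSup_nonneg A y d)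
  split_ifs with hd
  · simp [h γ hd]
  · exact le_rfl

theorem posSup_eq {y : Γ →ᵇ ℝ} {d : D} {γ : Γ} (hd : d ∈ A γ)
    (h : ∀ γ', γ' ≠ γ → d ∈ A γ' → y γ' = 0) : posSup A y d = max (y γ) 0 := by
  refine le_antisymm (Real.iSup_le (fun γ' => ?_) (le_max_right _ _)) (le_posSup A y hd)
  · by_cases hγ : γ' = γ
    · subst hγ; simp [hd]
    · split_ifs with hd'
      · simp [h γ' hγ hd']
      · exact le_max_right _ _

variable [TopologicalSpace D] [DiscreteTopology D]

/-- A Lipschitz, nonlinear lifting to `ℓ∞(D)` of the map sending the unit vector at `γ` to the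
class of `1_{A γ}` modulo `c₀(D)`. -/
noncomputable def lift (y : Γ →ᵇ ℝ) : D →ᵇ ℝ :=
  BoundedContinuousFunction.ofNormedAddCommGroupDiscrete
    (fun d => posSup A y d - posSup A (-y) d) ‖y‖ fun d => by
      have h0 : ∀ z : Γ →ᵇ ℝ, posSup A z d ≤ ‖z‖ := fun z => by
        have := posSup_le_add A z 0 d
        rwa [posSup_eq_zero A (y := 0) (fun _ _ => rfl), zero_add, sub_zero] at this
      have h1 := h0 y
      have h2 := h0 (-y)
      have h3 := posSup_nonneg A y d
      have h4 := posSup_nonneg A (-y) d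
      rw [norm_neg] at h2
      rw [Real.norm_eq_abs, abs_le]
      constructor <;> linarith

theorem lift_apply (y : Γ →ᵇ ℝ) (d : D) : lift A y d = posSup A y d - posSup A (-y) d := rfl

theorem lipschitzWith_lift : LipschitzWith 2 (lift A) := by
  refine LipschitzWith.of_dist_le_mul fun y z => ?_
  rw [BoundedContinuousFunction.dist_le (by positivity)]
  intro d
  have h1 := posSup_le_add A y z d
  have h2 := posSup_le_add A z y d
  have h3 := posSup_le_add A (-y) (-z) d
  have h4 := posSup_le_add A (-z) (-y) d
  have e1 : ‖z - y‖ = ‖y - z‖ := norm_sub_rev _ _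
  have e2 : ‖-y - -z‖ = ‖y - z‖ := by rw [← norm_neg]; congr 1; abel
  have e3 : ‖-z - -y‖ = ‖y - z‖ := by congr 1; abel
  rw [Real.dist_eq, dist_eq_norm, lift_apply, lift_apply, abs_le]
  push_cast
  constructor <;> linarith

theorem lift_eq_zero {y : Γ →ᵇ ℝ} {d : D} (h : ∀ γ, d ∈ A γ → y γ = 0) : lift A y d = 0 := by
  rw [lift_apply, posSup_eq_zero A h, posSup_eq_zero A (fun γ hd => by simp [h γ hd]), sub_zero]

theorem lift_eq {y : Γ →ᵇ ℝ} {d : D} {γ : Γ} (hd : d ∈ A γ)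
    (h : ∀ γ', γ' ≠ γ → d ∈ A γ' → y γ' = 0) : lift A y d = y γ := by
  rw [lift_apply, posSup_eq A hd h, posSup_eq A hd (fun γ' hγ hd' => by simp [h γ' hγ hd'])]
  exact max_zero_sub_eq_self (y γ)


variable {A}

theorem eventually_lift_apply (hA : Pairwise fun γ γ' => (A γ ∩ A γ').Finite) {s : Set Γ}
    (hs : s.Finite) : ∀ᶠ d in cofinite,
      (∀ y : Γ →ᵇ ℝ, Function.support y ⊆ s → lift A y d = 0) ∨
        ∃ γ, ∀ y : Γ →ᵇ ℝ, Function.support y ⊆ s → lift A y d = y γ := by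
  have h : ∀ᶠ d in cofinite, ∀ γ ∈ s, ∀ γ' ∈ s, γ' ≠ γ → ¬ (d ∈ A γ' ∧ d ∈ A γ) := by
    refine (eventually_all_finite hs).2 fun γ _ => (eventually_all_finite hs).2 fun γ' _ => ?_
    by_cases hne : γ' = γ
    · exact Eventually.of_forall fun d h => absurd hne h
    · exact (hA hne).eventually_cofinite_notMem.mono fun d hd _ => hd
  filter_upwards [h] with d hd
  by_cases hex : ∃ γ ∈ s, d ∈ A γ
  · obtain ⟨γ, hγ, hdγ⟩ := hex
    refine Or.inr ⟨γ, fun y hy => lift_eq A hdγ fun γ' hne hd' => ?_⟩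
    by_contra h0
    exact hd γ hγ γ' (hy h0) hne ⟨hd', hdγ⟩
  · refine Or.inl fun y hy => lift_eq_zero A fun γ hdγ => ?_
    by_contra h0
    exact hex ⟨γ, hy h0, hdγ⟩

theorem eventually_lift_apply_eq (hA : Pairwise fun γ γ' => (A γ ∩ A γ').Finite)
    {y : Γ →ᵇ ℝ} (hy : (Function.support y).Finite) (γ : Γ) :
    ∀ᶠ d in cofinite, d ∈ A γ → lift A y d = y γ := by
  have h : ∀ᶠ d in cofinite, ∀ γ' ∈ Function.support y, γ' ≠ γ → ¬ (d ∈ A γ' ∧ d ∈ A γ) := by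
    refine (eventually_all_finite hy).2 fun γ' _ => ?_
    by_cases hne : γ' = γ
    · exact Eventually.of_forall fun d h => absurd hne h
    · exact (hA hne).eventually_cofinite_notMem.mono fun d hd _ => hd
  filter_upwards [h] with d hd hdγ
  refine lift_eq A hdγ fun γ' hne hd' => ?_
  by_contra h0
  exact hd γ' h0 hne ⟨hd', hdγ⟩

variable (D Γ) in
/-- The pairs of finitely supported functions, a dense subspace of `c₀(D) × c₀(Γ)`. -/
def finiteSupport : Submodule ℝ ((D →ᵇ ℝ) × (Γ →ᵇ ℝ)) where
  carrier := {p | (∀ᶠ d in cofinite, p.1 d = 0) ∧ (Function.support p.2).Finite}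
  zero_mem' := by simp
  add_mem' := by
    rintro p q ⟨hp, hp'⟩ ⟨hq, hq'⟩
    refine ⟨?_, (hp'.union hq').subset (Function.support_add p.2 q.2)⟩
    filter_upwards [hp, hq] with d h1 h2
    simp [h1, h2]
  smul_mem' := by
    rintro c p ⟨hp, hp'⟩
    refine ⟨?_, hp'.subset (Function.support_const_smul_subset c p.2)⟩
    filter_upwards [hp] with d h1
    simp [h1]

/-- The pairs `(x, y)` with `y` finitely supported and `x` equal to `∑ γ, y γ • 1_{A γ}` up to a
finitely supported function. -/
def twisted (hA : Pairwise fun γ γ' => (A γ ∩ A γ').Finite) :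
    Submodule ℝ ((D →ᵇ ℝ) × (Γ →ᵇ ℝ)) where
  carrier := {p | (∀ᶠ d in cofinite, p.1 d = lift A p.2 d) ∧ (Function.support p.2).Finite}
  zero_mem' := by
    refine ⟨Eventually.of_forall fun d => ?_, by simp⟩
    exact (lift_eq_zero A fun _ _ => rfl).symm
  add_mem' := by
    rintro p q ⟨hp, hp'⟩ ⟨hq, hq'⟩
    have hs := Function.support_add p.2 q.2
    refine ⟨?_, (hp'.union hq').subset hs⟩
    filter_upwards [hp, hq, eventually_lift_apply hA (hp'.union hq')] with d h1 h2 h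
    have e : (p + q).1 d = p.1 d + q.1 d := rfl
    rw [e, h1, h2]
    rcases h with h | ⟨γ, h⟩ <;>
      rw [h p.2 Set.subset_union_left, h q.2 Set.subset_union_right, h (p + q).2 hs]
    · exact add_zero 0
    · rfl
  smul_mem' := by
    rintro c p ⟨hp, hp'⟩
    have hs := Function.support_const_smul_subset c p.2
    refine ⟨?_, hp'.subset hs⟩
    filter_upwards [hp, eventually_lift_apply hA hp'] with d h1 h
    have e : (c • p).1 d = c * p.1 d := rfl
    rw [e, h1]
    rcases h with h | ⟨γ, h⟩ <;> rw [h p.2 subset_rfl, h (c • p).2 hs]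
    · exact mul_zero c
    · rfl

theorem shear_image_twisted (hA : Pairwise fun γ γ' => (A γ ∩ A γ').Finite) :
    shear (lift A) (lipschitzWith_lift A) '' (twisted hA : Set ((D →ᵇ ℝ) × (Γ →ᵇ ℝ))) =
      finiteSupport D Γ := by
  ext p
  rw [Homeomorph.image_eq_preimage_symm]
  refine and_congr_left' (eventually_congr (Eventually.of_forall fun d => ?_))
  exact add_eq_right

theorem norm_snd_le_norm_fst (hA : Pairwise fun γ γ' => (A γ ∩ A γ').Finite)
    (hinf : ∀ γ, (A γ).Infinite) {p : (D →ᵇ ℝ) × (Γ →ᵇ ℝ)}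
    (hp : p ∈ (twisted hA).topologicalClosure) : ‖p.2‖ ≤ ‖p.1‖ := by
  have hcl : IsClosed {p : (D →ᵇ ℝ) × (Γ →ᵇ ℝ) | ‖p.2‖ ≤ ‖p.1‖} :=
    isClosed_le (by fun_prop) (by fun_prop)
  refine closure_minimal ?_ hcl hp
  rintro q ⟨hq, hq'⟩
  refine (BoundedContinuousFunction.norm_le (norm_nonneg _)).2 fun γ => ?_
  obtain ⟨d, hdγ, h1, h2⟩ := ((frequently_cofinite_iff_infinite.2 (hinf γ)).and_eventually
    (hq.and (eventually_lift_apply_eq hA hq' γ))).exists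
  rw [← h2 hdγ, ← h1]
  exact q.1.norm_coe_le_norm d

section UnitVectors

variable [DiscreteTopology Γ]

open Classical in
/-- The unit vector of `c₀(Γ)` at `γ`. -/
noncomputable def unitVector (γ : Γ) : Γ →ᵇ ℝ :=
  BoundedContinuousFunction.ofNormedAddCommGroupDiscrete (Pi.single γ 1) 1 fun γ' => by
    by_cases h : γ' = γ
    · subst h; simp
    · simp [Pi.single_eq_of_ne h]

open Classical in
theorem unitVector_apply (γ γ' : Γ) : unitVector γ γ' = if γ' = γ then 1 else 0 :=
  Pi.single_apply γ 1 γ'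

theorem norm_sum_smul_unitVector_le (s : Finset Γ) (ε : Γ → ℝ) (hε : ∀ γ, |ε γ| ≤ 1) :
    ‖∑ γ ∈ s, ε γ • unitVector γ‖ ≤ 1 := by
  classical
  refine (BoundedContinuousFunction.norm_le zero_le_one).2 fun γ' => ?_
  simp only [BoundedContinuousFunction.coe_sum, Finset.sum_apply,
    BoundedContinuousFunction.coe_smul, unitVector_apply, smul_eq_mul, mul_ite, mul_one, mul_zero,
    Finset.sum_ite_eq, Real.norm_eq_abs]
  split_ifs
  · exact hε γ'
  · simp

omit [DiscreteTopology D] in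
variable (D) in
theorem unitVector_mem (γ : Γ) :
    ((0, unitVector γ) : (D →ᵇ ℝ) × (Γ →ᵇ ℝ)) ∈ finiteSupport D Γ := by
  classical
  refine ⟨Eventually.of_forall fun _ => rfl, (Set.finite_singleton γ).subset fun γ' h => ?_⟩
  by_contra hne
  exact h ((unitVector_apply γ γ').trans (if_neg hne))

theorem unitVector_ne_zero (γ : Γ) : unitVector γ ≠ 0 := by
  classical
  intro h
  have h1 := DFunLike.congr_fun h γ
  simp [unitVector_apply] at h1

omit [DiscreteTopology D] in
theorem norm_sum_smul_zero_unitVector_le (s : Finset Γ) (ε : Γ → ℝ) (hε : ∀ γ, |ε γ| ≤ 1) :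
    ‖∑ γ ∈ s, ε γ • ((0, unitVector γ) : (D →ᵇ ℝ) × (Γ →ᵇ ℝ))‖ ≤ 1 := by
  have h : ∑ γ ∈ s, ε γ • ((0, unitVector γ) : (D →ᵇ ℝ) × (Γ →ᵇ ℝ)) =
      (0, ∑ γ ∈ s, ε γ • unitVector γ) := by
    simp [Prod.ext_iff, Prod.fst_sum, Prod.snd_sum]
  rw [h, Prod.norm_mk, norm_zero]
  exact max_le zero_le_one (norm_sum_smul_unitVector_le s ε hε)

theorem not_exists_embedding_twisted [Countable D] [Uncountable Γ]
    (hA : Pairwise fun γ γ' => (A γ ∩ A γ').Finite) (hinf : ∀ γ, (A γ).Infinite) :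
    ¬ ∃ (T : (finiteSupport D Γ).topologicalClosure →L[ℝ] (twisted hA).topologicalClosure)
      (c : ℝ), 0 < c ∧ ∀ y, c * ‖y‖ ≤ ‖T y‖ :=
  not_exists_linear_embedding _ _ (fun d : D => BoundedContinuousFunction.evalCLM ℝ d)
    (fun _ h => BoundedContinuousFunction.ext h) (fun _ hp => norm_snd_le_norm_fst hA hinf hp)
    (fun γ : Γ => (0, unitVector γ))
    (fun γ => Submodule.le_topologicalClosure _ (unitVector_mem D γ))
    (fun γ h => unitVector_ne_zero γ (congrArg Prod.snd h)) norm_sum_smul_zero_unitVector_le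

end UnitVectors

end Lift

/-- There is an almost disjoint family of continuum many infinite subsets of `ℕ`. -/
theorem exists_almostDisjoint :
    ∃ A : (ℕ → Bool) → Set ℕ,
      (Pairwise fun γ γ' => (A γ ∩ A γ').Finite) ∧ ∀ γ, (A γ).Infinite := by
  let code (γ : ℕ → Bool) (n : ℕ) : ℕ := Encodable.encode ((List.range n).map γ)
  have hlen : ∀ {γ γ' m n}, code γ m = code γ' n → (List.range m).map γ = (List.range n).map γ' :=
    fun h => Encodable.encode_injective h
  refine ⟨fun γ => Set.range (code γ), fun γ γ' hne => ?_, fun γ => ?_⟩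
  · obtain ⟨k, hk⟩ := Function.ne_iff.1 hne
    refine ((Set.finite_Iic k).image (code γ)).subset ?_
    rintro _ ⟨⟨m, rfl⟩, n, hn⟩
    refine ⟨m, ?_, rfl⟩
    by_contra hm
    have h := hlen hn
    obtain rfl : n = m := by simpa using congrArg List.length h
    exact hk (List.map_inj_left.1 h k (List.mem_range.2 (not_le.1 hm))).symm
  · refine Set.infinite_range_of_injective fun m n h => ?_
    simpa using congrArg List.length (hlen h)

end AharoniLindenstrauss

open AharoniLindenstrauss in
/-- (Aharoni–Lindenstrauss) There exist Lipschitz equivalent real Banach spaces `X` and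
`Y` such that `Y` does not embed linearly into `X`; in particular `X` and `Y` are not
linearly isomorphic. -/
theorem exists_lipschitz_equivalent_not_linearly_isomorphic :
    ∃ (X Y : Type) (_ : NormedAddCommGroup X) (_ : NormedSpace ℝ X) (_ : CompleteSpace X)
      (_ : NormedAddCommGroup Y) (_ : NormedSpace ℝ Y) (_ : CompleteSpace Y),
      (∃ (f : X ≃ Y) (K K' : ℝ≥0), LipschitzWith K f ∧ LipschitzWith K' f.symm) ∧
      (¬ ∃ (T : Y →L[ℝ] X) (c : ℝ), 0 < c ∧ ∀ y : Y, c * ‖y‖ ≤ ‖T y‖) ∧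
      ¬ Nonempty (X ≃L[ℝ] Y) := by
  
  obtain ⟨A, hA, hinf⟩ := exists_almostDisjoint
  let _ : TopologicalSpace (ℕ → Bool) := ⊥
  have _ : DiscreteTopology (ℕ → Bool) := ⟨rfl⟩
  have _ : Uncountable (ℕ → Bool) := by
    rw [← Cardinal.aleph0_lt_mk_iff]
    simpa using Cardinal.cantor Cardinal.aleph0
  have hemb := not_exists_embedding_twisted hA hinf
  exact exists_of_closed_submodules _ _ (Submodule.isClosed_topologicalClosure _)
    (Submodule.isClosed_topologicalClosure _) (exists_lipschitz_equiv_closure (lift A)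
      (lipschitzWith_lift A) _ _ (shear_image_twisted hA)) hemb
end

section
/- (Ribe) Let X and Y be real Banach spaces that are uniformly homeomorphic: there is a bijection f : X → Y with f and f⁻¹ both uniformly continuous. Then there is a constant C ≥ 1 such that for every finite-dimensional linear subspace E of X there exist a finite-dimensional linear subspace F of Y and a linear isomorphism T : E → F with ‖T‖ · ‖T⁻¹‖ ≤ C (where the norms are the operator norms for the norms induced from X and Y). -/
/-! ### Averages of translates -/

/-- A finite family of list properties that persist under appending can be satisfied at once. -/
lemma exists_list_forall_mem {ι G : Type*} (s : Finset ι) (Q : ι → List G → Prop)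
    (hl : ∀ i l m, Q i l → Q i (l ++ m)) (hr : ∀ i l m, Q i m → Q i (l ++ m))
    (h : ∀ i ∈ s, ∃ l, Q i l) : ∃ l, ∀ i ∈ s, Q i l := by
  classical
  induction s using Finset.induction_on with
  | empty => exact ⟨[], by simp⟩
  | insert a s _ ih =>
    obtain ⟨l, hl'⟩ := ih fun i hi => h i (Finset.mem_insert_of_mem hi)
    obtain ⟨m, hm⟩ := h a (Finset.mem_insert_self a s)
    refine ⟨l ++ m, fun i hi => ?_⟩
    rcases Finset.mem_insert.1 hi with rfl | hi
    · exact hr _ _ _ hm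
    · exact hl _ _ _ (hl' i hi)

section Averages

variable {G V : Type*} [AddCommGroup G] [AddCommGroup V] [Module ℝ V]

/-- Translation by `u`, acting on functions. -/
def translateEnd (V : Type*) [AddCommGroup V] [Module ℝ V] (u : G) : Module.End ℝ (G → V) :=
  LinearMap.funLeft ℝ V (fun x => x + u)

@[simp] lemma translateEnd_apply (u : G) (φ : G → V) (x : G) :
    translateEnd V u φ x = φ (x + u) := rfl

/-- The difference operator in direction `u`. -/
def diffEnd (V : Type*) [AddCommGroup V] [Module ℝ V] (u : G) : Module.End ℝ (G → V) :=
  translateEnd V u - 1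

@[simp] lemma diffEnd_apply (u : G) (φ : G → V) (x : G) :
    diffEnd V u φ x = φ (x + u) - φ x := rfl

/-- The mean of the identity and the translation by `u`. -/
noncomputable def midEnd (V : Type*) [AddCommGroup V] [Module ℝ V] (u : G) :
    Module.End ℝ (G → V) :=
  (1 / 2 : ℝ) • (1 + translateEnd V u)

lemma midEnd_apply (u : G) (φ : G → V) (x : G) :
    midEnd V u φ x = (1 / 2 : ℝ) • (φ x + φ (x + u)) := rfl

/-- The composition of the operators `midEnd V u` for `u` in the list `l`. -/
noncomputable def averageEnd (V : Type*) [AddCommGroup V] [Module ℝ V] (l : List G) :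
    Module.End ℝ (G → V) :=
  (l.map (midEnd V)).prod

@[simp] lemma averageEnd_nil : averageEnd V ([] : List G) = 1 := rfl

lemma averageEnd_cons (u : G) (l : List G) :
    averageEnd V (u :: l) = midEnd V u * averageEnd V l := by
  simp [averageEnd]

lemma averageEnd_append (l m : List G) :
    averageEnd V (l ++ m) = averageEnd V l * averageEnd V m := by
  simp [averageEnd]

lemma averageEnd_cons_apply (u : G) (l : List G) (φ : G → V) (x : G) :
    averageEnd V (u :: l) φ x =
      (1 / 2 : ℝ) • (averageEnd V l φ x + averageEnd V l φ (x + u)) := by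
  rw [averageEnd_cons]; rfl

lemma averageEnd_append_apply (l m : List G) (φ : G → V) :
    averageEnd V (l ++ m) φ = averageEnd V l (averageEnd V m φ) := by
  rw [averageEnd_append]; rfl

lemma commute_translateEnd (u v : G) : Commute (translateEnd V u) (translateEnd V v) := by
  ext φ x
  simp [add_right_comm]

lemma commute_midEnd_translateEnd (u v : G) : Commute (midEnd V u) (translateEnd V v) :=
  ((Commute.one_left _).add_left (commute_translateEnd u v)).smul_left _

lemma commute_averageEnd_translateEnd (l : List G) (v : G) :
    Commute (averageEnd V l) (translateEnd V v) := by
  induction l with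
  | nil => exact Commute.one_left _
  | cons u l ih =>
    rw [averageEnd_cons]
    exact (commute_midEnd_translateEnd u v).mul_left ih

lemma commute_averageEnd_diffEnd (l : List G) (v : G) :
    Commute (averageEnd V l) (diffEnd V v) :=
  (commute_averageEnd_translateEnd l v).sub_right (Commute.one_right _)

lemma commute_averageEnd (l m : List G) : Commute (averageEnd V l) (averageEnd V m) := by
  induction m with
  | nil => exact Commute.one_right _
  | cons u m ih =>
    rw [averageEnd_cons]
    exact (((Commute.one_right _).add_right
      (commute_averageEnd_translateEnd l u)).smul_right _).mul_right ih

lemma averageEnd_comm_apply (l m : List G) (φ : G → V) :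
    averageEnd V l (averageEnd V m φ) = averageEnd V m (averageEnd V l φ) :=
  LinearMap.congr_fun (commute_averageEnd l m).eq φ

lemma averageEnd_diffEnd_apply (l : List G) (u : G) (φ : G → V) :
    averageEnd V l (diffEnd V u φ) = diffEnd V u (averageEnd V l φ) :=
  LinearMap.congr_fun (commute_averageEnd_diffEnd l u).eq φ

lemma averageEnd_const (l : List G) (c : V) (x : G) : averageEnd V l (fun _ => c) x = c := by
  induction l generalizing x with
  | nil => rfl
  | cons u l ih =>
    rw [averageEnd_cons_apply, ih, ih, ← two_smul ℝ c, smul_smul]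
    norm_num

lemma averageEnd_mono (l : List G) {φ ψ : G → ℝ} (h : ∀ x, φ x ≤ ψ x) (x : G) :
    averageEnd ℝ l φ x ≤ averageEnd ℝ l ψ x := by
  induction l generalizing x with
  | nil => exact h x
  | cons u l ih =>
    rw [averageEnd_cons_apply, averageEnd_cons_apply, smul_eq_mul, smul_eq_mul]
    linarith [ih x, ih (x + u)]

lemma averageEnd_le (l : List G) {φ : G → ℝ} {c : ℝ} (h : ∀ x, φ x ≤ c) (x : G) :
    averageEnd ℝ l φ x ≤ c :=
  (averageEnd_mono l h x).trans_eq (averageEnd_const l c x)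

lemma le_averageEnd (l : List G) {φ : G → ℝ} {c : ℝ} (h : ∀ x, c ≤ φ x) (x : G) :
    c ≤ averageEnd ℝ l φ x :=
  (averageEnd_const l c x).symm.trans_le (averageEnd_mono l h x)

/-- The list `2 ^ (k - 1) • u, …, 2 • u, u`, whose average is uniform on multiples of `u`. -/
def dyadicList (u : G) : ℕ → List G
  | 0 => []
  | k + 1 => (2 ^ k • u) :: dyadicList u k

lemma averageEnd_dyadicList_diffEnd (u : G) (k : ℕ) (φ : G → V) (x : G) :
    averageEnd V (dyadicList u k) (diffEnd V u φ) x =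
      ((2 : ℝ) ^ k)⁻¹ • (φ (x + 2 ^ k • u) - φ x) := by
  induction k generalizing x with
  | zero => simp [dyadicList]
  | succ k ih =>
    rw [dyadicList, averageEnd_cons_apply, ih, ih, ← smul_add, smul_smul, add_assoc, ← add_nsmul,
      ← mul_two, ← pow_succ, add_comm, sub_add_sub_cancel]
    congr 1
    rw [pow_succ]
    field_simp

end Averages

section NormedAverages

variable {G Y : Type*} [AddCommGroup G] [NormedAddCommGroup Y] [NormedSpace ℝ Y]

lemma norm_averageEnd_le (l : List G) (φ : G → Y) (x : G) :
    ‖averageEnd Y l φ x‖ ≤ averageEnd ℝ l (fun y => ‖φ y‖) x := by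
  induction l generalizing x with
  | nil => exact le_rfl
  | cons u l ih =>
    rw [averageEnd_cons_apply, averageEnd_cons_apply, norm_smul, smul_eq_mul,
      Real.norm_of_nonneg (by norm_num)]
    gcongr
    exact (norm_add_le _ _).trans (add_le_add (ih _) (ih _))

lemma norm_averageEnd_le_of_le (l : List G) {φ : G → Y} {c : ℝ} (h : ∀ x, ‖φ x‖ ≤ c) (x : G) :
    ‖averageEnd Y l φ x‖ ≤ c :=
  (norm_averageEnd_le l φ x).trans (averageEnd_le l h x)

/-- Functions with uniformly small averages of translates. -/
def meanNull (G Y : Type*) [AddCommGroup G] [NormedAddCommGroup Y] [NormedSpace ℝ Y] :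
    AddSubgroup (G → Y) where
  carrier := {φ | ∀ ε > 0, ∃ l, ∀ x, ‖averageEnd Y l φ x‖ ≤ ε}
  zero_mem' ε hε := ⟨[], fun x => by simpa using hε.le⟩
  neg_mem' {φ} h ε hε := by
    obtain ⟨l, hl⟩ := h ε hε
    exact ⟨l, fun x => by simpa using hl x⟩
  add_mem' {φ ψ} hφ hψ ε hε := by
    obtain ⟨l, hl⟩ := hφ (ε / 2) (half_pos hε)
    obtain ⟨m, hm⟩ := hψ (ε / 2) (half_pos hε)
    refine ⟨l ++ m, fun x => ?_⟩
    rw [map_add, Pi.add_apply]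
    refine (norm_add_le _ _).trans ((add_le_add ?_ ?_).trans_eq (add_halves ε))
    · rw [averageEnd_append_apply, averageEnd_comm_apply]
      exact norm_averageEnd_le_of_le m hl x
    · rw [averageEnd_append_apply]
      exact norm_averageEnd_le_of_le l hm x

lemma exists_div_two_pow_le (a : ℝ) {ε : ℝ} (hε : 0 < ε) : ∃ k : ℕ, ((2 : ℝ) ^ k)⁻¹ * a ≤ ε := by
  obtain ⟨k, hk⟩ := pow_unbounded_of_one_lt (a / ε) one_lt_two
  refine ⟨k, ?_⟩
  rw [inv_mul_le_iff₀ (by positivity)]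
  exact ((div_lt_iff₀ hε).1 hk).le

lemma diffEnd_mem_meanNull {φ : G → Y} {c : ℝ} (h : ∀ x, ‖φ x‖ ≤ c) (u : G) :
    diffEnd Y u φ ∈ meanNull G Y := by
  intro ε hε
  obtain ⟨k, hk⟩ := exists_div_two_pow_le (c + c) hε
  refine ⟨dyadicList u k, fun x => ?_⟩
  rw [averageEnd_dyadicList_diffEnd, norm_smul, Real.norm_of_nonneg (by positivity)]
  refine le_trans ?_ hk
  gcongr
  exact (norm_sub_le _ _).trans (add_le_add (h _) (h _))

/-- If `f` has bounded differences, then `u ↦ diffEnd Y u f` is additive modulo `meanNull`. -/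
def diffHom (f : G → Y) (hf : ∀ u, ∃ c, ∀ x, ‖diffEnd Y u f x‖ ≤ c) :
    G →+ (G → Y) ⧸ meanNull G Y :=
  AddMonoidHom.mk' (fun u => QuotientAddGroup.mk (diffEnd Y u f)) fun u v => by
    rw [← QuotientAddGroup.mk_add, eq_comm, QuotientAddGroup.eq]
    obtain ⟨c, hc⟩ := hf u
    convert diffEnd_mem_meanNull hc v using 1
    ext x
    simp only [Pi.add_apply, Pi.neg_apply, diffEnd_apply]
    rw [add_right_comm x v u, ← add_assoc]
    abel

lemma diffEnd_sum_zsmul_sub_mem_meanNull (f : G → Y)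
    (hf : ∀ u, ∃ c, ∀ x, ‖diffEnd Y u f x‖ ≤ c) {ι : Type*} [Fintype ι] (e : ι → G) (k : ι → ℤ) :
    diffEnd Y (∑ i, k i • e i) f - ∑ i, k i • diffEnd Y (e i) f ∈ meanNull G Y := by
  have h : diffHom f hf (∑ i, k i • e i) = ∑ i, k i • diffHom f hf (e i) := by simp
  have h' : (QuotientAddGroup.mk' (meanNull G Y)) (diffEnd Y (∑ i, k i • e i) f) =
      QuotientAddGroup.mk' (meanNull G Y) (∑ i, k i • diffEnd Y (e i) f) := by
    rw [map_sum]
    simp only [map_zsmul]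
    exact h
  rw [← QuotientAddGroup.ker_mk' (meanNull G Y), AddMonoidHom.mem_ker, map_sub, h', sub_self]

end NormedAverages

/-- Uniformly continuous maps on normed spaces are Lipschitz at large distances. -/
lemma UniformContinuous.exists_norm_sub_le {X Y : Type*} [NormedAddCommGroup X]
    [NormedSpace ℝ X] [NormedAddCommGroup Y] {f : X → Y} (hf : UniformContinuous f) :
    ∃ L b : ℝ, 0 ≤ L ∧ ∀ x y, ‖f x - f y‖ ≤ L * ‖x - y‖ + b := by
  obtain ⟨δ, hδ, h⟩ := Metric.uniformContinuous_iff.1 hf 1 one_pos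
  have key : ∀ (n : ℕ) (y v : X), ‖v‖ < δ → ‖f (y + n • v) - f y‖ ≤ n := by
    intro n y v hv
    induction n with
    | zero => simp
    | succ n ih =>
      have h1 : dist (f (y + (n + 1) • v)) (f (y + n • v)) < 1 := by
        apply h
        rw [succ_nsmul, ← add_assoc, dist_self_add_left]
        exact hv
      rw [dist_eq_norm] at h1
      have h2 := norm_add_le (f (y + (n + 1) • v) - f (y + n • v)) (f (y + n • v) - f y)
      rw [sub_add_sub_cancel] at h2
      push_cast
      linarith
  refine ⟨1 / δ, 1, by positivity, fun x y => ?_⟩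
  set n := ⌊‖x - y‖ / δ⌋₊ + 1 with hn
  have hn0 : (0 : ℝ) < n := by rw [hn]; positivity
  have hlt : ‖x - y‖ / δ < n := by rw [hn]; exact_mod_cast Nat.lt_floor_add_one _
  have hle : (n : ℝ) ≤ ‖x - y‖ / δ + 1 := by
    rw [hn]; push_cast
    linarith [Nat.floor_le (show 0 ≤ ‖x - y‖ / δ by positivity)]
  have hv : ‖(n : ℝ)⁻¹ • (x - y)‖ < δ := by
    rw [norm_smul, Real.norm_of_nonneg (by positivity), inv_mul_lt_iff₀ hn0]
    exact (div_lt_iff₀ hδ).1 hlt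
  have := key n y _ hv
  rw [← Nat.cast_smul_eq_nsmul ℝ, smul_inv_smul₀ hn0.ne', add_sub_cancel] at this
  calc _ ≤ _ := this
    _ ≤ _ := hle
    _ = _ := by ring

section CoarseLipschitz

variable {X Y : Type*} [NormedAddCommGroup X] [NormedAddCommGroup Y] [NormedSpace ℝ Y]

lemma exists_norm_averageEnd_sub_le {f : X → Y} {L b : ℝ}
    (hf : ∀ x y, ‖f x - f y‖ ≤ L * ‖x - y‖ + b) (l : List X) :
    ∃ c, ∀ x, ‖averageEnd Y l f x - f x‖ ≤ c := by
  induction l with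
  | nil => exact ⟨0, by simp⟩
  | cons u l ih =>
    obtain ⟨c, hc⟩ := ih
    refine ⟨(1 / 2) * (c + c + (L * ‖u‖ + b)), fun x => ?_⟩
    have h : averageEnd Y (u :: l) f x - f x = (1 / 2 : ℝ) • ((averageEnd Y l f x - f x) +
        (averageEnd Y l f (x + u) - f (x + u)) + (f (x + u) - f x)) := by
      rw [averageEnd_cons_apply]
      module
    rw [h, norm_smul, Real.norm_of_nonneg (by norm_num)]
    gcongr
    refine (norm_add₃_le).trans (add_le_add_three (hc _) (hc _) ?_)
    simpa using hf (x + u) x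

lemma norm_diffEnd_le {f : X → Y} {L b : ℝ}
    (hf : ∀ x y, ‖f x - f y‖ ≤ L * ‖x - y‖ + b) (u x : X) :
    ‖diffEnd Y u f x‖ ≤ L * ‖u‖ + b := by
  simpa using hf (x + u) x

variable [NormedSpace ℝ X]

lemma exists_le_averageEnd_norm_diffEnd {f : X → Y} {L b c d : ℝ}
    (hf : ∀ x y, ‖f x - f y‖ ≤ L * ‖x - y‖ + b)
    (hf' : ∀ x y, c * ‖x - y‖ - d ≤ ‖f x - f y‖) (m : List X) (u : X) {ε : ℝ} (hε : 0 < ε) :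
    ∃ l : List X, ∀ x,
      c * ‖u‖ - ε ≤ averageEnd ℝ l (fun y => ‖averageEnd Y m (diffEnd Y u f) y‖) x := by
  obtain ⟨K, hK⟩ := exists_norm_averageEnd_sub_le hf m
  obtain ⟨k, hk⟩ := exists_div_two_pow_le (d + 2 * K) hε
  refine ⟨dyadicList u k, fun x => le_trans ?_ (norm_averageEnd_le _ _ x)⟩
  rw [averageEnd_diffEnd_apply, averageEnd_dyadicList_diffEnd, norm_smul,
    Real.norm_of_nonneg (by positivity)]
  set z := x + 2 ^ k • u with hz
  have h1 : c * (2 ^ k * ‖u‖) - d ≤ ‖f z - f x‖ := by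
    have := hf' z x
    rwa [show z - x = 2 ^ k • u from add_sub_cancel_left _ _, ← Nat.cast_smul_eq_nsmul ℝ, norm_smul,
      Real.norm_of_nonneg (by positivity), Nat.cast_pow, Nat.cast_ofNat] at this
  have h2 : ‖f z - f x‖ ≤ ‖averageEnd Y m f z - averageEnd Y m f x‖ + 2 * K := by
    have h3 : f z - f x = (averageEnd Y m f z - averageEnd Y m f x) -
        (averageEnd Y m f z - f z) + (averageEnd Y m f x - f x) := by abel
    rw [h3]
    linarith [norm_add_le (averageEnd Y m f z - averageEnd Y m f x -
        (averageEnd Y m f z - f z)) (averageEnd Y m f x - f x),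
      norm_sub_le (averageEnd Y m f z - averageEnd Y m f x) (averageEnd Y m f z - f z),
      hK z, hK x]
  calc c * ‖u‖ - ε ≤ c * ‖u‖ - ((2 : ℝ) ^ k)⁻¹ * (d + 2 * K) := by linarith
    _ = ((2 : ℝ) ^ k)⁻¹ * (c * (2 ^ k * ‖u‖) - (d + 2 * K)) := by field_simp
    _ ≤ _ := by gcongr; linarith

/-- Averages of a bi-Lipschitz map at large distances: at some point, an average of translates
keeps the lower bound on finitely many differences and almost annihilates finitely many
`meanNull` functions. -/
lemma exists_averageEnd_diffEnd {f : X → Y} {L b c d : ℝ}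
    (hf : ∀ x y, ‖f x - f y‖ ≤ L * ‖x - y‖ + b)
    (hf' : ∀ x y, c * ‖x - y‖ - d ≤ ‖f x - f y‖)
    (S : Finset X) (Ψ : Finset (X → Y)) (hΨ : ∀ ψ ∈ Ψ, ψ ∈ meanNull X Y)
    {ε : ℝ} (hε : 0 < ε) :
    ∃ (l : List X) (x : X), (∀ u ∈ S, c * ‖u‖ - ε ≤ ‖averageEnd Y l (diffEnd Y u f) x‖) ∧
      ∀ ψ ∈ Ψ, ‖averageEnd Y l ψ x‖ ≤ ε := by
  let Φ : List X → X → ℝ := fun m => ∑ u ∈ S, fun y => ‖averageEnd Y m (diffEnd Y u f) y‖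
  let B : Set ℝ := {r | ∃ l m, ∀ x, averageEnd ℝ l (Φ m) x ≤ r}
  have hΦ : ∀ m x, 0 ≤ Φ m x := fun m x => by
    simp only [Φ, Finset.sum_apply]
    positivity
  have hB : B.Nonempty := ⟨∑ u ∈ S, (L * ‖u‖ + b), [], [], fun x => by
    simp only [averageEnd_nil, Module.End.one_apply, Φ, Finset.sum_apply]
    exact Finset.sum_le_sum fun u _ => norm_diffEnd_le hf u x⟩
  have hB' : BddBelow B := ⟨0, fun r ⟨l, m, h⟩ => (le_averageEnd l (hΦ m) 0).trans (h 0)⟩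
  obtain ⟨r, ⟨l, m, hr⟩, hlt⟩ := Real.lt_sInf_add_pos hB (half_pos hε)
  obtain ⟨ν₁, hν₁⟩ := exists_list_forall_mem S
    (fun u ν => ∀ x, c * ‖u‖ - ε / 2 ≤
      averageEnd ℝ ν (fun y => ‖averageEnd Y m (diffEnd Y u f) y‖) x)
    (fun u l₁ l₂ h x => by
      rw [averageEnd_append_apply, averageEnd_comm_apply]
      exact le_averageEnd l₂ h x)
    (fun u l₁ l₂ h x => by
      rw [averageEnd_append_apply]
      exact le_averageEnd l₁ h x)
    (fun u _ => exists_le_averageEnd_norm_diffEnd hf hf' m u (half_pos hε))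
  obtain ⟨ν₂, hν₂⟩ := exists_list_forall_mem Ψ
    (fun ψ ν => ∀ x, ‖averageEnd Y ν ψ x‖ ≤ ε)
    (fun ψ l₁ l₂ h x => by
      rw [averageEnd_append_apply, averageEnd_comm_apply]
      exact norm_averageEnd_le_of_le l₂ h x)
    (fun ψ l₁ l₂ h x => by
      rw [averageEnd_append_apply]
      exact norm_averageEnd_le_of_le l₁ h x)
    (fun ψ hψ => hΨ ψ hψ ε hε)
  set ν := ν₁ ++ ν₂ with hν
  obtain ⟨x, hx⟩ : ∃ x, averageEnd ℝ ν (Φ m) x < Φ (ν ++ m) x + ε / 2 := by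
    by_contra! hcon
    have hmem : r - ε / 2 ∈ B := by
      refine ⟨l, ν ++ m, fun x => ?_⟩
      have h1 := averageEnd_mono l hcon x
      have h2 : averageEnd ℝ l (fun y => Φ (ν ++ m) y + ε / 2) x =
          averageEnd ℝ l (Φ (ν ++ m)) x + ε / 2 := by
        have : (fun y => Φ (ν ++ m) y + ε / 2) = Φ (ν ++ m) + fun _ => ε / 2 := rfl
        rw [this, map_add, Pi.add_apply, averageEnd_const]
      rw [h2] at h1
      change _ ≤ averageEnd ℝ l (averageEnd ℝ ν (Φ m)) x at h1
      rw [averageEnd_comm_apply] at h1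
      linarith [averageEnd_le ν hr x]
    linarith [csInf_le hB' hmem]
  refine ⟨ν ++ m, x, fun u hu => ?_, fun ψ hψ => ?_⟩
  · have hterm : ∀ v ∈ S, 0 ≤ averageEnd ℝ ν (fun y => ‖averageEnd Y m (diffEnd Y v f) y‖) x -
        ‖averageEnd Y (ν ++ m) (diffEnd Y v f) x‖ := fun v _ => by
      rw [averageEnd_append_apply ν m]
      exact sub_nonneg.2 (norm_averageEnd_le _ _ _)
    have hle := Finset.single_le_sum hterm hu
    have hsum : ∑ v ∈ S, (averageEnd ℝ ν (fun y => ‖averageEnd Y m (diffEnd Y v f) y‖) x -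
        ‖averageEnd Y (ν ++ m) (diffEnd Y v f) x‖) =
        averageEnd ℝ ν (Φ m) x - Φ (ν ++ m) x := by
      simp only [Φ, map_sum, Finset.sum_apply, Finset.sum_sub_distrib]
    have hlow : c * ‖u‖ - ε / 2 ≤
        averageEnd ℝ ν (fun y => ‖averageEnd Y m (diffEnd Y u f) y‖) x := by
      rw [hν, averageEnd_append_apply, averageEnd_comm_apply]
      exact le_averageEnd ν₂ (hν₁ u hu) x
    linarith
  · rw [averageEnd_append_apply, averageEnd_comm_apply, hν, averageEnd_append_apply]
    exact norm_averageEnd_le_of_le m (norm_averageEnd_le_of_le ν₁ (hν₂ ψ hψ)) x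

/-- A map of a finite-dimensional space that is bi-Lipschitz at large distances yields a linear
embedding whose constants do not depend on the dimension. -/
lemma exists_linearMap_of_coarse_bilipschitz [FiniteDimensional ℝ X] {f : X → Y} {L b c d : ℝ}
    (hL : 0 ≤ L) (hc : 0 < c) (hf : ∀ x y, ‖f x - f y‖ ≤ L * ‖x - y‖ + b)
    (hf' : ∀ x y, c * ‖x - y‖ - d ≤ ‖f x - f y‖) :
    ∃ T : X →ₗ[ℝ] Y, ∀ v, c / 2 * ‖v‖ ≤ ‖T v‖ ∧ ‖T v‖ ≤ (L + 1) * ‖v‖ := by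
  classical
  let e := Module.finBasis ℝ X
  let A := LinearMap.toContinuousLinearMap e.equivFun.toLinearMap
  set κ := ∑ i, ‖e i‖ with hκ
  set κ' := ∑ i, (L * ‖e i‖ + b) with hκ'
  obtain ⟨m, hm⟩ := exists_nat_gt
    (max 0 (max (L * κ + b + 1 + κ') (2 * (c * κ + 2 + κ') / c)))
  obtain ⟨hm0, hm1, hm2⟩ : (0 : ℝ) < m ∧ L * κ + b + 1 + κ' < m ∧
      2 * (c * κ + 2 + κ') / c < m := by simpa [max_lt_iff] using hm
  rw [div_lt_iff₀ hc] at hm2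
  obtain ⟨M, hM⟩ := exists_nat_gt (m * ‖A‖ + 1)
  let I : Finset (Fin (Module.finrank ℝ X) → ℤ) :=
    Fintype.piFinset fun _ => Finset.Icc (-(M : ℤ)) M
  have hbdd : ∀ u, ∃ c, ∀ x, ‖diffEnd Y u f x‖ ≤ c := fun u => ⟨_, norm_diffEnd_le hf u⟩
  obtain ⟨l, x, hlow, hadd⟩ := exists_averageEnd_diffEnd hf hf'
    (I.image fun k => ∑ i, k i • e i)
    (I.image fun k => diffEnd Y (∑ i, k i • e i) f - ∑ i, k i • diffEnd Y (e i) f)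
    (by
      simp only [Finset.mem_image]
      rintro _ ⟨k, -, rfl⟩
      exact diffEnd_sum_zsmul_sub_mem_meanNull f hbdd e k) one_pos
  let g : X → Y := fun u => averageEnd Y l (diffEnd Y u f) x
  have hg : ∀ u, ‖g u‖ ≤ L * ‖u‖ + b := fun u =>
    norm_averageEnd_le_of_le l (norm_diffEnd_le hf u) x
  let T : X →ₗ[ℝ] Y := e.constr ℝ fun i => g (e i)
  have hTe : ∀ i, T (e i) = g (e i) := fun i => e.constr_basis ℝ _ i
  have hT : ∀ k ∈ I, ‖g (∑ i, k i • e i) - T (∑ i, k i • e i)‖ ≤ 1 := fun k hk => by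
    have := hadd _ (Finset.mem_image_of_mem _ hk)
    simpa [g, hTe, map_sub, map_sum, map_zsmul] using this
  have hunit : ∀ v : X, ‖v‖ = 1 → c / 2 ≤ ‖T v‖ ∧ ‖T v‖ ≤ L + 1 := by
    intro v hv
    let k : Fin (Module.finrank ℝ X) → ℤ := fun i => ⌊(m : ℝ) * e.repr v i⌋
    have hcoord : ∀ i, |e.repr v i| ≤ ‖A‖ := fun i => by
      have h1 : ‖A v i‖ ≤ ‖A v‖ := norm_le_pi_norm _ i
      have h2 := A.le_opNorm v
      rw [hv, mul_one] at h2
      exact h1.trans h2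
    have hk : k ∈ I := by
      refine Fintype.mem_piFinset.2 fun i => Finset.mem_Icc.2 ?_
      have h1 := abs_le.1 (hcoord i)
      have h2 : (m : ℝ) * e.repr v i ≤ m * ‖A‖ := by gcongr; exact h1.2
      have h3 : (m : ℝ) * -‖A‖ ≤ m * e.repr v i := by gcongr; exact h1.1
      have h4 := Int.floor_le ((m : ℝ) * e.repr v i)
      have h5 := Int.lt_floor_add_one ((m : ℝ) * e.repr v i)
      constructor
      · have : (-(M : ℝ)) ≤ (k i : ℝ) := by simp only [k]; linarith
        exact_mod_cast this
      · have : (k i : ℝ) ≤ M := by simp only [k]; linarith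
        exact_mod_cast this
    set w := ∑ i, k i • e i with hw
    have hdiff : (m : ℝ) • v - w = ∑ i, Int.fract ((m : ℝ) * e.repr v i) • e i := by
      conv_lhs => rw [← e.sum_repr v, hw, Finset.smul_sum, ← Finset.sum_sub_distrib]
      refine Finset.sum_congr rfl fun i _ => ?_
      rw [smul_smul, ← Int.cast_smul_eq_zsmul ℝ, ← sub_smul]
      rfl
    have hfract : ∀ (i) (z : Y), ‖Int.fract ((m : ℝ) * e.repr v i) • z‖ ≤ ‖z‖ := fun i z => by
      rw [norm_smul, Real.norm_of_nonneg (Int.fract_nonneg _)]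
      exact mul_le_of_le_one_left (norm_nonneg _) (Int.fract_lt_one _).le
    have hfract' : ∀ (i) (z : X), ‖Int.fract ((m : ℝ) * e.repr v i) • z‖ ≤ ‖z‖ := fun i z => by
      rw [norm_smul, Real.norm_of_nonneg (Int.fract_nonneg _)]
      exact mul_le_of_le_one_left (norm_nonneg _) (Int.fract_lt_one _).le
    have h1 : ‖(m : ℝ) • v - w‖ ≤ κ := by
      rw [hdiff]
      exact norm_sum_le_of_le _ fun i _ => hfract' i _
    have h2 : ‖T ((m : ℝ) • v) - T w‖ ≤ κ' := by
      rw [← map_sub, hdiff, map_sum]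
      refine norm_sum_le_of_le _ fun i _ => ?_
      rw [map_smul, hTe]
      exact (hfract i _).trans (hg _)
    have h3 := hT k hk
    have h4 := hlow w (Finset.mem_image_of_mem _ hk)
    have h5 := hg w
    change _ ≤ ‖g w‖ at h4
    change ‖g w - T w‖ ≤ 1 at h3
    have hmv : ‖(m : ℝ) • v‖ = m := by rw [norm_smul, hv, Real.norm_of_nonneg hm0.le, mul_one]
    have hTmv : ‖T ((m : ℝ) • v)‖ = m * ‖T v‖ := by
      rw [map_smul, norm_smul, Real.norm_of_nonneg hm0.le]
    have h6 := abs_le.1 ((abs_norm_sub_norm_le _ _).trans h1)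
    have h7 := abs_le.1 ((abs_norm_sub_norm_le _ _).trans h2)
    have h8 := abs_le.1 ((abs_norm_sub_norm_le _ _).trans h3)
    rw [hmv] at h6
    rw [hTmv] at h7
    have h9 : c * (m - κ) ≤ c * ‖w‖ := by gcongr; linarith
    have h10 : L * ‖w‖ ≤ L * (m + κ) := by gcongr; linarith
    constructor
    · refine le_of_mul_le_mul_left ?_ hm0
      linarith
    · refine le_of_mul_le_mul_left ?_ hm0
      linarith
  refine ⟨T, fun v => ?_⟩
  rcases eq_or_ne v 0 with rfl | hv
  · simp
  have hv0 : 0 < ‖v‖ := norm_pos_iff.2 hv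
  have := hunit (‖v‖⁻¹ • v) (norm_smul_inv_norm (𝕜 := ℝ) hv)
  rwa [map_smul, norm_smul, norm_inv, norm_norm, le_inv_mul_iff₀ hv0, inv_mul_le_iff₀ hv0,
    mul_comm ‖v‖, mul_comm ‖v‖] at this

end CoarseLipschitz

/-- (Ribe) If `X` and `Y` are uniformly homeomorphic real Banach spaces, then there is a
uniform bound `C` such that every finite-dimensional subspace of `X` is `C`-isomorphic to
a subspace of `Y`. -/
theorem ribe_local_structure_of_uniformly_homeomorphic
    {X Y : Type*}
    [NormedAddCommGroup X] [NormedSpace ℝ X] [CompleteSpace X]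
    [NormedAddCommGroup Y] [NormedSpace ℝ Y] [CompleteSpace Y]
    (f : X ≃ Y) (hf : UniformContinuous f) (hf' : UniformContinuous f.symm) :
    ∃ C : ℝ, 1 ≤ C ∧
      ∀ E : Subspace ℝ X, FiniteDimensional ℝ E →
        ∃ F : Subspace ℝ Y, FiniteDimensional ℝ F ∧
          ∃ T : E ≃L[ℝ] F,
            ‖(T : E →L[ℝ] F)‖ * ‖(T.symm : F →L[ℝ] E)‖ ≤ C := by
  obtain ⟨L, b, hL, hLb⟩ := hf.exists_norm_sub_le
  obtain ⟨K, d, hK, hKd⟩ := hf'.exists_norm_sub_le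
  set c := (K + 1)⁻¹ with hc
  have hc0 : 0 < c := by positivity
  have hlow : ∀ x y, c * ‖x - y‖ - c * d ≤ ‖f x - f y‖ := fun x y => by
    have h := hKd (f x) (f y)
    rw [f.symm_apply_apply, f.symm_apply_apply] at h
    rw [← mul_sub, hc, inv_mul_le_iff₀ (by positivity)]
    linarith [norm_nonneg (f x - f y)]
  refine ⟨max 1 ((L + 1) * (c / 2)⁻¹), le_max_left _ _, fun E hE => ?_⟩
  obtain ⟨T, hT⟩ := exists_linearMap_of_coarse_bilipschitz (X := E) (f := fun x => f x) hL hc0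
    (fun x y => hLb x y) (fun x y => hlow x y)
  have hinj : Function.Injective T := (injective_iff_map_eq_zero T).2 fun v hv => by
    have h := (hT v).1
    rw [hv, norm_zero] at h
    exact norm_le_zero_iff.1 (nonpos_of_mul_nonpos_right h (half_pos hc0))
  let e := (LinearEquiv.ofInjective T hinj).toContinuousLinearEquiv
  have he : ∀ v, ‖e v‖ = ‖T v‖ := fun v => rfl
  refine ⟨LinearMap.range T, inferInstance, e, le_trans ?_ (le_max_right _ _)⟩
  refine mul_le_mul ?_ ?_ (ContinuousLinearMap.opNorm_nonneg _) (by positivity)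
  · exact ContinuousLinearMap.opNorm_le_bound _ (by positivity) fun v => (hT v).2
  · refine ContinuousLinearMap.opNorm_le_bound _ (by positivity) fun y => ?_
    have h := (hT (e.symm y)).1
    rw [← he, e.apply_symm_apply] at h
    exact (le_inv_mul_iff₀ (half_pos hc0)).2 h
end
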